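/- arXiv:2012.12860 — 8 statements merged into one kernel-verified Lean document; each statement's English description precedes it below -/
import Mathlib

section
/- Let Ω ⊊ ℝⁿ be a domain, n ≥ 2, 1 < p < ∞, and α + p > n. Then for every φ ∈ C_c^∞(Ω), ∫_Ω |∇φ|^p d_Ω^{−α} dx ≥ ((α+p−n)/p)^p ∫_Ω |φ|^p d_Ω^{−(p+α)} dx. -/
open MeasureTheory Metric Set

open scoped Topology NNReal

theorem abs_infDist_sub_le {E : Type*} [SeminormedAddCommGroup E] (A : Set E) (x y : E) :
    |infDist x A - infDist y A| ≤ ‖x - y‖ := by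
  simpa [Real.dist_eq, dist_eq_norm] using (lipschitz_infDist_pt A).dist_le_mul x y

section DistanceSquared

variable {E : Type*} [NormedAddCommGroup E] [InnerProductSpace ℝ E]

/-- The function `‖x‖ ^ 2 - dist(x, A) ^ 2` is midpoint convex. -/
theorem infDist_sq_add_infDist_sq_le [ProperSpace E] {A : Set E} (hA : IsClosed A)
    (hne : A.Nonempty) (x h : E) :
    infDist (x + h) A ^ 2 + infDist (x - h) A ^ 2 ≤ 2 * infDist x A ^ 2 + 2 * ‖h‖ ^ 2 := by
  obtain ⟨y, hy, hxy⟩ := hA.exists_infDist_eq_dist hne x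
  have h1 : infDist (x + h) A ≤ ‖(x - y) + h‖ := by
    have := infDist_le_dist_of_mem (x := x + h) hy
    rwa [dist_eq_norm, add_sub_right_comm] at this
  have h2 : infDist (x - h) A ≤ ‖(x - y) - h‖ := by
    have := infDist_le_dist_of_mem (x := x - h) hy
    rwa [dist_eq_norm, sub_right_comm] at this
  have h3 := parallelogram_law_with_norm ℝ (x - y) h
  rw [hxy, dist_eq_norm]
  have h4 := pow_le_pow_left₀ infDist_nonneg h1 2
  have h5 := pow_le_pow_left₀ infDist_nonneg h2 2
  linarith

theorem norm_fderiv_infDist_le (A : Set E) (x : E) :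
    ‖fderiv ℝ (fun z ↦ infDist z A) x‖ ≤ 1 := by
  simpa using norm_fderiv_le_of_lipschitz ℝ (lipschitz_infDist_pt A) (x₀ := x)

theorem one_le_norm_fderiv_infDist [ProperSpace E] {A : Set E} (hA : IsClosed A)
    (hne : A.Nonempty) {x : E} (hx : 0 < infDist x A)
    (hd : DifferentiableAt ℝ (fun z ↦ infDist z A) x) :
    1 ≤ ‖fderiv ℝ (fun z ↦ infDist z A) x‖ := by
  obtain ⟨y, hy, hxy⟩ := hA.exists_infDist_eq_dist hne x
  rw [dist_eq_norm] at hxy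
  have hslope := hd.hasFDerivAt.hasLineDerivAt (y - x)
  have hlim := hslope.tendsto_slope_zero_right
  have hev : ∀ᶠ t : ℝ in 𝓝[>] 0,
      t⁻¹ • (infDist (x + t • (y - x)) A - infDist x A) ≤ -‖x - y‖ := by
    filter_upwards [self_mem_nhdsWithin, Ioc_mem_nhdsGT (zero_lt_one' ℝ)] with t ht ht1
    have h1 : infDist (x + t • (y - x)) A ≤ (1 - t) * ‖x - y‖ := by
      have := infDist_le_dist_of_mem (x := x + t • (y - x)) hy
      rwa [dist_eq_norm, show x + t • (y - x) - y = (1 - t) • (x - y) by module, norm_smul,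
        Real.norm_of_nonneg (by linarith [ht1.2])] at this
    rw [smul_eq_mul, inv_mul_le_iff₀ ht, hxy]
    linarith
  have hle := le_of_tendsto hlim hev
  have hnorm := (fderiv ℝ (fun z ↦ infDist z A) x).le_opNorm (y - x)
  rw [Real.norm_eq_abs, norm_sub_rev y x] at hnorm
  have h3 := neg_abs_le (fderiv ℝ (fun z ↦ infDist z A) x (y - x))
  have hpos : 0 < ‖x - y‖ := hxy ▸ hx
  refine le_of_mul_le_mul_right ?_ hpos
  linarith

theorem norm_slope_mul_slope_infDist_sq_le (A : Set E) {η : E → ℝ} {C : ℝ≥0}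
    (hη : LipschitzWith C η) {v : E} (hv : ‖v‖ = 1) {t : ℝ} (ht : 0 < t) (ht1 : t ≤ 1) (x : E) :
    ‖(t⁻¹ * (η (x + t • v) - η x)) * (t⁻¹ * (infDist (x + t • v) A ^ 2 - infDist x A ^ 2))‖ ≤
      (cthickening 1 (tsupport η)).indicator (fun x ↦ (C : ℝ) * (2 * infDist x A + 1)) x := by
  have htv : ‖t • v‖ = t := by rw [norm_smul, hv, mul_one, Real.norm_of_nonneg ht.le]
  by_cases hx : x ∈ cthickening 1 (tsupport η)
  · rw [indicator_of_mem hx, norm_mul]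
    have h1 : ‖t⁻¹ * (η (x + t • v) - η x)‖ ≤ C := by
      have := hη.dist_le_mul (x + t • v) x
      rw [dist_eq_norm, dist_eq_norm, add_sub_cancel_left, htv] at this
      rw [norm_mul, norm_inv, Real.norm_of_nonneg ht.le, inv_mul_le_iff₀ ht]
      linarith
    have h2 : ‖t⁻¹ * (infDist (x + t • v) A ^ 2 - infDist x A ^ 2)‖ ≤ 2 * infDist x A + 1 := by
      have := abs_infDist_sub_le A (x + t • v) x
      rw [add_sub_cancel_left, htv] at this
      have h0 : 0 ≤ infDist x A := infDist_nonneg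
      have h0' : 0 ≤ infDist (x + t • v) A := infDist_nonneg
      have h3 := (abs_le.1 this).2
      rw [norm_mul, norm_inv, Real.norm_of_nonneg ht.le, inv_mul_le_iff₀ ht, sq_sub_sq, norm_mul,
        Real.norm_of_nonneg (add_nonneg h0' h0), Real.norm_eq_abs, mul_comm t]
      exact mul_le_mul (by linarith) this (abs_nonneg _) (by linarith)
    exact mul_le_mul h1 h2 (norm_nonneg _) C.2
  · have e1 : η x = 0 :=
      image_eq_zero_of_notMem_tsupport fun h ↦ hx (self_subset_cthickening _ h)
    have e2 : η (x + t • v) = 0 := by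
      refine image_eq_zero_of_notMem_tsupport fun h ↦ hx ?_
      refine mem_cthickening_of_dist_le x (x + t • v) 1 _ h ?_
      rwa [dist_eq_norm, sub_add_cancel_left, norm_neg, htv]
    simp [e1, e2, indicator_of_notMem hx]

end DistanceSquared

section DiscreteIntegration

variable {E : Type*} [NormedAddCommGroup E] [InnerProductSpace ℝ E] [FiniteDimensional ℝ E]
  [MeasurableSpace E] [BorelSpace E]

theorem integral_sub_mul_sub_eq {η f : E → ℝ} (hη : Continuous η)
    (hηc : HasCompactSupport η) (hf : Continuous f) (h : E) :
    ∫ x, (η (x + h) - η x) * (f (x + h) - f x) =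
      -∫ x, η x * (f (x + h) + f (x - h) - 2 * f x) := by
  have i0 : Integrable (fun x ↦ η x * f x) :=
    (hη.mul hf).integrable_of_hasCompactSupport hηc.mul_right
  have i1 : Integrable (fun x ↦ η x * f (x + h)) :=
    Continuous.integrable_of_hasCompactSupport (by fun_prop) hηc.mul_right
  have i2 : Integrable (fun x ↦ η x * f (x - h)) :=
    Continuous.integrable_of_hasCompactSupport (by fun_prop) hηc.mul_right
  have i3 : Integrable (fun x ↦ η (x + h) * f (x + h)) := i0.comp_add_right h
  have i4 : Integrable (fun x ↦ η (x + h) * f x) := by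
    simpa using i2.comp_add_right h
  have e3 : ∫ x, η (x + h) * f (x + h) = ∫ x, η x * f x :=
    integral_add_right_eq_self (fun x ↦ η x * f x) h
  have e4 : ∫ x, η (x + h) * f x = ∫ x, η x * f (x - h) := by
    simpa using integral_add_right_eq_self (fun x ↦ η x * f (x - h)) h
  have lhs : ∫ x, (η (x + h) - η x) * (f (x + h) - f x) =
      ∫ x, (η (x + h) * f (x + h) - η (x + h) * f x) - (η x * f (x + h) - η x * f x) := by
    congr 1; ext x; ring
  have rhs : ∫ x, η x * (f (x + h) + f (x - h) - 2 * f x) =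
      ∫ x, (η x * f (x + h) + η x * f (x - h)) - 2 * (η x * f x) := by
    congr 1; ext x; ring
  have i34 : Integrable fun x ↦ η (x + h) * f (x + h) - η (x + h) * f x := i3.sub i4
  have i10 : Integrable fun x ↦ η x * f (x + h) - η x * f x := i1.sub i0
  have i12 : Integrable fun x ↦ η x * f (x + h) + η x * f (x - h) := i1.add i2
  rw [lhs, rhs, integral_sub i34 i10, integral_sub i3 i4, integral_sub i1 i0,
    integral_sub i12 (i0.const_mul 2), integral_add i1 i2, integral_const_mul, e3, e4]
  ring

theorem neg_two_mul_integral_le_integral_slope {A : Set E} (hA : IsClosed A) (hne : A.Nonempty)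
    {η : E → ℝ} (hη : Continuous η) (hηc : HasCompactSupport η) (hη0 : ∀ x, 0 ≤ η x)
    {v : E} (hv : ‖v‖ = 1) {t : ℝ} (ht : 0 < t) :
    -(2 * ∫ x, η x) ≤ ∫ x, (t⁻¹ * (η (x + t • v) - η x)) *
      (t⁻¹ * (infDist (x + t • v) A ^ 2 - infDist x A ^ 2)) := by
  have hf : Continuous fun x ↦ infDist x A ^ 2 := (continuous_infDist_pt A).pow 2
  have e : ∫ x, (t⁻¹ * (η (x + t • v) - η x)) *
      (t⁻¹ * (infDist (x + t • v) A ^ 2 - infDist x A ^ 2)) =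
      t⁻¹ ^ 2 * ∫ x, (η (x + t • v) - η x) *
        (infDist (x + t • v) A ^ 2 - infDist x A ^ 2) := by
    rw [← integral_const_mul]
    congr 1; ext x; ring
  rw [e, integral_sub_mul_sub_eq hη hηc hf]
  have hle : ∫ x, η x * (infDist (x + t • v) A ^ 2 + infDist (x - t • v) A ^ 2 -
      2 * infDist x A ^ 2) ≤ ∫ x, (2 * t ^ 2) * η x := by
    refine integral_mono (Continuous.integrable_of_hasCompactSupport (by fun_prop) hηc.mul_right)
      ((hη.integrable_of_hasCompactSupport hηc).const_mul _) fun x ↦ ?_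
    have h1 := infDist_sq_add_infDist_sq_le hA hne x (t • v)
    rw [norm_smul, hv, mul_one, Real.norm_of_nonneg ht.le] at h1
    have := mul_le_mul_of_nonneg_left (a := η x)
      (show infDist (x + t • v) A ^ 2 + infDist (x - t • v) A ^ 2 - 2 * infDist x A ^ 2
        ≤ 2 * t ^ 2 by linarith) (hη0 x)
    simpa [mul_comm] using this
  rw [integral_const_mul] at hle
  have := mul_le_mul_of_nonneg_left hle (by positivity : 0 ≤ t⁻¹ ^ 2)
  have e2 : t⁻¹ ^ 2 * (2 * t ^ 2 * ∫ x, η x) = 2 * ∫ x, η x := by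
    field_simp
  linarith

/-- Weak form of `Δ (dist(·, A) ^ 2) ≤ 2 n`, one direction at a time. -/
theorem neg_two_mul_integral_le_integral_fderiv {A : Set E} (hA : IsClosed A) (hne : A.Nonempty)
    {η : E → ℝ} {C : ℝ≥0} (hη : LipschitzWith C η) (hηc : HasCompactSupport η)
    (hη0 : ∀ x, 0 ≤ η x) {v : E} (hv : ‖v‖ = 1) :
    Integrable (fun x ↦ fderiv ℝ η x v * fderiv ℝ (fun z ↦ infDist z A ^ 2) x v) ∧
    -(2 * ∫ x, η x) ≤ ∫ x, fderiv ℝ η x v * fderiv ℝ (fun z ↦ infDist z A ^ 2) x v := by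
  have hηcont := hη.continuous
  have hd : Continuous fun x ↦ infDist x A := continuous_infDist_pt A
  have hK : IsCompact (cthickening 1 (tsupport η)) := hηc.cthickening
  have hbint : Integrable
      ((cthickening 1 (tsupport η)).indicator fun x ↦ (C : ℝ) * (2 * infDist x A + 1)) := by
    rw [integrable_indicator_iff hK.measurableSet]
    exact ContinuousOn.integrableOn_compact hK (by fun_prop)
  have hev : ∀ᶠ t : ℝ in 𝓝[>] 0, 0 < t ∧ t ≤ 1 := Ioc_mem_nhdsGT (zero_lt_one' ℝ)
  have hlim : ∀ᵐ x, Filter.Tendsto (fun t : ℝ ↦ (t⁻¹ * (η (x + t • v) - η x)) *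
      (t⁻¹ * (infDist (x + t • v) A ^ 2 - infDist x A ^ 2))) (𝓝[>] 0)
      (𝓝 (fderiv ℝ η x v * fderiv ℝ (fun z ↦ infDist z A ^ 2) x v)) := by
    filter_upwards [hη.ae_differentiableAt, (lipschitz_infDist_pt A).ae_differentiableAt]
      with x h1 h2
    have h3 : DifferentiableAt ℝ (fun z ↦ infDist z A ^ 2) x := h2.pow 2
    exact (h1.hasFDerivAt.hasLineDerivAt v).tendsto_slope_zero_right.mul
      (h3.hasFDerivAt.hasLineDerivAt v).tendsto_slope_zero_right
  constructor
  · refine hbint.mono' ((measurable_fderiv_apply_const ℝ η v).mul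
      (measurable_fderiv_apply_const ℝ _ v)).aestronglyMeasurable ?_
    filter_upwards [hlim] with x hx
    refine le_of_tendsto hx.norm ?_
    filter_upwards [hev] with t ht
    exact norm_slope_mul_slope_infDist_sq_le A hη hv ht.1 ht.2 x
  · refine ge_of_tendsto (tendsto_integral_filter_of_dominated_convergence _ ?_ ?_ hbint hlim) ?_
    · filter_upwards with t
      exact Continuous.aestronglyMeasurable (by fun_prop)
    · filter_upwards [hev] with t ht
      exact .of_forall fun x ↦ norm_slope_mul_slope_infDist_sq_le A hη hv ht.1 ht.2 x
    · filter_upwards [hev] with t ht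
      exact neg_two_mul_integral_le_integral_slope hA hne hηcont hηc hη0 hv ht.1

end DiscreteIntegration

theorem young_rpow_sub_le {p c a b : ℝ} (hp : 1 < p) (hc : 0 ≤ c) (ha : 0 ≤ a) (hb : 0 ≤ b) :
    p * c ^ (p - 1) * (b ^ (p - 1) * a) - (p - 1) * c ^ p * b ^ p ≤ a ^ p := by
  have hp0 : 0 < p := by linarith
  have hp1 : 0 < p - 1 := by linarith
  have hcb : 0 ≤ c * b := mul_nonneg hc hb
  have hpq : p.HolderConjugate (p / (p - 1)) := Real.HolderConjugate.conjExponent hp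
  have h := Real.young_inequality_of_nonneg ha (Real.rpow_nonneg hcb (p - 1)) hpq
  rw [← Real.rpow_mul hcb, show (p - 1) * (p / (p - 1)) = p by field_simp,
    Real.mul_rpow hc hb, Real.mul_rpow hc hb] at h
  have h2 := mul_le_mul_of_nonneg_left h hp0.le
  have e : p * (a ^ p / p + c ^ p * b ^ p / (p / (p - 1))) =
      a ^ p + (p - 1) * c ^ p * b ^ p := by field_simp
  rw [e] at h2
  linarith

theorem weighted_young_rpow_sub_le {p α c a b w : ℝ} (hp : 1 < p) (hc : 0 ≤ c) (ha : 0 ≤ a)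
    (hb : 0 ≤ b) (hw : 0 < w) :
    p * c ^ (p - 1) * (b ^ (p - 1) * a * w ^ (1 - (p + α))) -
      (p - 1) * c ^ p * (b ^ p * w ^ (-(p + α))) ≤ a ^ p * w ^ (-α) := by
  have h := mul_le_mul_of_nonneg_right
    (young_rpow_sub_le hp hc ha (div_nonneg hb hw.le)) (Real.rpow_nonneg hw.le (-α))
  have e1 : w ^ (1 - (p + α)) = w ^ (-α) / w ^ (p - 1) := by
    rw [← Real.rpow_sub hw]; ring_nf
  have e2 : w ^ (-(p + α)) = w ^ (-α) / w ^ p := by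
    rw [← Real.rpow_sub hw]; ring_nf
  rw [Real.div_rpow hb hw.le, Real.div_rpow hb hw.le] at h
  rw [e1, e2]
  refine le_trans (le_of_eq ?_) h
  ring

theorem exists_lipschitzWith_max_rpow {m : ℝ} (hm : 0 < m) (s : ℝ) (hs : 0 ≤ s) :
    ∃ C : ℝ≥0, LipschitzWith C fun r : ℝ ↦ max r m ^ (-s) := by
  have hon : LipschitzOnWith (Real.toNNReal (s * m ^ (-s - 1))) (fun r : ℝ ↦ r ^ (-s))
      (Ici m) := by
    refine (convex_Ici m).lipschitzOnWith_of_nnnorm_deriv_le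
      (fun x hx ↦ Real.differentiableAt_rpow_const_of_ne _ (hm.trans_le hx).ne') fun x hx ↦ ?_
    have hx0 : 0 < x := hm.trans_le hx
    rw [Real.deriv_rpow_const, ← NNReal.coe_le_coe, coe_nnnorm,
      Real.coe_toNNReal _ (by positivity), norm_mul, norm_neg,
      Real.norm_of_nonneg hs, Real.norm_of_nonneg (by positivity)]
    exact mul_le_mul_of_nonneg_left
      (Real.rpow_le_rpow_of_nonpos hm hx (by linarith)) hs
  refine ⟨Real.toNNReal (s * m ^ (-s - 1)), LipschitzWith.of_dist_le_mul fun a b ↦ ?_⟩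
  refine (hon.dist_le_mul _ (le_max_right a m) _ (le_max_right b m)).trans ?_
  refine mul_le_mul_of_nonneg_left ?_ NNReal.zero_le_coe
  simpa using (LipschitzWith.id.max_const m).dist_le_mul a b

theorem LipschitzWith.exists_lipschitzWith_mul {X : Type*} [PseudoMetricSpace X] {f g : X → ℝ}
    {C D : ℝ≥0} (hf : LipschitzWith C f) (hg : LipschitzWith D g) {M N : ℝ≥0}
    (hM : ∀ x, |f x| ≤ M) (hN : ∀ x, |g x| ≤ N) :
    ∃ K : ℝ≥0, LipschitzWith K fun x ↦ f x * g x := by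
  refine ⟨M * D + N * C, LipschitzWith.of_dist_le_mul fun x y ↦ ?_⟩
  have h1 := hf.dist_le_mul x y
  have h2 := hg.dist_le_mul x y
  rw [Real.dist_eq] at *
  have e : f x * g x - f y * g y = f x * (g x - g y) + (f x - f y) * g y := by ring
  rw [e]
  refine (abs_add_le _ _).trans ?_
  rw [abs_mul, abs_mul]
  have h3 := mul_le_mul (hM x) h2 (abs_nonneg _) M.2
  have h4 := mul_le_mul h1 (hN y) (abs_nonneg _) (by positivity)
  push_cast
  linarith

section Hardy

variable {E : Type*} [NormedAddCommGroup E] [InnerProductSpace ℝ E] [FiniteDimensional ℝ E]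

theorem OrthonormalBasis.sum_apply_mul_apply {ι : Type*} [Fintype ι]
    (b : OrthonormalBasis ι ℝ E) (L M : StrongDual ℝ E) :
    ∑ i, L (b i) * M (b i) =
      inner ℝ ((InnerProductSpace.toDual ℝ E).symm L) ((InnerProductSpace.toDual ℝ E).symm M) := by
  rw [← b.sum_inner_mul_inner]
  refine Finset.sum_congr rfl fun i _ ↦ ?_
  rw [InnerProductSpace.toDual_symm_apply, real_inner_comm, InnerProductSpace.toDual_symm_apply]

theorem sum_fderiv_mul_rpow_mul_fderiv_infDist_sq_le {A : Set E} (hA : IsClosed A)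
    (hne : A.Nonempty) {ψ : E → ℝ} {m s : ℝ} (hm : 0 < m)
    (hmK : ∀ x ∈ tsupport ψ, m < infDist x A) {ι : Type*} [Fintype ι]
    (b : OrthonormalBasis ι ℝ E) {x : E} (hψ : DifferentiableAt ℝ ψ x)
    (hd : DifferentiableAt ℝ (fun z ↦ infDist z A) x) :
    ∑ i, fderiv ℝ (fun z ↦ ψ z * max (infDist z A) m ^ (-s)) x (b i) *
        fderiv ℝ (fun z ↦ infDist z A ^ 2) x (b i) ≤
      2 * (‖fderiv ℝ ψ x‖ * max (infDist x A) m ^ (1 - s)) -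
        2 * s * (ψ x * max (infDist x A) m ^ (-s)) := by
  by_cases hx : x ∈ tsupport ψ
  · have hmx := hmK x hx
    have hpos : 0 < infDist x A := hm.trans hmx
    set d := infDist x A
    set D := fderiv ℝ (fun z ↦ infDist z A) x
    set P := fderiv ℝ ψ x
    have hsq : HasFDerivAt (fun z ↦ infDist z A ^ 2) ((2 * d) • D) x := by
      simpa using hd.hasFDerivAt.pow 2
    have hw : HasFDerivAt (fun z ↦ infDist z A ^ (-s)) ((-s * d ^ (-s - 1)) • D) x :=
      hd.hasFDerivAt.rpow_const (Or.inl hpos.ne')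
    have hη : HasFDerivAt (fun z ↦ ψ z * max (infDist z A) m ^ (-s))
        (ψ x • ((-s * d ^ (-s - 1)) • D) + d ^ (-s) • P) x := by
      refine (hψ.hasFDerivAt.mul hw).congr_of_eventuallyEq ?_
      filter_upwards [(continuous_infDist_pt A).continuousAt.eventually (lt_mem_nhds hmx)]
        with z hz
      rw [max_eq_left (le_of_lt hz), Pi.mul_apply]
    rw [hη.fderiv, hsq.fderiv, max_eq_left hmx.le]
    have e1 : d ^ (1 - s) = d * d ^ (-s) := by
      rw [sub_eq_add_neg, Real.rpow_add hpos, Real.rpow_one]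
    have e2 : d ^ (-s - 1) * d = d ^ (-s) := by
      rw [Real.rpow_sub_one hpos.ne', div_mul_cancel₀ _ hpos.ne']
    have hsum : ∑ i, (ψ x • ((-s * d ^ (-s - 1)) • D) + d ^ (-s) • P) (b i) *
        ((2 * d) • D) (b i) =
        2 * d ^ (1 - s) * ∑ i, P (b i) * D (b i) -
          2 * s * (ψ x * d ^ (-s)) * ∑ i, D (b i) * D (b i) := by
      rw [Finset.mul_sum, Finset.mul_sum, ← Finset.sum_sub_distrib]
      refine Finset.sum_congr rfl fun i _ ↦ ?_
      simp only [add_apply, smul_apply, smul_eq_mul]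
      rw [e1, ← e2]
      ring
    rw [hsum, b.sum_apply_mul_apply, b.sum_apply_mul_apply, real_inner_self_eq_norm_sq,
      LinearIsometryEquiv.norm_map]
    have hD1 : 1 ≤ ‖D‖ := one_le_norm_fderiv_infDist hA hne hpos hd
    have hD2 : ‖D‖ ≤ 1 := norm_fderiv_infDist_le A x
    have hinner : inner ℝ ((InnerProductSpace.toDual ℝ E).symm P)
        ((InnerProductSpace.toDual ℝ E).symm D) ≤ ‖P‖ := by
      refine (real_inner_le_norm _ _).trans ?_
      rw [LinearIsometryEquiv.norm_map, LinearIsometryEquiv.norm_map]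
      exact mul_le_of_le_one_right (norm_nonneg _) hD2
    rw [le_antisymm hD2 hD1]
    have := mul_le_mul_of_nonneg_left hinner (by positivity : 0 ≤ 2 * d ^ (1 - s))
    linarith
  · have h0 : ψ =ᶠ[𝓝 x] 0 := notMem_tsupport_iff_eventuallyEq.1 hx
    have h1 : fderiv ℝ (fun z ↦ ψ z * max (infDist z A) m ^ (-s)) x = 0 := by
      have : (fun z ↦ ψ z * max (infDist z A) m ^ (-s)) =ᶠ[𝓝 x] fun _ ↦ 0 := by
        filter_upwards [h0] with z hz
        simp [hz]
      rw [this.fderiv_eq, fderiv_fun_const]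
      rfl
    have h2 : ψ x = 0 := h0.self_of_nhds
    simp only [h1, h2, zero_apply, zero_mul, Finset.sum_const_zero, mul_zero, sub_zero]
    positivity

variable [MeasurableSpace E] [BorelSpace E]

theorem sub_finrank_mul_integral_le_integral_norm_fderiv {A : Set E} (hA : IsClosed A)
    (hne : A.Nonempty) {ψ : E → ℝ} (hψ : ContDiff ℝ 1 ψ) (hψc : HasCompactSupport ψ)
    (hψ0 : ∀ x, 0 ≤ ψ x) {m s : ℝ} (hm : 0 < m) (hs : 0 ≤ s)
    (hmK : ∀ x ∈ tsupport ψ, m < infDist x A) :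
    (s - Module.finrank ℝ E) * ∫ x, ψ x * max (infDist x A) m ^ (-s) ≤
      ∫ x, ‖fderiv ℝ ψ x‖ * max (infDist x A) m ^ (1 - s) := by
  set w : E → ℝ := fun x ↦ max (infDist x A) m
  have hwc : Continuous w := (continuous_infDist_pt A).max continuous_const
  have hwpos : ∀ x, 0 < w x := fun x ↦ hm.trans_le (le_max_right _ _)
  have hwr : ∀ r : ℝ, Continuous fun x ↦ w x ^ r := fun r ↦
    hwc.rpow_const fun x ↦ Or.inl (hwpos x).ne'
  obtain ⟨C, hC⟩ := hψ.lipschitzWith_of_hasCompactSupport hψc one_ne_zero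
  obtain ⟨D, hD⟩ := exists_lipschitzWith_max_rpow hm s hs
  obtain ⟨M, hM⟩ := hψc.exists_bound_of_continuous hψ.continuous
  obtain ⟨K, hK⟩ : ∃ K : ℝ≥0, LipschitzWith K fun x ↦ ψ x * w x ^ (-s) := by
    refine hC.exists_lipschitzWith_mul (hD.comp (lipschitz_infDist_pt A))
      (M := M.toNNReal) (N := (m ^ (-s)).toNNReal)
      (fun x ↦ (hM x).trans (Real.le_coe_toNNReal M)) fun x ↦ ?_
    rw [Real.coe_toNNReal _ (by positivity),
      abs_of_nonneg (Real.rpow_nonneg (hwpos x).le _)]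
    exact Real.rpow_le_rpow_of_nonpos hm (le_max_right _ _) (by linarith)
  have hηc : HasCompactSupport fun x ↦ ψ x * w x ^ (-s) := hψc.mul_right
  have hη0 : ∀ x, 0 ≤ ψ x * w x ^ (-s) := fun x ↦
    mul_nonneg (hψ0 x) (Real.rpow_nonneg (hwpos x).le _)
  have hηi : Integrable fun x ↦ ψ x * w x ^ (-s) :=
    hK.continuous.integrable_of_hasCompactSupport hηc
  have hgi : Integrable fun x ↦ ‖fderiv ℝ ψ x‖ * w x ^ (1 - s) :=
    ((hψ.continuous_fderiv one_ne_zero).norm.mul (hwr _)).integrable_of_hasCompactSupport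
      (hψc.fderiv ℝ).norm.mul_right
  set b := stdOrthonormalBasis ℝ E
  have hdir := fun i ↦ neg_two_mul_integral_le_integral_fderiv hA hne hK hηc hη0
    (b.norm_eq_one i)
  have hsum := Finset.sum_le_sum fun i (_ : i ∈ Finset.univ) ↦ (hdir i).2
  rw [← integral_finsetSum _ fun i _ ↦ (hdir i).1, Finset.sum_const, Finset.card_univ,
    Fintype.card_fin, nsmul_eq_mul] at hsum
  have hle := integral_mono_ae (integrable_finsetSum Finset.univ fun i _ ↦ (hdir i).1)
    ((hgi.const_mul 2).sub (hηi.const_mul (2 * s))) (by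
      filter_upwards [(lipschitz_infDist_pt A).ae_differentiableAt] with x hx
      exact sum_fderiv_mul_rpow_mul_fderiv_infDist_sq_le hA hne hm hmK b
        (hψ.differentiable one_ne_zero x) hx)
  have hint := integral_sub (hgi.const_mul 2) (hηi.const_mul (2 * s))
  rw [integral_const_mul, integral_const_mul] at hint
  have := hsum.trans (hle.trans_eq hint)
  linarith

theorem hardy_infDist_of_lt_on_tsupport {A : Set E} (hA : IsClosed A) (hne : A.Nonempty)
    {φ : E → ℝ} (hφ : ContDiff ℝ 1 φ) (hφc : HasCompactSupport φ) {p α m : ℝ} (hp : 1 < p)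
    (hα : Module.finrank ℝ E < α + p) (hm : 0 < m) (hmK : ∀ x ∈ tsupport φ, m < infDist x A) :
    ((α + p - Module.finrank ℝ E) / p) ^ p *
        ∫ x, |φ x| ^ p * max (infDist x A) m ^ (-(p + α)) ≤
      ∫ x, ‖fderiv ℝ φ x‖ ^ p * max (infDist x A) m ^ (-α) := by
  set w : E → ℝ := fun x ↦ max (infDist x A) m
  have hwc : Continuous w := (continuous_infDist_pt A).max continuous_const
  have hwpos : ∀ x, 0 < w x := fun x ↦ hm.trans_le (le_max_right _ _)
  have hwr : ∀ r : ℝ, Continuous fun x ↦ w x ^ r := fun r ↦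
    hwc.rpow_const fun x ↦ Or.inl (hwpos x).ne'
  have hp0 : 0 < p := by linarith
  set c := (α + p - Module.finrank ℝ E) / p with hc
  have hcpos : 0 < c := div_pos (by linarith) hp0
  have hs : 0 ≤ p + α := by
    have : (0 : ℝ) ≤ Module.finrank ℝ E := Nat.cast_nonneg _
    linarith
  have hdφ := (hφ.continuous_fderiv one_ne_zero).norm
  have hdφc : HasCompactSupport fun x ↦ ‖fderiv ℝ φ x‖ := (hφc.fderiv ℝ).norm
  have hψ : ContDiff ℝ 1 fun x ↦ |φ x| ^ p := hφ.norm_rpow hp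
  have hψsupp : tsupport (fun x ↦ |φ x| ^ p) ⊆ tsupport φ :=
    closure_mono fun x hx hx0 ↦ hx (by simp [hx0, hp0.ne'])
  have hψc : HasCompactSupport fun x ↦ |φ x| ^ p :=
    hφc.of_isClosed_subset (isClosed_tsupport _) hψsupp
  have hFi : Integrable fun x ↦ |φ x| ^ p * w x ^ (-(p + α)) :=
    (hψ.continuous.mul (hwr _)).integrable_of_hasCompactSupport hψc.mul_right
  have hGi : Integrable fun x ↦ ‖fderiv ℝ φ x‖ ^ p * w x ^ (-α) := by
    refine ((hdφ.rpow_const fun x ↦ Or.inr hp0.le).mul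
      (hwr _)).integrable_of_hasCompactSupport (HasCompactSupport.mul_right ?_)
    exact hdφc.comp_left (g := fun r : ℝ ↦ r ^ p) (Real.zero_rpow hp0.ne')
  have hIi : Integrable fun x ↦ |φ x| ^ (p - 1) * ‖fderiv ℝ φ x‖ * w x ^ (1 - (p + α)) := by
    refine (((hφ.continuous.abs.rpow_const fun x ↦ Or.inr (by linarith)).mul hdφ).mul
      (hwr _)).integrable_of_hasCompactSupport (HasCompactSupport.mul_right ?_)
    exact hdφc.mul_left
  have hψi : Integrable fun x ↦
      ‖fderiv ℝ (fun z ↦ |φ z| ^ p) x‖ * w x ^ (1 - (p + α)) :=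
    ((hψ.continuous_fderiv one_ne_zero).norm.mul (hwr _)).integrable_of_hasCompactSupport
      (hψc.fderiv ℝ).norm.mul_right
  have h1 := sub_finrank_mul_integral_le_integral_norm_fderiv hA hne hψ hψc
    (fun x ↦ Real.rpow_nonneg (abs_nonneg _) _) hm hs fun x hx ↦ hmK x (hψsupp hx)
  have h2 : ∫ x, ‖fderiv ℝ (fun z ↦ |φ z| ^ p) x‖ * w x ^ (1 - (p + α)) ≤
      ∫ x, p * (|φ x| ^ (p - 1) * ‖fderiv ℝ φ x‖ * w x ^ (1 - (p + α))) := by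
    refine integral_mono hψi (hIi.const_mul p) fun x ↦ ?_
    have := mul_le_mul_of_nonneg_right
      (norm_fderiv_norm_rpow_le (hφ.differentiable one_ne_zero) (x := x) hp)
      (Real.rpow_nonneg (hwpos x).le (1 - (p + α)))
    simpa [mul_assoc] using this
  have h3 := integral_mono ((hIi.const_mul (p * c ^ (p - 1))).sub
    (hFi.const_mul ((p - 1) * c ^ p))) hGi fun x ↦
      weighted_young_rpow_sub_le (α := α) hp hcpos.le (norm_nonneg (fderiv ℝ φ x))
        (abs_nonneg (φ x)) (hwpos x)
  have h4 := integral_sub (hIi.const_mul (p * c ^ (p - 1))) (hFi.const_mul ((p - 1) * c ^ p))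
  rw [integral_const_mul, integral_const_mul] at h4
  have h5 := h4.symm.trans_le h3
  rw [integral_const_mul] at h2
  have h6 := mul_le_mul_of_nonneg_left (h1.trans h2) (Real.rpow_nonneg hcpos.le (p - 1))
  have e1 : p + α - Module.finrank ℝ E = p * c := by rw [hc]; field_simp; ring
  have e2 : c ^ p = c ^ (p - 1) * c := by
    rw [Real.rpow_sub_one hcpos.ne', div_mul_cancel₀ _ hcpos.ne']
  rw [e1] at h6
  rw [e2] at h5 ⊢
  linarith

end Hardy

theorem stmt_5 (n : ℕ) (hn : 2 ≤ n) (p α : ℝ) (hp1 : 1 < p)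
    (hα : (n : ℝ) < α + p) (Ω : Set (EuclideanSpace ℝ (Fin n)))
    (hΩopen : IsOpen Ω) (hΩconn : IsConnected Ω) (hΩne : Ω.Nonempty)
    (hΩproper : Ω ≠ Set.univ)
    (φ : EuclideanSpace ℝ (Fin n) → ℝ) (hφ : ContDiff ℝ (⊤ : ℕ∞) φ)
    (hφc : HasCompactSupport φ) (hφsupp : tsupport φ ⊆ Ω) :
    ∫ x in Ω, ‖fderiv ℝ φ x‖ ^ p * (infDist x (frontier Ω)) ^ (-α) ≥
      ((α + p - n) / p) ^ p *
        ∫ x in Ω, |φ x| ^ p * (infDist x (frontier Ω)) ^ (-(p + α)) := by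
  have hA : IsClosed (frontier Ω) := isClosed_frontier
  have hne : (frontier Ω).Nonempty := nonempty_frontier_iff.2 ⟨hΩne, hΩproper⟩
  have hp0 : p ≠ 0 := by linarith
  have hpos : ∀ x ∈ tsupport φ, 0 < infDist x (frontier Ω) := fun x hx ↦
    (hA.notMem_iff_infDist_pos hne).1 fun hxf ↦
      (hΩopen.frontier_eq ▸ hxf).2 (hφsupp hx)
  obtain ⟨m', hm', hmK⟩ := hφc.isCompact.exists_forall_le'
    (continuous_infDist_pt (frontier Ω)).continuousOn hpos
  have hmK' : ∀ x ∈ tsupport φ, m' / 2 < infDist x (frontier Ω) := fun x hx ↦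
    (half_lt_self hm').trans_le (hmK x hx)
  have key := hardy_infDist_of_lt_on_tsupport hA hne (hφ.of_le (by simp)) hφc hp1
    (by simpa using hα) (half_pos hm') hmK'
  rw [finrank_euclideanSpace_fin] at key
  have hset : ∀ (g : EuclideanSpace ℝ (Fin n) → ℝ) (r : ℝ), (∀ x ∉ tsupport φ, g x = 0) →
      ∫ x in Ω, g x * infDist x (frontier Ω) ^ r =
        ∫ x, g x * max (infDist x (frontier Ω)) (m' / 2) ^ r := by
    intro g r hg
    rw [setIntegral_eq_integral_of_forall_compl_eq_zero fun x hx ↦ by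
      rw [hg x fun h ↦ hx (hφsupp h), zero_mul]]
    congr 1
    ext x
    by_cases hx : x ∈ tsupport φ
    · rw [max_eq_left (hmK' x hx).le]
    · rw [hg x hx, zero_mul, zero_mul]
  rw [hset (fun x ↦ ‖fderiv ℝ φ x‖ ^ p) _ fun x hx ↦ ?_, hset (fun x ↦ |φ x| ^ p) _ fun x hx ↦ ?_]
  · exact key
  · simp [image_eq_zero_of_notMem_tsupport hx, hp0]
  · have : fderiv ℝ φ x = 0 :=
      image_eq_zero_of_notMem_tsupport fun h ↦ hx (tsupport_fderiv_subset ℝ h)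
    simp [this, hp0]
end

section
/- Let Ω ⊊ ℝⁿ be a domain and d_Ω(x) = dist(x, ∂Ω). Then the distributional inequality −Δd_Ω ≥ −(n−1)/d_Ω holds in Ω; that is, for every nonnegative ψ ∈ C_c^∞(Ω), −∫_Ω d_Ω Δψ dx ≥ −(n−1) ∫_Ω ψ/d_Ω dx. -/
open MeasureTheory Metric Set

open Filter Topology

section SecondDifference

variable {E : Type*} [NormedAddCommGroup E]

/-- The symmetric second difference of `f` at `x` with step `v`. -/
def secondDifference (f : E → ℝ) (v x : E) : ℝ := f (x + v) + f (x - v) - 2 * f x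

theorem Continuous.secondDifference {f : E → ℝ} (hf : Continuous f) (v : E) :
    Continuous (secondDifference f v) := by
  unfold _root_.secondDifference
  fun_prop

theorem integral_mul_secondDifference [MeasurableSpace E] [BorelSpace E] {μ : Measure E}
    [μ.IsAddRightInvariant] [IsFiniteMeasureOnCompacts μ] {f g : E → ℝ}
    (hf : Continuous f) (hfc : HasCompactSupport f) (hg : Continuous g) (v : E) :
    ∫ x, g x * secondDifference f v x ∂μ = ∫ x, f x * secondDifference g v x ∂μ := by
  have hfadd (w : E) : HasCompactSupport fun x => f (x + w) :=
    hfc.comp_homeomorph (Homeomorph.addRight w)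
  have hint (w : E) : Integrable (fun x => g x * f (x + w)) μ :=
    (by fun_prop : Continuous fun x => g x * f (x + w)).integrable_of_hasCompactSupport
      ((hfadd w).mul_left)
  have hint' (w : E) : Integrable (fun x => f x * g (x + w)) μ :=
    (by fun_prop : Continuous fun x => f x * g (x + w)).integrable_of_hasCompactSupport
      hfc.mul_right
  have hshift (w : E) : ∫ x, g x * f (x + w) ∂μ = ∫ x, f x * g (x + -w) ∂μ := by
    rw [← integral_add_right_eq_self (fun x => f x * g (x + -w)) w]
    simp only [add_neg_cancel_right, mul_comm]
  have hl : (fun x => g x * secondDifference f v x) = fun x =>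
      g x * f (x + v) + g x * f (x + -v) - 2 * (g x * f (x + 0)) := by
    ext x
    simp only [secondDifference, sub_eq_add_neg, add_zero]
    ring
  have hr : (fun x => f x * secondDifference g v x) = fun x =>
      f x * g (x + v) + f x * g (x + -v) - 2 * (f x * g (x + 0)) := by
    ext x
    simp only [secondDifference, sub_eq_add_neg, add_zero]
    ring
  rw [hl, hr, integral_sub (by exact (hint _).add (hint _)) ((hint _).const_mul _),
    integral_add (hint _) (hint _), integral_const_mul,
    integral_sub (by exact (hint' _).add (hint' _)) ((hint' _).const_mul _),
    integral_add (hint' _) (hint' _), integral_const_mul, hshift, hshift, hshift]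
  simp only [neg_neg, neg_zero]
  ring

variable [NormedSpace ℝ E]

theorem hasDerivAt_secondDifference_smul {f : E → ℝ} (hf : Differentiable ℝ f) (v x : E) (t : ℝ) :
    HasDerivAt (fun s : ℝ => secondDifference f (s • v) x)
      (fderiv ℝ f (x + t • v) v - fderiv ℝ f (x - t • v) v) t := by
  have hlin : HasDerivAt (fun s : ℝ => s • v) v t := by
    simpa using (hasDerivAt_id t).smul_const v
  have hadd : HasDerivAt (fun s : ℝ => f (x + s • v)) (fderiv ℝ f (x + t • v) v) t :=
    (hf _).hasFDerivAt.comp_hasDerivAt t (hlin.const_add x)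
  have hsub : HasDerivAt (fun s : ℝ => f (x - s • v)) (fderiv ℝ f (x - t • v) (-v)) t :=
    (hf _).hasFDerivAt.comp_hasDerivAt t (hlin.const_sub x)
  simpa [sub_eq_add_neg, secondDifference] using (hadd.add hsub).sub_const (2 * f x)

theorem tendsto_secondDifference_smul_div_sq {f : E → ℝ} (hf : ContDiff ℝ 2 f) (v x : E) :
    Tendsto (fun t : ℝ => secondDifference f (t • v) x / t ^ 2) (𝓝[>] 0)
      (𝓝 (fderiv ℝ (fun y => fderiv ℝ f y v) x v)) := by
  have hfd : Differentiable ℝ f := hf.differentiable (by norm_num)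
  have hχ : Differentiable ℝ fun y => fderiv ℝ f y v :=
    ((hf.fderiv_right (m := 1) (by norm_num)).clm_apply contDiff_const).differentiable
      (by norm_num)
  have hline : HasDerivAt (fun s : ℝ => fderiv ℝ f (x + s • v) v - fderiv ℝ f (x - s • v) v)
      (2 * fderiv ℝ (fun y => fderiv ℝ f y v) x v) 0 := by
    have hlin : HasDerivAt (fun s : ℝ => s • v) v 0 := by
      simpa using (hasDerivAt_id (0 : ℝ)).smul_const v
    have hx : HasFDerivAt (fun y => fderiv ℝ f y v)
        (fderiv ℝ (fun y => fderiv ℝ f y v) x) x := (hχ x).hasFDerivAt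
    have hadd : HasDerivAt (fun s : ℝ => fderiv ℝ f (x + s • v) v)
        (fderiv ℝ (fun y => fderiv ℝ f y v) x v) 0 :=
      HasFDerivAt.comp_hasDerivAt (f := fun s : ℝ => x + s • v)
        (l := fun y => fderiv ℝ f y v) 0 (by simpa using hx) (hlin.const_add x)
    have hsub : HasDerivAt (fun s : ℝ => fderiv ℝ f (x - s • v) v)
        (fderiv ℝ (fun y => fderiv ℝ f y v) x (-v)) 0 :=
      HasFDerivAt.comp_hasDerivAt (f := fun s : ℝ => x - s • v)
        (l := fun y => fderiv ℝ f y v) 0 (by simpa using hx) (hlin.const_sub x)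
    have h := hadd.sub hsub
    rw [map_neg, sub_neg_eq_add, ← two_mul] at h
    exact h
  refine HasDerivAt.lhopital_zero_nhdsGT
    (f' := fun t => fderiv ℝ f (x + t • v) v - fderiv ℝ f (x - t • v) v)
    (g' := fun t => 2 * t)
    (Eventually.of_forall fun t => hasDerivAt_secondDifference_smul hfd v x t)
    (Eventually.of_forall fun t => by simpa using hasDerivAt_pow 2 t) ?_ ?_ ?_ ?_
  · filter_upwards [self_mem_nhdsWithin] with t ht
    have : (0 : ℝ) < t := ht
    positivity
  · have h := (hasDerivAt_secondDifference_smul hfd v x 0).continuousAt.tendsto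
    have h0 : secondDifference f ((0 : ℝ) • v) x = 0 := by simp [secondDifference]; ring
    rw [h0] at h
    exact h.mono_left nhdsWithin_le_nhds
  · have h : Tendsto (fun t : ℝ => t ^ 2) (𝓝 0) (𝓝 (0 ^ 2)) := (continuous_pow 2).tendsto 0
    simpa using h.mono_left nhdsWithin_le_nhds
  · have h := (hasDerivAt_iff_tendsto_slope_zero.mp hline).mono_left
      (nhdsWithin_mono 0 fun t (ht : 0 < t) => ht.ne')
    have h2 := h.const_mul (1 / 2)
    have he : 1 / 2 * (2 * fderiv ℝ (fun y => fderiv ℝ f y v) x v) =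
        fderiv ℝ (fun y => fderiv ℝ f y v) x v := by ring
    rw [he] at h2
    refine h2.congr fun t => ?_
    simp only [zero_add, zero_smul, add_zero, sub_zero, sub_self, smul_eq_mul]
    rw [one_div, ← mul_assoc, ← mul_inv, mul_comm, div_eq_mul_inv]

theorem exists_abs_secondDifference_smul_le {f : E → ℝ} (hf : ContDiff ℝ 2 f)
    (hfc : HasCompactSupport f) (v : E) :
    ∃ C, 0 ≤ C ∧ ∀ (x : E) (t : ℝ), 0 ≤ t → |secondDifference f (t • v) x| ≤ C * t ^ 2 := by
  have hfd : Differentiable ℝ f := hf.differentiable (by norm_num)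
  have hχ : ContDiff ℝ 1 fun y => fderiv ℝ f y v :=
    (hf.fderiv_right (m := 1) (by norm_num)).clm_apply contDiff_const
  obtain ⟨K, hK⟩ := hχ.lipschitzWith_of_hasCompactSupport (hfc.fderiv_apply ℝ v) (by norm_num)
  refine ⟨2 * K * ‖v‖, by positivity, fun x t ht => ?_⟩
  have hderiv : ∀ s ∈ Icc 0 t,
      ‖fderiv ℝ f (x + s • v) v - fderiv ℝ f (x - s • v) v‖ ≤ 2 * K * ‖v‖ * t := by
    intro s hs
    have h := hK.dist_le_mul (x + s • v) (x - s • v)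
    rw [dist_eq_norm, dist_eq_norm] at h
    refine h.trans ?_
    have : x + s • v - (x - s • v) = (2 * s) • v := by rw [two_mul, add_smul]; abel
    rw [this, norm_smul, Real.norm_of_nonneg (by linarith [hs.1])]
    have : 0 ≤ K * ‖v‖ := by positivity
    nlinarith [hs.2]
  have h := (convex_Icc 0 t).norm_image_sub_le_of_norm_hasDerivWithin_le
    (fun s _ => (hasDerivAt_secondDifference_smul hfd v x s).hasDerivWithinAt) hderiv
    (left_mem_Icc.2 ht) (right_mem_Icc.2 ht)
  have h0 : secondDifference f ((0 : ℝ) • v) x = 0 := by simp [secondDifference]; ring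
  rw [h0, sub_zero, sub_zero, Real.norm_eq_abs, Real.norm_of_nonneg ht] at h
  linarith

theorem tendsto_integral_mul_secondDifference_div_sq [ProperSpace E] [MeasurableSpace E]
    [BorelSpace E] {μ : Measure E} [IsFiniteMeasureOnCompacts μ] {f g : E → ℝ}
    (hf : ContDiff ℝ 2 f) (hfc : HasCompactSupport f) (hg : Continuous g) (v : E) :
    Tendsto (fun t : ℝ => ∫ x, g x * (secondDifference f (t • v) x / t ^ 2) ∂μ) (𝓝[>] 0)
      (𝓝 (∫ x, g x * fderiv ℝ (fun y => fderiv ℝ f y v) x v ∂μ)) := by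
  obtain ⟨C, hC, hbound⟩ := exists_abs_secondDifference_smul_le hf hfc v
  set S := cthickening ‖v‖ (tsupport f) with hS
  have hScompact : IsCompact S := hfc.isCompact.cthickening
  have hzero : ∀ t ∈ Ioc (0 : ℝ) 1, ∀ x ∉ S, secondDifference f (t • v) x = 0 := by
    intro t ht x hx
    have hout : ∀ y, dist x y ≤ ‖v‖ → f y = 0 := fun y hy => by
      by_contra hne
      exact hx (mem_cthickening_of_dist_le x y _ _ (subset_tsupport f hne) hy)
    have hn : ‖t • v‖ ≤ ‖v‖ := by
      rw [norm_smul, Real.norm_of_nonneg ht.1.le]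
      exact mul_le_of_le_one_left (norm_nonneg v) ht.2
    rw [secondDifference, hout (x + t • v) (by simpa using hn),
      hout (x - t • v) (by simpa [dist_eq_norm] using hn), hout x (by simp)]
    simp
  refine tendsto_integral_filter_of_dominated_convergence (S.indicator fun x => |g x| * C)
    ?_ ?_ ?_ (Eventually.of_forall fun x =>
      (tendsto_secondDifference_smul_div_sq hf v x).const_mul (g x))
  · exact Eventually.of_forall fun t =>
      (hg.mul ((hf.continuous.secondDifference _).div_const _)).aestronglyMeasurable
  · filter_upwards [Ioc_mem_nhdsGT (zero_lt_one' ℝ)] with t ht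
    refine Eventually.of_forall fun x => ?_
    by_cases hx : x ∈ S
    · rw [indicator_of_mem hx, norm_mul, Real.norm_eq_abs, Real.norm_eq_abs, abs_div,
        abs_of_nonneg (sq_nonneg t)]
      gcongr
      rw [div_le_iff₀ (pow_pos ht.1 2)]
      exact hbound x t ht.1.le
    · simp [indicator_of_notMem hx, hzero t ht x hx]
  · exact (integrable_indicator_iff hScompact.measurableSet).2
      ((hg.abs.mul continuous_const).continuousOn.integrableOn_compact hScompact)

end SecondDifference

section InnerProduct

variable {E : Type*} [NormedAddCommGroup E] [InnerProductSpace ℝ E]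

theorem norm_add_le_add_inner_div {w h : E} (hlt : ‖h‖ < ‖w‖) :
    ‖w + h‖ ≤ ‖w‖ + inner ℝ w h / ‖w‖ +
      (‖h‖ ^ 2 - (inner ℝ w h / ‖w‖) ^ 2) / (2 * (‖w‖ - ‖h‖)) := by
  have hw : 0 < ‖w‖ := (norm_nonneg h).trans_lt hlt
  set a := inner ℝ w h / ‖w‖ with ha
  have hinner : inner ℝ w h = a * ‖w‖ := by rw [ha]; field_simp
  have hab : |a| ≤ ‖h‖ := by
    rw [ha, abs_div, abs_of_pos hw, div_le_iff₀ hw, mul_comm]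
    exact abs_real_inner_le_norm w h
  have hal : -‖h‖ ≤ a := (abs_le.1 hab).1
  have hp : 0 ≤ ‖h‖ ^ 2 - a ^ 2 := by
    rw [sub_nonneg, ← sq_abs a]
    gcongr
  have hc : 0 < ‖w‖ + a := by linarith
  have hexp : ‖w + h‖ ^ 2 = (‖w‖ + a) ^ 2 + (‖h‖ ^ 2 - a ^ 2) := by
    rw [norm_add_sq_real, hinner]
    ring
  have hle : (‖h‖ ^ 2 - a ^ 2) / (2 * (‖w‖ + a)) ≤ (‖h‖ ^ 2 - a ^ 2) / (2 * (‖w‖ - ‖h‖)) := by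
    apply div_le_div_of_nonneg_left hp (by linarith) (by linarith)
  refine le_trans ?_ (add_le_add_right hle _)
  refine abs_le_of_sq_le_sq' ?_ (by positivity) |>.2
  rw [hexp]
  have : (‖w‖ + a + (‖h‖ ^ 2 - a ^ 2) / (2 * (‖w‖ + a))) ^ 2 = (‖w‖ + a) ^ 2 + (‖h‖ ^ 2 - a ^ 2) +
      ((‖h‖ ^ 2 - a ^ 2) / (2 * (‖w‖ + a))) ^ 2 := by
    field_simp
    ring
  rw [this]
  exact le_add_of_nonneg_right (sq_nonneg _)

theorem secondDifference_norm_le {w h : E} (hlt : ‖h‖ < ‖w‖) :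
    secondDifference norm h w ≤ (‖h‖ ^ 2 - (inner ℝ w h / ‖w‖) ^ 2) / (‖w‖ - ‖h‖) := by
  have h₁ := norm_add_le_add_inner_div hlt
  have h₂ := norm_add_le_add_inner_div (w := w) (h := -h) (by rwa [norm_neg])
  rw [inner_neg_right, norm_neg, neg_div, neg_sq, ← sub_eq_add_neg] at h₂
  have hhalf (p q : ℝ) : p / (2 * q) = p / q / 2 := by rw [mul_comm, div_mul_eq_div_div]
  rw [hhalf] at h₁ h₂
  rw [secondDifference]
  linarith

theorem sum_secondDifference_infDist_le [FiniteDimensional ℝ E] {ι : Type*} [Fintype ι]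
    (b : OrthonormalBasis ι ℝ E) {s : Set E} (hs : IsClosed s) (hne : s.Nonempty) {x : E} {t : ℝ}
    (ht : 0 ≤ t) (hlt : t < infDist x s) :
    ∑ i, secondDifference (fun y => infDist y s) (t • b i) x ≤
      t ^ 2 * (Fintype.card ι - 1) / (infDist x s - t) := by
  obtain ⟨y, hy, hxy⟩ := hs.exists_infDist_eq_dist hne x
  rw [dist_eq_norm] at hxy
  have hd : 0 < ‖x - y‖ := by rw [← hxy]; linarith
  have hnorm (i : ι) : ‖t • b i‖ = t := by
    rw [norm_smul, b.norm_eq_one, mul_one, Real.norm_of_nonneg ht]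
  have hle (i : ι) : secondDifference (fun y => infDist y s) (t • b i) x ≤
      (t ^ 2 - (inner ℝ (x - y) (t • b i) / ‖x - y‖) ^ 2) / (‖x - y‖ - t) := by
    have h := secondDifference_norm_le (w := x - y) (h := t • b i) (by rw [hnorm, ← hxy]; exact hlt)
    rw [hnorm] at h
    refine le_trans ?_ h
    have h₁ := infDist_le_dist_of_mem (x := x + t • b i) hy
    have h₂ := infDist_le_dist_of_mem (x := x - t • b i) hy
    rw [dist_eq_norm, add_sub_right_comm] at h₁
    rw [dist_eq_norm, sub_right_comm] at h₂
    simp only [secondDifference, hxy]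
    linarith
  refine (Finset.sum_le_sum fun i _ => hle i).trans_eq ?_
  rw [← Finset.sum_div, Finset.sum_sub_distrib, hxy]
  have hsum : ∑ i, (inner ℝ (x - y) (t • b i) / ‖x - y‖) ^ 2 = t ^ 2 := by
    simp only [inner_smul_right, div_pow, mul_pow]
    rw [← Finset.sum_div, ← Finset.mul_sum]
    have h := b.sum_sq_norm_inner_left (x - y)
    simp only [Real.norm_eq_abs, sq_abs] at h
    rw [h]
    field_simp
  rw [hsum]
  simp only [Finset.sum_const, Finset.card_univ, nsmul_eq_mul]
  ring

theorem trace_fderiv_gradient [CompleteSpace E] {ι : Type*} [Fintype ι]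
    (b : OrthonormalBasis ι ℝ E) {f : E → ℝ} (hf : ContDiff ℝ 2 f) (x : E) :
    LinearMap.trace ℝ E (fderiv ℝ (fun z => gradient f z) x).toLinearMap =
      ∑ i, fderiv ℝ (fun y => fderiv ℝ f y (b i)) x (b i) := by
  have hdiff : DifferentiableAt ℝ (fun z => gradient f z) x := by
    have h : Differentiable ℝ (fderiv ℝ f) :=
      (hf.fderiv_right (m := 1) (by norm_num)).differentiable (by norm_num)
    exact ((InnerProductSpace.toDual ℝ E).symm.toContinuousLinearEquiv.differentiableAt).comp x
      (h x)
  rw [LinearMap.trace_eq_sum_inner _ b]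
  refine Finset.sum_congr rfl fun i _ => ?_
  have he : (fun y => fderiv ℝ f y (b i)) = fun y => inner ℝ (b i) (gradient f y) := by
    ext y
    rw [real_inner_comm, gradient, InnerProductSpace.toDual_symm_apply]
  rw [he, fderiv_inner_apply ℝ (differentiableAt_const _) hdiff]
  simp

end InnerProduct

/-- The distance to a nonempty closed set `s` has distributional Laplacian at most
`(dim E - 1) / infDist · s` off `s`. -/
theorem integral_infDist_mul_trace_fderiv_gradient_le {E : Type*} [NormedAddCommGroup E]
    [InnerProductSpace ℝ E] [FiniteDimensional ℝ E] [MeasurableSpace E] [BorelSpace E]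
    {ι : Type*} [Fintype ι] (b : OrthonormalBasis ι ℝ E)
    {μ : Measure E} [μ.IsAddRightInvariant] [IsFiniteMeasureOnCompacts μ] {s : Set E}
    (hs : IsClosed s) (hne : s.Nonempty) {f : E → ℝ} (hf : ContDiff ℝ 2 f)
    (hfc : HasCompactSupport f) (hfs : Disjoint (tsupport f) s) (hfpos : ∀ x, 0 ≤ f x) :
    ∫ x, infDist x s * LinearMap.trace ℝ E (fderiv ℝ (fun z => gradient f z) x).toLinearMap ∂μ ≤
      (Fintype.card ι - 1) * ∫ x, f x / infDist x s ∂μ := by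
  have hdcont : Continuous fun x => infDist x s := continuous_infDist_pt s
  obtain ⟨δ, hδ, hδle⟩ : ∃ δ > 0, ∀ x ∈ tsupport f, δ ≤ infDist x s := by
    rcases (tsupport f).eq_empty_or_nonempty with hempty | hnonempty
    · exact ⟨1, one_pos, by simp [hempty]⟩
    · obtain ⟨x₀, hx₀, hmin⟩ := hfc.isCompact.exists_isMinOn hnonempty hdcont.continuousOn
      exact ⟨_, (hs.notMem_iff_infDist_pos hne).1 (hfs.notMem_of_mem_left hx₀),
        fun x hx => hmin hx⟩
  have hquot : (fun x => f x / infDist x s) = fun x => f x / max (infDist x s) δ := by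
    ext x
    by_cases hx : f x = 0
    · simp [hx]
    · rw [max_eq_left (hδle x (subset_tsupport f hx))]
  have hquotint : Integrable (fun x => f x / infDist x s) μ := by
    have hmax : ∀ x, max (infDist x s) δ ≠ 0 := fun x => (lt_max_of_lt_right hδ).ne'
    rw [hquot]
    refine Continuous.integrable_of_hasCompactSupport
      (hf.continuous.div (hdcont.max continuous_const) hmax) ?_
    simp only [div_eq_mul_inv]
    exact hfc.mul_right
  have hint (v : E) (t : ℝ) :
      Integrable (fun x => f x * secondDifference (fun y => infDist y s) v x / t ^ 2) μ :=
    ((hf.continuous.mul (hdcont.secondDifference v)).integrable_of_hasCompactSupport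
      hfc.mul_right).div_const _
  have hlim : Tendsto (fun t : ℝ => ∑ i, ∫ x, infDist x s *
        (secondDifference f (t • b i) x / t ^ 2) ∂μ) (𝓝[>] 0)
      (𝓝 (∫ x, infDist x s *
        LinearMap.trace ℝ E (fderiv ℝ (fun z => gradient f z) x).toLinearMap ∂μ)) := by
    have hsecond (i : ι) : Integrable
        (fun x => infDist x s * fderiv ℝ (fun y => fderiv ℝ f y (b i)) x (b i)) μ := by
      have hχ : ContDiff ℝ 1 fun y => fderiv ℝ f y (b i) :=
        (hf.fderiv_right (m := 1) (by norm_num)).clm_apply contDiff_const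
      exact (hdcont.mul ((hχ.continuous_fderiv (by norm_num)).clm_apply
        continuous_const)).integrable_of_hasCompactSupport
        (((hfc.fderiv_apply ℝ (b i)).fderiv_apply ℝ (b i)).mul_left)
    simp only [trace_fderiv_gradient b hf, Finset.mul_sum]
    rw [integral_finsetSum _ fun i _ => hsecond i]
    exact tendsto_finsetSum _ fun i _ =>
      tendsto_integral_mul_secondDifference_div_sq hf hfc hdcont (b i)
  have hlim' : Tendsto (fun t : ℝ => δ / (δ - t) *
      ((Fintype.card ι - 1) * ∫ x, f x / infDist x s ∂μ)) (𝓝[>] 0)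
      (𝓝 ((Fintype.card ι - 1) * ∫ x, f x / infDist x s ∂μ)) := by
    have h : ContinuousAt (fun t : ℝ => δ / (δ - t) *
        ((Fintype.card ι - 1) * ∫ x, f x / infDist x s ∂μ)) 0 := by
      refine ContinuousAt.mul (ContinuousAt.div continuousAt_const (by fun_prop) ?_)
        continuousAt_const
      simpa using hδ.ne'
    have h' := h.tendsto.mono_left (nhdsWithin_le_nhds (s := Ioi 0))
    rwa [sub_zero, div_self hδ.ne', one_mul] at h'
  refine le_of_tendsto_of_tendsto hlim hlim' ?_
  filter_upwards [Ioo_mem_nhdsGT hδ] with t ht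
  have hswap : ∑ i, ∫ x, infDist x s * (secondDifference f (t • b i) x / t ^ 2) ∂μ =
      ∫ x, ∑ i, f x * secondDifference (fun y => infDist y s) (t • b i) x / t ^ 2 ∂μ := by
    rw [integral_finsetSum _ fun i _ => hint _ _]
    refine Finset.sum_congr rfl fun i _ => ?_
    simp only [← mul_div_assoc]
    rw [integral_div, integral_div, integral_mul_secondDifference hf.continuous hfc hdcont]
  rw [hswap, ← integral_const_mul, ← integral_const_mul]
  refine integral_mono (integrable_finsetSum _ fun i _ => hint _ _)
    ((hquotint.const_mul _).const_mul _) fun x => ?_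
  by_cases hx : f x = 0
  · simp [hx]
  have hdx : δ ≤ infDist x s := hδle x (subset_tsupport f hx)
  have hcard : (0 : ℝ) ≤ Fintype.card ι - 1 := by
    have hnontrivial : Nonempty ι := by
      by_contra hempty
      rw [not_nonempty_iff] at hempty
      have hzero (y : E) : y = 0 := by simpa using (b.sum_repr y).symm
      obtain ⟨y, hy⟩ := hne
      exact hfs.le_bot ⟨subset_tsupport f hx, by rwa [hzero x, ← hzero y]⟩
    rw [sub_nonneg]
    exact_mod_cast Fintype.card_pos
  have hsum := sum_secondDifference_infDist_le b hs hne ht.1.le (ht.2.trans_le hdx)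
  have ht2 : 0 < t ^ 2 := pow_pos ht.1 2
  have hdt : 0 < infDist x s - t := sub_pos.2 (ht.2.trans_le hdx)
  have hδt : 0 < δ - t := sub_pos.2 ht.2
  have hd : 0 < infDist x s := hδ.trans_le hdx
  have hratio : 1 / (infDist x s - t) ≤ δ / (δ - t) * (1 / infDist x s) := by
    rw [div_mul_div_comm, mul_one, div_le_div_iff₀ hdt (by positivity)]
    nlinarith [ht.1]
  calc ∑ i, f x * secondDifference (fun y => infDist y s) (t • b i) x / t ^ 2
      = f x / t ^ 2 * ∑ i, secondDifference (fun y => infDist y s) (t • b i) x := by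
        rw [Finset.mul_sum]
        exact Finset.sum_congr rfl fun i _ => by ring
    _ ≤ f x / t ^ 2 * (t ^ 2 * (Fintype.card ι - 1) / (infDist x s - t)) :=
        mul_le_mul_of_nonneg_left hsum (div_nonneg (hfpos x) ht2.le)
    _ = f x * (Fintype.card ι - 1) * (1 / (infDist x s - t)) := by
        have htne : t ≠ 0 := ht.1.ne'
        field_simp
    _ ≤ f x * (Fintype.card ι - 1) * (δ / (δ - t) * (1 / infDist x s)) :=
        mul_le_mul_of_nonneg_left hratio (mul_nonneg (hfpos x) hcard)
    _ = δ / (δ - t) * ((Fintype.card ι - 1) * (f x / infDist x s)) := by ring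

theorem stmt_6 (n : ℕ) (Ω : Set (EuclideanSpace ℝ (Fin n)))
    (hΩopen : IsOpen Ω) (hΩconn : IsConnected Ω) (hΩne : Ω.Nonempty)
    (hΩproper : Ω ≠ Set.univ)
    (ψ : EuclideanSpace ℝ (Fin n) → ℝ) (hψ : ContDiff ℝ (⊤ : ℕ∞) ψ)
    (hψc : HasCompactSupport ψ) (hψsupp : tsupport ψ ⊆ Ω)
    (hψpos : ∀ x, 0 ≤ ψ x) :
    -∫ x in Ω, infDist x (frontier Ω) *
        (LinearMap.trace ℝ (EuclideanSpace ℝ (Fin n))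
          (fderiv ℝ (fun z => gradient ψ z) x).toLinearMap) ≥
      -(n - 1 : ℝ) * ∫ x in Ω, ψ x / infDist x (frontier Ω) := by
  have hdiff2 : ContDiff ℝ 2 ψ := contDiff_infty.1 hψ 2
  have hfrontier : (frontier Ω).Nonempty := nonempty_frontier_iff.2 ⟨hΩne, hΩproper⟩
  have hdisj : Disjoint (tsupport ψ) (frontier Ω) :=
    (disjoint_frontier_iff_isOpen.2 hΩopen).symm.mono_left hψsupp
  have hmain := integral_infDist_mul_trace_fderiv_gradient_le (μ := volume)
    (EuclideanSpace.basisFun (Fin n) ℝ) isClosed_frontier hfrontier hdiff2 hψc hdisj hψpos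
  rw [Fintype.card_fin] at hmain
  rw [setIntegral_eq_integral_of_forall_compl_eq_zero,
    setIntegral_eq_integral_of_forall_compl_eq_zero]
  · linarith
  · intro x hx
    rw [image_eq_zero_of_notMem_tsupport fun h => hx (hψsupp h), zero_div]
  · intro x hx
    have hev : ψ =ᶠ[𝓝 x] 0 := notMem_tsupport_iff_eventuallyEq.1 fun h => hx (hψsupp h)
    have hgrad : (fun z => gradient ψ z) =ᶠ[𝓝 x] fun _ => 0 := by
      filter_upwards [hev.fderiv (𝕜 := ℝ)] with z hz
      rw [gradient, hz]
      simp
    rw [hgrad.fderiv_eq]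
    simp
end

section
/- Let Ω ⊊ ℝⁿ be a domain and d_Ω(x) = dist(x, ∂Ω). Then for every nonnegative ψ ∈ C_c^∞(Ω), ∫_Ω ∇ψ · ∇d_Ω dx ≥ −(n−1) ∫_Ω ψ/d_Ω dx. -/
open MeasureTheory Metric Set
open scoped RealInnerProductSpace

open Filter Topology

theorem Real.sqrt_one_add_le_cubic {u : ℝ} (hu : -1 ≤ u) :
    √(1 + u) ≤ 1 + u / 2 - u ^ 2 / 8 + u ^ 3 / 16 := by
  apply Real.sqrt_le_iff.2
  constructor
  · nlinarith [mul_nonneg (by linarith : 0 ≤ 1 + u) (sq_nonneg (u - 3 / 2)), sq_nonneg u]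
  · have : 0 ≤ u ^ 4 * (5 / 64 - u / 64 + u ^ 2 / 256) :=
      mul_nonneg (by positivity) (by nlinarith [sq_nonneg (u - 2)])
    nlinarith

section

variable {E : Type*} [NormedAddCommGroup E] [InnerProductSpace ℝ E]

theorem norm_add_smul_le {z e : E} (hz : z ≠ 0) (he : ‖e‖ = 1) (t : ℝ) :
    ‖z + t • e‖ ≤ ‖z‖ * (1 + (2 * t * ⟪z, e⟫ + t ^ 2) / ‖z‖ ^ 2 / 2
      - ((2 * t * ⟪z, e⟫ + t ^ 2) / ‖z‖ ^ 2) ^ 2 / 8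
      + ((2 * t * ⟪z, e⟫ + t ^ 2) / ‖z‖ ^ 2) ^ 3 / 16) := by
  have hr : 0 < ‖z‖ := norm_pos_iff.2 hz
  set u := (2 * t * ⟪z, e⟫ + t ^ 2) / ‖z‖ ^ 2 with hu
  have hsq : ‖z + t • e‖ ^ 2 = ‖z‖ ^ 2 * (1 + u) := by
    rw [norm_add_sq_real, real_inner_smul_right, norm_smul, he, mul_one, Real.norm_eq_abs,
      sq_abs, hu]
    field_simp
    ring
  have hu1 : -1 ≤ u := by
    by_contra! h
    nlinarith [sq_nonneg ‖z + t • e‖, pow_pos hr 2]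
  calc ‖z + t • e‖ = √(‖z + t • e‖ ^ 2) := (Real.sqrt_sq (norm_nonneg _)).symm
    _ = ‖z‖ * √(1 + u) := by rw [hsq, Real.sqrt_mul (by positivity), Real.sqrt_sq hr.le]
    _ ≤ _ := by gcongr; exact Real.sqrt_one_add_le_cubic hu1

theorem norm_add_smul_add_norm_sub_smul_sub_le {z e : E} (hz : z ≠ 0) (he : ‖e‖ = 1) (t : ℝ) :
    ‖z + t • e‖ + ‖z - t • e‖ - 2 * ‖z‖ ≤
      t ^ 2 * (1 / ‖z‖ - ⟪z, e⟫ ^ 2 / ‖z‖ ^ 3)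
        + (3 / 2 * t ^ 4 / ‖z‖ ^ 3 + t ^ 6 / (8 * ‖z‖ ^ 5)) := by
  have hr : 0 < ‖z‖ := norm_pos_iff.2 hz
  have h₁ := norm_add_smul_le hz he t
  have h₂ := norm_add_smul_le hz he (-t)
  rw [neg_smul, ← sub_eq_add_neg] at h₂
  have ha : ⟪z, e⟫ ^ 2 ≤ ‖z‖ ^ 2 := by
    have := abs_real_inner_le_norm z e
    rw [he, mul_one] at this
    exact sq_le_sq' (neg_le_of_abs_le this) (le_of_abs_le this)
  set a := ⟪z, e⟫
  set r := ‖z‖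
  have h₃ : t ^ 4 * a ^ 2 / r ^ 5 ≤ t ^ 4 * r ^ 2 / r ^ 5 := by gcongr
  have h₄ : t ^ 4 * r ^ 2 / r ^ 5 = t ^ 4 / r ^ 3 := by field_simp
  have h₅ : 0 ≤ t ^ 4 / r ^ 3 := by positivity
  have key : r * (1 + (2 * t * a + t ^ 2) / r ^ 2 / 2
      - ((2 * t * a + t ^ 2) / r ^ 2) ^ 2 / 8
      + ((2 * t * a + t ^ 2) / r ^ 2) ^ 3 / 16) +
      r * (1 + (2 * -t * a + (-t) ^ 2) / r ^ 2 / 2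
      - ((2 * -t * a + (-t) ^ 2) / r ^ 2) ^ 2 / 8
      + ((2 * -t * a + (-t) ^ 2) / r ^ 2) ^ 3 / 16) - 2 * r =
      t ^ 2 * (1 / r - a ^ 2 / r ^ 3) + (3 / 2 * (t ^ 4 * a ^ 2 / r ^ 5) + t ^ 6 / (8 * r ^ 5))
        - t ^ 4 / r ^ 3 / 4 := by
    field_simp
    ring
  have h₆ : 3 / 2 * t ^ 4 / r ^ 3 = 3 / 2 * (t ^ 4 / r ^ 3) := by ring
  linarith

theorem sum_infDist_add_smul_le {ι : Type*} [Fintype ι] [ProperSpace E]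
    (b : OrthonormalBasis ι ℝ E) {K : Set E} (hK : IsClosed K) (hKne : K.Nonempty)
    {δ : ℝ} (hδ : 0 < δ) {x : E} (hx : δ ≤ infDist x K) {t : ℝ} (ht : t ≠ 0) :
    ∑ i, (infDist (x + t • b i) K + infDist (x - t • b i) K - 2 * infDist x K) / t ^ 2 ≤
      (Fintype.card ι - 1) / infDist x K
        + Fintype.card ι * (3 / 2 * t ^ 2 / δ ^ 3 + t ^ 4 / (8 * δ ^ 5)) := by
  obtain ⟨y, hy, hxy⟩ := hK.exists_infDist_eq_dist hKne x
  rw [dist_eq_norm] at hxy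
  have hδr : δ ≤ ‖x - y‖ := hxy ▸ hx
  have hr : 0 < ‖x - y‖ := hδ.trans_le hδr
  have hz : x - y ≠ 0 := norm_pos_iff.1 hr
  have hsum : ∑ i, ⟪x - y, b i⟫ ^ 2 = ‖x - y‖ ^ 2 := by
    rw [← real_inner_self_eq_norm_sq, ← b.sum_inner_mul_inner]
    exact Finset.sum_congr rfl fun i _ => by rw [sq, real_inner_comm (x - y) (b i)]
  rw [hxy]
  calc _ ≤ ∑ i, ((1 / ‖x - y‖ - ⟪x - y, b i⟫ ^ 2 / ‖x - y‖ ^ 3)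
          + (3 / 2 * t ^ 2 / δ ^ 3 + t ^ 4 / (8 * δ ^ 5))) := by
        refine Finset.sum_le_sum fun i _ => ?_
        rw [div_le_iff₀ (by positivity)]
        have h₁ : infDist (x + t • b i) K ≤ ‖x - y + t • b i‖ := by
          refine (infDist_le_dist_of_mem hy).trans_eq ?_
          rw [dist_eq_norm]; congr 1; abel
        have h₂ : infDist (x - t • b i) K ≤ ‖x - y - t • b i‖ := by
          refine (infDist_le_dist_of_mem hy).trans_eq ?_
          rw [dist_eq_norm]; congr 1; abel
        have h₃ := norm_add_smul_add_norm_sub_smul_sub_le hz (b.norm_eq_one i) t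
        have h₄ : 3 / 2 * t ^ 4 / ‖x - y‖ ^ 3 ≤ 3 / 2 * t ^ 4 / δ ^ 3 := by gcongr
        have h₅ : t ^ 6 / (8 * ‖x - y‖ ^ 5) ≤ t ^ 6 / (8 * δ ^ 5) := by gcongr
        have h₆ : (3 / 2 * t ^ 2 / δ ^ 3 + t ^ 4 / (8 * δ ^ 5)) * t ^ 2 =
          3 / 2 * t ^ 4 / δ ^ 3 + t ^ 6 / (8 * δ ^ 5) := by ring
        rw [add_mul, h₆]
        linarith
    _ = _ := by
        rw [Finset.sum_add_distrib, Finset.sum_sub_distrib,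
          ← Finset.sum_div _ (fun i => ⟪x - y, b i⟫ ^ 2), hsum]
        simp only [Finset.sum_const, Finset.card_univ, nsmul_eq_mul]
        field_simp

variable [FiniteDimensional ℝ E] [MeasurableSpace E] [BorelSpace E]

/-- Summation by parts for first differences against a compactly supported function. -/
theorem integral_difference_mul_difference {φ g : E → ℝ} (hφ : Continuous φ)
    (hφc : HasCompactSupport φ) (hg : Continuous g) (w : E) :
    ∫ x, (φ (x + w) - φ x) * (g (x + w) - g x) =
      -∫ x, φ x * (g (x + w) + g (x - w) - 2 * g x) := by
  have h₁ : Integrable fun x => φ x * (g x - g (x - w)) :=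
    (by fun_prop : Continuous _).integrable_of_hasCompactSupport hφc.mul_right
  have h₂ : Integrable fun x => φ x * (g (x + w) - g x) :=
    (by fun_prop : Continuous _).integrable_of_hasCompactSupport hφc.mul_right
  calc _ = ∫ x, (φ (x + w) * (g (x + w) - g (x + w - w)) - φ x * (g (x + w) - g x)) := by
        congr 1; ext x; rw [add_sub_cancel_right]; ring
    _ = (∫ x, φ x * (g x - g (x - w))) - ∫ x, φ x * (g (x + w) - g x) := by
        rw [integral_sub (h₁.comp_add_right w) h₂,
          integral_add_right_eq_self (fun x => φ x * (g x - g (x - w))) w]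
    _ = _ := by
        rw [← integral_sub h₁ h₂, ← integral_neg]
        congr 1; ext x; ring

theorem tendsto_integral_differenceQuotient_mul {φ g : E → ℝ} {C D : NNReal}
    (hφ : LipschitzWith C φ) (hφc : HasCompactSupport φ) (hg : LipschitzWith D g)
    (v : E) :
    Tendsto (fun t : ℝ => ∫ x, (φ (x + t • v) - φ x) / t * ((g (x + t • v) - g x) / t))
      (𝓝[>] 0) (𝓝 (∫ x, fderiv ℝ φ x v * fderiv ℝ g x v)) := by
  have hquot : ∀ {f : E → ℝ} {L : NNReal}, LipschitzWith L f → ∀ (x : E) {t : ℝ}, 0 < t →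
      |(f (x + t • v) - f x) / t| ≤ L * ‖v‖ := by
    intro f L hf x t ht
    rw [abs_div, abs_of_pos ht, div_le_iff₀ ht]
    have := hf.dist_le_mul (x + t • v) x
    rw [dist_eq_norm, dist_eq_norm, add_sub_cancel_left, norm_smul, Real.norm_eq_abs,
      Real.norm_eq_abs, abs_of_pos ht] at this
    linarith
  have hlim : ∀ {f : E → ℝ} {x : E}, DifferentiableAt ℝ f x →
      Tendsto (fun t : ℝ => (f (x + t • v) - f x) / t) (𝓝[>] 0) (𝓝 (fderiv ℝ f x v)) := by
    intro f x hf
    refine ((hf.hasFDerivAt.hasLineDerivAt v).tendsto_slope_zero_right).congr fun t => ?_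
    rw [smul_eq_mul, div_eq_inv_mul]
  set S := cthickening ‖v‖ (tsupport φ)
  have hS : IsCompact S := hφc.cthickening
  have hout : ∀ x ∉ S, ∀ t : ℝ, 0 < t → t ≤ 1 → φ (x + t • v) - φ x = 0 := by
    intro x hx t ht ht1
    have h₁ : φ x = 0 := image_eq_zero_of_notMem_tsupport fun h =>
      hx (self_subset_cthickening _ h)
    have h₂ : φ (x + t • v) = 0 := image_eq_zero_of_notMem_tsupport fun h => by
      refine hx (mem_cthickening_of_dist_le x _ _ _ h ?_)
      rw [dist_eq_norm, sub_add_cancel_left, norm_neg, norm_smul, Real.norm_eq_abs, abs_of_pos ht]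
      exact mul_le_of_le_one_left (norm_nonneg _) ht1
    rw [h₁, h₂, sub_zero]
  refine tendsto_integral_filter_of_dominated_convergence
    (S.indicator fun _ => (C * ‖v‖) * (D * ‖v‖)) ?_ ?_ ?_ ?_
  · refine Eventually.of_forall fun t => Continuous.aestronglyMeasurable ?_
    have := hφ.continuous
    have := hg.continuous
    fun_prop
  · filter_upwards [Ioc_mem_nhdsGT (zero_lt_one' ℝ)] with t ht
    refine Eventually.of_forall fun x => ?_
    by_cases hx : x ∈ S
    · rw [indicator_of_mem hx, norm_mul]
      exact mul_le_mul (hquot hφ x ht.1) (hquot hg x ht.1) (abs_nonneg _) (by positivity)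
    · rw [indicator_of_notMem hx, hout x hx t ht.1 ht.2]
      simp
  · exact (integrable_indicator_iff hS.measurableSet).2 (integrableOn_const hS.measure_ne_top)
  · filter_upwards [hφ.ae_differentiableAt, hg.ae_differentiableAt] with x h₁ h₂
    exact (hlim h₁).mul (hlim h₂)

theorem integrable_fderiv_mul_fderiv {φ g : E → ℝ} {D : NNReal}
    (hφ : ContDiff ℝ 1 φ) (hφc : HasCompactSupport φ) (hg : LipschitzWith D g) (v : E) :
    Integrable fun x => fderiv ℝ φ x v * fderiv ℝ g x v := by
  have h₁ : Integrable fun x => fderiv ℝ φ x v :=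
    ((hφ.continuous_fderiv one_ne_zero).clm_apply continuous_const).integrable_of_hasCompactSupport
      (hφc.fderiv_apply ℝ v)
  refine h₁.mul_bdd (c := D * ‖v‖) (measurable_fderiv_apply_const ℝ g v).aestronglyMeasurable ?_
  exact Eventually.of_forall fun x => (ContinuousLinearMap.le_opNorm _ _).trans <| by
    gcongr; exact norm_fderiv_le_of_lipschitz ℝ hg

/-- The weak form of `Δ (dist · K) ≤ (dim - 1) / dist · K` away from the closed set `K`. -/
theorem integral_inner_gradient_gradient_infDist_ge {ι : Type*} [Fintype ι]
    (b : OrthonormalBasis ι ℝ E) {K : Set E} (hK : IsClosed K) (hKne : K.Nonempty)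
    {ψ : E → ℝ} (hψ : ContDiff ℝ 1 ψ) (hψc : HasCompactSupport ψ)
    (hψK : Disjoint (tsupport ψ) K) (hψpos : ∀ x, 0 ≤ ψ x) :
    -(Fintype.card ι - 1 : ℝ) * ∫ x, ψ x / infDist x K ≤
      ∫ x, ⟪gradient ψ x, gradient (fun z => infDist z K) x⟫ := by
  have hd : LipschitzWith 1 fun z => infDist z K := lipschitz_infDist_pt K
  obtain ⟨C, hC⟩ := hψ.lipschitzWith_of_hasCompactSupport hψc one_ne_zero
  have hdpos : ∀ x ∈ tsupport ψ, 0 < infDist x K := fun x hx =>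
    (hK.notMem_iff_infDist_pos hKne).1 (hψK.notMem_of_mem_left hx)
  obtain ⟨δ, hδ, hδd⟩ : ∃ δ > 0, ∀ x ∈ tsupport ψ, δ ≤ infDist x K :=
    hψc.isCompact.exists_forall_le' (continuous_infDist_pt K).continuousOn hdpos
  have hψi : Integrable ψ := hψ.continuous.integrable_of_hasCompactSupport hψc
  have hψdi : Integrable fun x => ψ x / infDist x K := by
    rw [← integrableOn_iff_integrable_of_support_subset (s := tsupport ψ)]
    · exact (hψ.continuous.continuousOn.div (continuous_infDist_pt K).continuousOn
        fun x hx => (hdpos x hx).ne').integrableOn_compact hψc.isCompact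
    · exact fun x hx => subset_tsupport ψ fun h => hx (by simp [h])
  have hinner : ∫ x, ⟪gradient ψ x, gradient (fun z => infDist z K) x⟫ =
      ∑ i, ∫ x, fderiv ℝ ψ x (b i) * fderiv ℝ (fun z => infDist z K) x (b i) := by
    rw [← integral_finsetSum _ fun i _ => integrable_fderiv_mul_fderiv hψ hψc hd (b i)]
    congr 1; ext x
    rw [← b.sum_inner_mul_inner]
    refine Finset.sum_congr rfl fun i _ => ?_
    rw [real_inner_comm (gradient (fun z => infDist z K) x) (b i)]
    simp [gradient]
  set R : ℝ → ℝ := fun t =>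
    Fintype.card ι * (3 / 2 * t ^ 2 / δ ^ 3 + t ^ 4 / (8 * δ ^ 5))
  have hlim := tendsto_finsetSum Finset.univ fun i _ =>
    tendsto_integral_differenceQuotient_mul hC hψc hd (b i)
  have hR : Tendsto (fun t => -(Fintype.card ι - 1 : ℝ) * (∫ x, ψ x / infDist x K)
      - R t * ∫ x, ψ x) (𝓝[>] 0) (𝓝 (-(Fintype.card ι - 1 : ℝ) * ∫ x, ψ x / infDist x K)) := by
    have : Continuous fun t => -(Fintype.card ι - 1 : ℝ) * (∫ x, ψ x / infDist x K)
      - R t * ∫ x, ψ x := by fun_prop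
    simpa [R] using (this.tendsto 0).mono_left nhdsWithin_le_nhds
  rw [hinner]
  refine le_of_tendsto_of_tendsto hR hlim ?_
  filter_upwards [self_mem_nhdsWithin] with t (ht : 0 < t)
  have hcont := continuous_infDist_pt K
  have hi : ∀ i, Integrable fun x => ψ x *
      ((infDist (x + t • b i) K + infDist (x - t • b i) K - 2 * infDist x K) / t ^ 2) := by
    intro i
    refine Continuous.integrable_of_hasCompactSupport ?_ hψc.mul_right
    have := hψ.continuous
    fun_prop
  have hsum : ∑ i, ∫ x, (ψ (x + t • b i) - ψ x) / t *
        ((infDist (x + t • b i) K - infDist x K) / t) =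
      -∫ x, ψ x * ∑ i,
        (infDist (x + t • b i) K + infDist (x - t • b i) K - 2 * infDist x K) / t ^ 2 := by
    simp only [Finset.mul_sum]
    rw [integral_finsetSum _ fun i _ => hi i, ← Finset.sum_neg_distrib]
    refine Finset.sum_congr rfl fun i _ => ?_
    have h := integral_difference_mul_difference hψ.continuous hψc hcont (t • b i)
    calc _ = (∫ x, (ψ (x + t • b i) - ψ x) * (infDist (x + t • b i) K - infDist x K)) / t ^ 2 := by
          rw [← integral_div]; congr 1; ext x; ring
      _ = _ := by
          rw [h, neg_div, ← integral_div]; congr 2; ext x; ring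
  rw [hsum]
  have hmono : ∫ x, ψ x * ∑ i,
        (infDist (x + t • b i) K + infDist (x - t • b i) K - 2 * infDist x K) / t ^ 2 ≤
      ∫ x, ((Fintype.card ι - 1 : ℝ) * (ψ x / infDist x K) + R t * ψ x) := by
    refine integral_mono ?_ ((hψdi.const_mul _).add (hψi.const_mul _)) fun x => ?_
    · simp only [Finset.mul_sum]
      exact integrable_finsetSum _ fun i _ => hi i
    · by_cases hx : x ∈ tsupport ψ
      · refine (mul_le_mul_of_nonneg_left
          (sum_infDist_add_smul_le b hK hKne hδ (hδd x hx) ht.ne') (hψpos x)).trans_eq ?_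
        simp only [R]
        ring
      · simp [image_eq_zero_of_notMem_tsupport hx]
  rw [integral_add (hψdi.const_mul _) (hψi.const_mul _), integral_const_mul,
    integral_const_mul] at hmono
  linarith

end

theorem stmt_7 (n : ℕ) (Ω : Set (EuclideanSpace ℝ (Fin n)))
    (hΩopen : IsOpen Ω) (hΩconn : IsConnected Ω) (hΩne : Ω.Nonempty)
    (hΩproper : Ω ≠ Set.univ)
    (ψ : EuclideanSpace ℝ (Fin n) → ℝ) (hψ : ContDiff ℝ (⊤ : ℕ∞) ψ)
    (hψc : HasCompactSupport ψ) (hψsupp : tsupport ψ ⊆ Ω)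
    (hψpos : ∀ x, 0 ≤ ψ x) :
    ∫ x in Ω, ⟪gradient ψ x, gradient (fun z => infDist z (frontier Ω)) x⟫ ≥
      -(n - 1 : ℝ) * ∫ x in Ω, ψ x / infDist x (frontier Ω) := by
  have hdisj : Disjoint (tsupport ψ) (frontier Ω) := by
    rw [hΩopen.frontier_eq]
    exact disjoint_sdiff_right.mono_left hψsupp
  have h := integral_inner_gradient_gradient_infDist_ge (EuclideanSpace.basisFun (Fin n) ℝ)
    isClosed_frontier (nonempty_frontier_iff.2 ⟨hΩne, hΩproper⟩)
    (hψ.of_le (by exact_mod_cast le_top)) hψc hdisj hψpos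
  rw [Fintype.card_fin] at h
  rw [setIntegral_eq_integral_of_forall_compl_eq_zero,
    setIntegral_eq_integral_of_forall_compl_eq_zero]
  · exact h
  · intro x hx
    rw [image_eq_zero_of_notMem_tsupport fun h => hx (hψsupp h), zero_div]
  · intro x hx
    have : fderiv ℝ ψ x = 0 := fderiv_of_notMem_tsupport ℝ fun h => hx (hψsupp h)
    simp [gradient, this]
end

section
/- Let Ω ⊊ ℝⁿ be a domain, s > n, and d_Ω(x) = dist(x, ∂Ω). Then the L¹-Hardy inequality ∫_Ω |∇φ| d_Ω^{−(s−1)} dx ≥ (s−n) ∫_Ω |φ| d_Ω^{−s} dx holds for all φ ∈ C_c^∞(Ω). -/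
open MeasureTheory Metric Set

open Filter Topology Module
open scoped ENNReal NNReal

/-- An antilipschitz self-map expands volume by at least the corresponding power. -/
theorem AntilipschitzWith.volume_preimage_le {n : ℕ} {K : ℝ≥0}
    {f : EuclideanSpace ℝ (Fin n) → EuclideanSpace ℝ (Fin n)} (hf : AntilipschitzWith K f)
    (A : Set (EuclideanSpace ℝ (Fin n))) :
    volume (f ⁻¹' A) ≤ (K : ℝ≥0∞) ^ n * volume A := by
  have h := Measure.isAddLeftInvariant_eq_smul
    (volume : Measure (EuclideanSpace ℝ (Fin n)))
    (Measure.hausdorffMeasure (finrank ℝ (EuclideanSpace ℝ (Fin n))))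
  have h' := hf.hausdorffMeasure_preimage_le
    (Nat.cast_nonneg (finrank ℝ (EuclideanSpace ℝ (Fin n)))) A
  rw [h]
  simp only [finrank_euclideanSpace_fin, ENNReal.rpow_natCast, Measure.smul_apply,
    ENNReal.smul_def, smul_eq_mul] at h' ⊢
  rw [mul_left_comm]
  gcongr

theorem AntilipschitzWith.lintegral_comp_le {n : ℕ} {K : ℝ≥0}
    {f : EuclideanSpace ℝ (Fin n) → EuclideanSpace ℝ (Fin n)} (hf : AntilipschitzWith K f)
    (hfm : Measurable f) {g : EuclideanSpace ℝ (Fin n) → ℝ≥0∞} (hg : Measurable g) :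
    ∫⁻ x, g (f x) ≤ (K : ℝ≥0∞) ^ n * ∫⁻ x, g x := by
  rw [← lintegral_map hg hfm, ← smul_eq_mul, ← lintegral_smul_measure]
  refine lintegral_mono' (Measure.le_iff.2 fun A hA => ?_) le_rfl
  rw [Measure.map_apply hfm hA, Measure.smul_apply, smul_eq_mul]
  exact hf.volume_preimage_le A

/-- Contracting towards nearest points of a set by the factor `t` shrinks distances by at most `t`,
because the nearest-point map is monotone. -/
theorem antilipschitzWith_homothety_nearest {E : Type*} [NormedAddCommGroup E]
    [InnerProductSpace ℝ E] {p : E → E} (hp : ∀ x y, dist x (p x) ≤ dist x (p y))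
    {t : ℝ} (ht : 0 < t) (ht1 : t ≤ 1) :
    AntilipschitzWith (t⁻¹).toNNReal fun x => p x + t • (x - p x) := by
  refine AntilipschitzWith.of_le_mul_dist fun x y => ?_
  rw [Real.coe_toNNReal _ (inv_nonneg.2 ht.le), inv_mul_eq_div, le_div_iff₀ ht, dist_eq_norm,
    dist_eq_norm]
  set w := p x + t • (x - p x) - (p y + t • (y - p y)) with hw
  have hmono : 0 ≤ inner ℝ (p x - p y) (x - y) := by
    have h1 := hp x y
    have h2 := hp y x
    rw [dist_eq_norm, dist_eq_norm, ← sq_le_sq₀ (norm_nonneg _) (norm_nonneg _)] at h1 h2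
    simp only [← real_inner_self_eq_norm_sq, inner_sub_left, inner_sub_right] at h1 h2 ⊢
    linarith [real_inner_comm x (p x), real_inner_comm x (p y), real_inner_comm y (p x),
      real_inner_comm y (p y)]
  have hwe : w = t • (x - y) + (1 - t) • (p x - p y) := by rw [hw]; module
  have hinner : t * ‖x - y‖ ^ 2 ≤ inner ℝ w (x - y) := by
    rw [hwe, inner_add_left, inner_smul_left, inner_smul_left, real_inner_self_eq_norm_sq]
    have := mul_nonneg (sub_nonneg.2 ht1) hmono
    simpa using this
  have hcs := real_inner_le_norm w (x - y)
  rcases (norm_nonneg (x - y)).eq_or_lt with h0 | h0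
  · rw [← h0]; simp
  · nlinarith

theorem enorm_le_lintegral_enorm_fderiv {E : Type*} [NormedAddCommGroup E] [NormedSpace ℝ E]
    {φ : E → ℝ} (hφ : ContDiff ℝ 1 φ) {p : E} (hp : φ p = 0) (x : E) :
    ‖φ x‖ₑ ≤ ∫⁻ t in Ioc (0 : ℝ) 1, ‖fderiv ℝ φ (p + t • (x - p)) (x - p)‖ₑ := by
  have hder : ∀ t : ℝ, HasDerivAt (fun t : ℝ => φ (p + t • (x - p)))
      (fderiv ℝ φ (p + t • (x - p)) (x - p)) t := fun t => by
    have h1 : HasDerivAt (fun t : ℝ => p + t • (x - p)) (x - p) t := by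
      simpa using ((hasDerivAt_id t).smul_const (x - p)).const_add p
    exact ((hφ.differentiable one_ne_zero _).hasFDerivAt).comp_hasDerivAt t h1
  have hcont : Continuous fun t : ℝ => fderiv ℝ φ (p + t • (x - p)) (x - p) :=
    ((hφ.continuous_fderiv one_ne_zero).comp (by fun_prop)).clm_apply continuous_const
  have h := intervalIntegral.integral_eq_sub_of_hasDerivAt (a := 0) (b := 1)
    (fun t _ => hder t) (hcont.intervalIntegrable _ _)
  rw [intervalIntegral.integral_of_le zero_le_one] at h
  have hx : φ x = ∫ t in Ioc (0 : ℝ) 1, fderiv ℝ φ (p + t • (x - p)) (x - p) := by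
    rw [h]; simp [hp]
  rw [hx]
  exact enorm_integral_le_lintegral_enorm _

/-- `L¹` Hardy inequality with the distance to a finite piece of `K`, in terms of a nearest-point
selection `p`, on the left hand side. -/
theorem lintegral_hardy_nearest {n : ℕ} {s : ℝ} (hs : (n : ℝ) < s) (hs1 : 1 ≤ s)
    {K : Set (EuclideanSpace ℝ (Fin n))} (hK : IsClosed K)
    {φ : EuclideanSpace ℝ (Fin n) → ℝ} (hφ : ContDiff ℝ 1 φ) (hφK : Disjoint (tsupport φ) K)
    {p : EuclideanSpace ℝ (Fin n) → EuclideanSpace ℝ (Fin n)} (hpm : Measurable p)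
    (hpK : ∀ x, p x ∈ K) (hp : ∀ x y, dist x (p x) ≤ dist x (p y)) :
    ∫⁻ x, ENNReal.ofReal (|φ x| * dist x (p x) ^ (-s)) ≤
      ENNReal.ofReal (1 / (s - n)) *
        ∫⁻ x, ENNReal.ofReal (‖fderiv ℝ φ x‖ * infDist x K ^ (-(s - 1))) := by
  set g : EuclideanSpace ℝ (Fin n) → ℝ≥0∞ :=
    fun x => ENNReal.ofReal (‖fderiv ℝ φ x‖ * infDist x K ^ (-(s - 1))) with hg
  have hgm : Measurable g := by
    have := (hφ.continuous_fderiv one_ne_zero).measurable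
    exact (this.norm.mul ((measurable_infDist).pow_const _)).ennreal_ofReal
  have hφ0 : ∀ x ∈ K, φ x = 0 := fun x hx =>
    image_eq_zero_of_notMem_tsupport fun h => hφK.le_bot ⟨h, hx⟩
  have hdφ0 : ∀ x ∈ K, fderiv ℝ φ x = 0 := fun x hx =>
    image_eq_zero_of_notMem_tsupport fun h =>
      hφK.le_bot ⟨tsupport_fderiv_subset ℝ h, hx⟩
  have hpt : ∀ x, ENNReal.ofReal (|φ x| * dist x (p x) ^ (-s)) ≤
      ∫⁻ t in Ioc (0 : ℝ) 1, ENNReal.ofReal (t ^ (s - 1)) * g (p x + t • (x - p x)) := by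
    intro x
    rw [ENNReal.ofReal_mul (abs_nonneg _), ← Real.norm_eq_abs, ofReal_norm]
    refine (mul_le_mul_left (enorm_le_lintegral_enorm_fderiv hφ (hφ0 _ (hpK x)) x) _).trans ?_
    rw [← lintegral_mul_const' _ _ ENNReal.ofReal_ne_top]
    refine setLIntegral_mono' measurableSet_Ioc fun t ht => ?_
    set y := p x + t • (x - p x) with hy
    rw [hg, ← ofReal_norm, ← ENNReal.ofReal_mul (norm_nonneg _),
      ← ENNReal.ofReal_mul (Real.rpow_nonneg ht.1.le _)]
    refine ENNReal.ofReal_le_ofReal ?_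
    by_cases hyK : y ∈ K
    · simp [hdφ0 y hyK]
    have hd : 0 < infDist y K := (hK.notMem_iff_infDist_pos ⟨_, hpK x⟩).1 hyK
    have hle : infDist y K ≤ t * dist x (p x) := by
      refine (infDist_le_dist_of_mem (hpK x)).trans_eq ?_
      rw [hy, dist_eq_norm, add_sub_cancel_left, norm_smul, Real.norm_of_nonneg ht.1.le,
        dist_eq_norm]
    have hr : 0 < dist x (p x) := by
      have := hd.trans_le hle
      exact pos_of_mul_pos_right this ht.1.le
    calc ‖fderiv ℝ φ y (x - p x)‖ * dist x (p x) ^ (-s)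
        ≤ (‖fderiv ℝ φ y‖ * dist x (p x)) * dist x (p x) ^ (-s) := by
          gcongr
          rw [dist_eq_norm]
          exact (fderiv ℝ φ y).le_opNorm _
      _ = ‖fderiv ℝ φ y‖ * dist x (p x) ^ (-(s - 1)) := by
          have h := Real.rpow_add hr 1 (-s)
          rw [Real.rpow_one] at h
          rw [mul_assoc, ← h]
          ring_nf
      _ = t ^ (s - 1) * (‖fderiv ℝ φ y‖ * (t * dist x (p x)) ^ (-(s - 1))) := by
          rw [Real.mul_rpow ht.1.le hr.le, Real.rpow_neg ht.1.le]
          have := (Real.rpow_pos_of_pos ht.1 (s - 1)).ne'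
          field_simp
      _ ≤ t ^ (s - 1) * (‖fderiv ℝ φ y‖ * infDist y K ^ (-(s - 1))) := by
          have := Real.rpow_nonneg ht.1.le (s - 1)
          gcongr ?_ * (?_ * ?_)
          exact Real.rpow_le_rpow_of_nonpos hd hle (by linarith)
  calc ∫⁻ x, ENNReal.ofReal (|φ x| * dist x (p x) ^ (-s))
      ≤ ∫⁻ x, ∫⁻ t in Ioc (0 : ℝ) 1,
          ENNReal.ofReal (t ^ (s - 1)) * g (p x + t • (x - p x)) := lintegral_mono hpt
    _ = ∫⁻ t in Ioc (0 : ℝ) 1, ∫⁻ x,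
          ENNReal.ofReal (t ^ (s - 1)) * g (p x + t • (x - p x)) := by
        refine lintegral_lintegral_swap (Measurable.aemeasurable ?_)
        have hpm' : Measurable fun z : EuclideanSpace ℝ (Fin n) × ℝ => p z.1 :=
          hpm.comp measurable_fst
        exact (measurable_snd.pow_const _).ennreal_ofReal.mul (hgm.comp
          (hpm'.add (measurable_snd.smul (measurable_fst.sub hpm'))))
    _ ≤ ∫⁻ t in Ioc (0 : ℝ) 1, ENNReal.ofReal (t ^ (s - 1 - n)) * ∫⁻ x, g x := by
        refine setLIntegral_mono' measurableSet_Ioc fun t ht => ?_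
        rw [lintegral_const_mul' _ _ ENNReal.ofReal_ne_top]
        have h := (antilipschitzWith_homothety_nearest hp ht.1 ht.2).lintegral_comp_le
          (hpm.add ((measurable_id.sub hpm).const_smul t)) hgm
        refine (mul_le_mul_right h _).trans_eq ?_
        rw [← mul_assoc]
        congr 1
        change _ * ENNReal.ofReal t⁻¹ ^ n = _
        rw [← ENNReal.ofReal_pow (inv_nonneg.2 ht.1.le),
          ← ENNReal.ofReal_mul (Real.rpow_nonneg ht.1.le _), Real.rpow_sub ht.1 (s - 1),
          Real.rpow_natCast, inv_pow, div_eq_mul_inv]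
    _ = ENNReal.ofReal (1 / (s - n)) * ∫⁻ x, g x := by
        rw [lintegral_mul_const _ (by fun_prop)]
        congr 1
        have hexp : -1 < s - 1 - n := by linarith
        have hint := (intervalIntegral.intervalIntegrable_rpow' (a := 0) (b := 1) hexp)
        rw [intervalIntegrable_iff_integrableOn_Ioc_of_le zero_le_one] at hint
        rw [← ofReal_integral_eq_lintegral_ofReal hint
          ((ae_restrict_mem measurableSet_Ioc).mono fun t ht => Real.rpow_nonneg ht.1.le _),
          ← intervalIntegral.integral_of_le zero_le_one, integral_rpow (Or.inl hexp)]
        have hne : s - 1 - n + 1 ≠ 0 := by linarith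
        rw [Real.one_rpow, Real.zero_rpow hne]
        ring_nf

theorem tendsto_dist_nearestPt {X : Type*} [PseudoMetricSpace X] [MeasurableSpace X]
    [OpensMeasurableSpace X] {K : Set X} {e : ℕ → X} (heK : ∀ k, e k ∈ K)
    (hdense : K ⊆ closure (range e)) (x : X) :
    Tendsto (fun N => dist x (SimpleFunc.nearestPt e N x)) atTop (𝓝 (infDist x K)) := by
  have hmem : ∀ N, SimpleFunc.nearestPt e N x ∈ K := fun N => heK _
  refine tendsto_order.2 ⟨fun a ha => Eventually.of_forall fun N =>
    ha.trans_le (infDist_le_dist_of_mem (hmem N)), fun a ha => ?_⟩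
  have ha' : infDist x (range e) < a := by
    rw [← infDist_closure]
    exact (infDist_le_infDist_of_subset hdense ⟨_, heK 0⟩).trans_lt ha
  obtain ⟨_, ⟨k, rfl⟩, hk⟩ := (infDist_lt_iff (range_nonempty e)).1 ha'
  filter_upwards [eventually_ge_atTop k] with N hN
  refine lt_of_le_of_lt ?_ hk
  have := SimpleFunc.edist_nearestPt_le e x hN
  rw [edist_dist, edist_dist, ENNReal.ofReal_le_ofReal_iff dist_nonneg] at this
  rwa [dist_comm x, dist_comm x]

/-- `L¹` Hardy inequality for the distance to a nonempty closed set. -/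
theorem lintegral_hardy {n : ℕ} {s : ℝ} (hs : (n : ℝ) < s) (hs1 : 1 ≤ s)
    {K : Set (EuclideanSpace ℝ (Fin n))} (hK : IsClosed K) (hKne : K.Nonempty)
    {φ : EuclideanSpace ℝ (Fin n) → ℝ} (hφ : ContDiff ℝ 1 φ) (hφK : Disjoint (tsupport φ) K) :
    ∫⁻ x, ENNReal.ofReal (|φ x| * infDist x K ^ (-s)) ≤
      ENNReal.ofReal (1 / (s - n)) *
        ∫⁻ x, ENNReal.ofReal (‖fderiv ℝ φ x‖ * infDist x K ^ (-(s - 1))) := by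
  have : Nonempty K := hKne.to_subtype
  set e : ℕ → EuclideanSpace ℝ (Fin n) := fun k => TopologicalSpace.denseSeq K k with he
  have heK : ∀ k, e k ∈ K := fun k => (TopologicalSpace.denseSeq K k).2
  have hdense : K ⊆ closure (range e) := fun x hx => by
    have h := (TopologicalSpace.denseRange_denseSeq K) ⟨x, hx⟩
    have h2 := image_closure_subset_closure_image continuous_subtype_val (mem_image_of_mem _ h)
    rwa [← range_comp] at h2
  have hpm : ∀ N, Measurable (SimpleFunc.nearestPt e N) := fun N => SimpleFunc.measurable _
  have hp : ∀ N x y,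
      dist x (SimpleFunc.nearestPt e N x) ≤ dist x (SimpleFunc.nearestPt e N y) := by
    intro N x y
    have := SimpleFunc.edist_nearestPt_le e x (SimpleFunc.nearestPtInd_le e N y)
    rw [edist_dist, edist_dist, ENNReal.ofReal_le_ofReal_iff dist_nonneg] at this
    rwa [dist_comm x, dist_comm x]
  have hlim : ∀ x, Tendsto
      (fun N => ENNReal.ofReal (|φ x| * dist x (SimpleFunc.nearestPt e N x) ^ (-s))) atTop
      (𝓝 (ENNReal.ofReal (|φ x| * infDist x K ^ (-s)))) := by
    intro x
    by_cases hx : x ∈ tsupport φ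
    · have hd : 0 < infDist x K :=
        (hK.notMem_iff_infDist_pos hKne).1 fun h => hφK.le_bot ⟨hx, h⟩
      exact ENNReal.tendsto_ofReal (((tendsto_dist_nearestPt heK hdense x).rpow_const
        (Or.inl hd.ne')).const_mul _)
    · simp [image_eq_zero_of_notMem_tsupport hx]
  calc ∫⁻ x, ENNReal.ofReal (|φ x| * infDist x K ^ (-s))
      = ∫⁻ x, liminf (fun N =>
          ENNReal.ofReal (|φ x| * dist x (SimpleFunc.nearestPt e N x) ^ (-s))) atTop :=
        lintegral_congr fun x => (hlim x).liminf_eq.symm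
    _ ≤ liminf (fun N => ∫⁻ x,
          ENNReal.ofReal (|φ x| * dist x (SimpleFunc.nearestPt e N x) ^ (-s))) atTop := by
        refine lintegral_liminf_le fun N => ?_
        have h1 := hφ.continuous.measurable.norm
        exact (h1.mul ((measurable_id.dist (hpm N)).pow_const _)).ennreal_ofReal
    _ ≤ liminf (fun _ : ℕ => ENNReal.ofReal (1 / (s - n)) *
          ∫⁻ x, ENNReal.ofReal (‖fderiv ℝ φ x‖ * infDist x K ^ (-(s - 1)))) atTop :=
        liminf_le_liminf (Eventually.of_forall fun N =>
          lintegral_hardy_nearest hs hs1 hK hφ hφK (hpm N) (fun _ => heK _) (hp N))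
    _ = _ := liminf_const _

theorem integrable_mul_infDist_rpow {n : ℕ} {K : Set (EuclideanSpace ℝ (Fin n))}
    (hK : IsClosed K) (hKne : K.Nonempty) {f : EuclideanSpace ℝ (Fin n) → ℝ} (hf : Continuous f)
    (hfc : HasCompactSupport f) (hfK : Disjoint (tsupport f) K) (r : ℝ) :
    Integrable fun x => f x * infDist x K ^ r := by
  refine Continuous.integrable_of_hasCompactSupport ?_ hfc.mul_right
  refine continuous_of_tsupport fun x hx => ?_
  have hxf : x ∈ tsupport f := tsupport_mul_subset_left hx
  have hd : 0 < infDist x K :=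
    (hK.notMem_iff_infDist_pos hKne).1 fun h => hfK.le_bot ⟨hxf, h⟩
  exact hf.continuousAt.mul
    ((continuous_infDist_pt K).continuousAt.rpow_const (Or.inl hd.ne'))

theorem stmt_8 (n : ℕ) (s : ℝ) (hs : (n : ℝ) < s)
    (Ω : Set (EuclideanSpace ℝ (Fin n)))
    (hΩopen : IsOpen Ω) (hΩconn : IsConnected Ω) (hΩne : Ω.Nonempty)
    (hΩproper : Ω ≠ Set.univ)
    (φ : EuclideanSpace ℝ (Fin n) → ℝ) (hφ : ContDiff ℝ (⊤ : ℕ∞) φ)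
    (hφc : HasCompactSupport φ) (hφsupp : tsupport φ ⊆ Ω) :
    ∫ x in Ω, ‖fderiv ℝ φ x‖ * (infDist x (frontier Ω)) ^ (-(s - 1)) ≥
      (s - n) * ∫ x in Ω, |φ x| * (infDist x (frontier Ω)) ^ (-s) := by
  have hn : 1 ≤ n := by
    rcases Nat.eq_zero_or_pos n with rfl | h
    · exact absurd (Subsingleton.eq_univ_of_nonempty hΩne) hΩproper
    · exact h
  have hs1 : 1 ≤ s := (Nat.one_le_cast.2 hn).trans hs.le
  have hKne : (frontier Ω).Nonempty := nonempty_frontier_iff.2 ⟨hΩne, hΩproper⟩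
  have hK : IsClosed (frontier Ω) := isClosed_frontier
  have hdisj : Disjoint (tsupport φ) (frontier Ω) :=
    (disjoint_frontier_iff_isOpen.2 hΩopen).symm.mono_left hφsupp
  have hφ1 : ContDiff ℝ 1 φ := hφ.of_le (by exact_mod_cast le_top)
  have hcd := hφ1.continuous_fderiv one_ne_zero
  have hsub : tsupport (fun x => ‖fderiv ℝ φ x‖) ⊆ tsupport φ :=
    (closure_mono fun x hx => by simpa using hx).trans (tsupport_fderiv_subset ℝ)
  have hsub' : tsupport (fun x => |φ x|) ⊆ tsupport φ :=
    closure_mono fun x hx => by simpa using hx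
  rw [setIntegral_eq_integral_of_forall_compl_eq_zero fun x hx => ?_,
    setIntegral_eq_integral_of_forall_compl_eq_zero fun x hx => ?_]
  rotate_left
  · rw [image_eq_zero_of_notMem_tsupport fun h => hx (hφsupp h)]; simp
  · rw [image_eq_zero_of_notMem_tsupport (f := fderiv ℝ φ)
      fun h => hx (hφsupp (tsupport_fderiv_subset ℝ h))]
    simp
  have hi1 := integrable_mul_infDist_rpow hK hKne hcd.norm (hφc.fderiv ℝ).norm
    (hdisj.mono_left hsub) (-(s - 1))
  have hi2 := integrable_mul_infDist_rpow hK hKne hφ.continuous.abs hφc.norm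
    (hdisj.mono_left hsub') (-s)
  have h := lintegral_hardy hs hs1 hK hKne hφ1 hdisj
  rw [← ofReal_integral_eq_lintegral_ofReal hi1 (Eventually.of_forall fun x =>
      mul_nonneg (norm_nonneg _) (Real.rpow_nonneg infDist_nonneg _)),
    ← ofReal_integral_eq_lintegral_ofReal hi2 (Eventually.of_forall fun x =>
      mul_nonneg (abs_nonneg _) (Real.rpow_nonneg infDist_nonneg _))] at h
  have hsn : 0 < s - n := sub_pos.2 hs
  have hnn : 0 ≤ ∫ x, ‖fderiv ℝ φ x‖ * infDist x (frontier Ω) ^ (-(s - 1)) :=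
    integral_nonneg fun x => mul_nonneg (norm_nonneg _) (Real.rpow_nonneg infDist_nonneg _)
  rw [← ENNReal.ofReal_mul (by positivity), ENNReal.ofReal_le_ofReal_iff (by positivity),
    one_div, inv_mul_eq_div, le_div_iff₀' hsn] at h
  exact h
end

section
/- Let Ω ⊊ ℝⁿ be a domain, 1 < p < ∞, and s > n. Assume the L¹-Hardy inequality ∫_Ω |∇φ| d_Ω^{−(s−1)} dx ≥ (s−n) ∫_Ω |φ| d_Ω^{−s} dx holds for all φ ∈ C_c^∞(Ω). Then for every ψ ∈ C_c^∞(Ω), ((s−n)/p)^p ∫_Ω |ψ|^p d_Ω^{−s} dx ≤ ∫_Ω |∇ψ|^p d_Ω^{−(s−p)} dx. -/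
open MeasureTheory Metric Set

open Filter Topology

section CompactIntegrals

variable {E : Type*} [NormedAddCommGroup E] [MeasurableSpace E] [BorelSpace E]
  {μ : Measure E} [IsFiniteMeasureOnCompacts μ] {K : Set E}

theorem ContinuousOn.memLp_restrict_of_isCompact {f : E → ℝ} (hf : ContinuousOn f K)
    (hK : IsCompact K) (q : ENNReal) : MemLp f q (μ.restrict K) := by
  obtain ⟨C, hC⟩ := hK.exists_bound_of_continuousOn hf
  have : IsFiniteMeasure (μ.restrict K) := ⟨by simpa using hK.measure_lt_top⟩
  refine MemLp.of_bound (hf.aestronglyMeasurable_of_isCompact hK hK.measurableSet) C ?_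
  exact (ae_restrict_iff' hK.measurableSet).2 (.of_forall hC)

/-- Hölder's inequality with weights that are powers of a positive function `d`. -/
theorem setIntegral_weighted_holder (hK : IsCompact K) {V G d : E → ℝ} {p s : ℝ} (hp : 1 < p)
    (hV : ContinuousOn V K) (hG : ContinuousOn G K) (hd : ContinuousOn d K)
    (hVpos : ∀ x ∈ K, 0 < V x) (hGnonneg : ∀ x ∈ K, 0 ≤ G x) (hdpos : ∀ x ∈ K, 0 < d x) :
    ∫ x in K, V x ^ ((p - 1) / 2) * G x * d x ^ (-(s - 1)) ∂μ ≤
      (∫ x in K, V x ^ (p / 2) * d x ^ (-s) ∂μ) ^ ((p - 1) / p) *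
        (∫ x in K, G x ^ p * d x ^ (-(s - p)) ∂μ) ^ (1 / p) := by
  have hp0 : 0 < p := by linarith
  have hp1 : p - 1 ≠ 0 := by linarith
  have hpow (a : ℝ) : ContinuousOn (fun x ↦ d x ^ a) K :=
    hd.rpow_const fun x hx ↦ .inl (hdpos x hx).ne'
  have hVpow (a : ℝ) : ContinuousOn (fun x ↦ V x ^ a) K :=
    hV.rpow_const fun x hx ↦ .inl (hVpos x hx).ne'
  have hpq : (p / (p - 1)).HolderConjugate p :=
    ((Real.holderConjugate_iff_eq_conjExponent hp).2 rfl).symm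
  have key := integral_mul_le_Lp_mul_Lq_of_nonneg (μ := μ.restrict K) hpq
    (f := fun x ↦ V x ^ ((p - 1) / 2) * d x ^ (-s * ((p - 1) / p)))
    (g := fun x ↦ G x * d x ^ (-(s - p) / p))
    ((ae_restrict_iff' hK.measurableSet).2 <| .of_forall fun x hx ↦
      mul_nonneg (Real.rpow_nonneg (hVpos x hx).le _) (Real.rpow_nonneg (hdpos x hx).le _))
    ((ae_restrict_iff' hK.measurableSet).2 <| .of_forall fun x hx ↦
      mul_nonneg (hGnonneg x hx) (Real.rpow_nonneg (hdpos x hx).le _))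
    (((hVpow _).mul (hpow _)).memLp_restrict_of_isCompact hK _)
    ((hG.mul (hpow _)).memLp_restrict_of_isCompact hK _)
  rw [one_div_div] at key
  convert key using 1
  · refine setIntegral_congr_fun hK.measurableSet fun x hx ↦ ?_
    have : d x ^ (-(s - 1)) = d x ^ (-s * ((p - 1) / p)) * d x ^ (-(s - p) / p) := by
      rw [← Real.rpow_add (hdpos x hx)]
      congr 1
      field_simp
      ring
    simp only [this]
    ring
  · congr 2
    · refine setIntegral_congr_fun hK.measurableSet fun x hx ↦ ?_
      rw [Real.mul_rpow (Real.rpow_nonneg (hVpos x hx).le _) (Real.rpow_nonneg (hdpos x hx).le _),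
        ← Real.rpow_mul (hVpos x hx).le, ← Real.rpow_mul (hdpos x hx).le]
      congr 2 <;> field_simp
    · refine setIntegral_congr_fun hK.measurableSet fun x hx ↦ ?_
      rw [Real.mul_rpow (hGnonneg x hx) (Real.rpow_nonneg (hdpos x hx).le _),
        ← Real.rpow_mul (hdpos x hx).le]
      congr 2
      field_simp

theorem tendsto_setIntegral_sq_add_rpow (hK : IsCompact K) {f w : E → ℝ} {q : ℝ} (hq : 0 < q)
    (hf : ContinuousOn f K) (hw : ContinuousOn w K) :
    Tendsto (fun δ : ℝ ↦ ∫ x in K, (f x ^ 2 + δ) ^ q * w x ∂μ) (𝓝[>] 0)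
      (𝓝 (∫ x in K, (f x ^ 2) ^ q * w x ∂μ)) := by
  have hcont (δ : ℝ) : ContinuousOn (fun x ↦ (f x ^ 2 + δ) ^ q * w x) K :=
    (((hf.pow 2).add continuousOn_const).rpow_const fun _ _ ↦ .inr hq.le).mul hw
  refine tendsto_integral_filter_of_dominated_convergence
    (fun x ↦ ‖(f x ^ 2 + 1) ^ q * w x‖) ?_ ?_ ?_ ?_
  · exact .of_forall fun δ ↦ (hcont δ).aestronglyMeasurable_of_isCompact hK hK.measurableSet
  · filter_upwards [Ioo_mem_nhdsGT (zero_lt_one' ℝ)] with δ hδ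
    refine .of_forall fun x ↦ ?_
    have h0 : 0 ≤ f x ^ 2 + δ := by nlinarith [hδ.1, sq_nonneg (f x)]
    rw [norm_mul, norm_mul, Real.norm_of_nonneg (Real.rpow_nonneg h0 _),
      Real.norm_of_nonneg (show 0 ≤ (f x ^ 2 + 1) ^ q by positivity)]
    gcongr
    exact hδ.2.le
  · exact ((hcont 1).integrableOn_compact hK).norm
  · refine .of_forall fun x ↦ Tendsto.mul_const _ ?_
    have : ContinuousAt (fun δ : ℝ ↦ (f x ^ 2 + δ) ^ q) 0 :=
      (continuousAt_const.add continuousAt_id).rpow_const (.inr hq.le)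
    simpa using this.tendsto.mono_left nhdsWithin_le_nhds

end CompactIntegrals

theorem norm_fderiv_sq_add_rpow_sub_le {E : Type*} [NormedAddCommGroup E] [NormedSpace ℝ E]
    {f : E → ℝ} {x : E} (hf : DifferentiableAt ℝ f x) {p δ : ℝ} (hp : 0 ≤ p) (hδ : 0 < δ) :
    ‖fderiv ℝ (fun y ↦ (f y ^ 2 + δ) ^ (p / 2) - δ ^ (p / 2)) x‖ ≤
      p * ((f x ^ 2 + δ) ^ ((p - 1) / 2) * ‖fderiv ℝ f x‖) := by
  have hV : 0 < f x ^ 2 + δ := by positivity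
  have h := (((hf.hasFDerivAt.pow 2).add_const δ).rpow_const (p := p / 2)
    (.inl hV.ne')).sub_const (δ ^ (p / 2))
  rw [h.fderiv, norm_smul, norm_smul]
  have habs : |f x| ≤ (f x ^ 2 + δ) ^ (1 / 2 : ℝ) := by
    rw [← Real.sqrt_eq_rpow]
    exact Real.abs_le_sqrt (by linarith)
  have hsplit : (f x ^ 2 + δ) ^ ((p - 1) / 2) =
      (f x ^ 2 + δ) ^ (p / 2 - 1) * (f x ^ 2 + δ) ^ (1 / 2 : ℝ) := by
    rw [← Real.rpow_add hV]
    congr 1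
    ring
  have h1 : 0 ≤ (f x ^ 2 + δ) ^ (p / 2 - 1) := Real.rpow_nonneg hV.le _
  rw [hsplit, Real.norm_of_nonneg (mul_nonneg (by positivity) h1)]
  calc p / 2 * (f x ^ 2 + δ) ^ (p / 2 - 1) * (‖(2 • f x ^ (2 - 1) : ℝ)‖ * ‖fderiv ℝ f x‖)
      = p * ((f x ^ 2 + δ) ^ (p / 2 - 1) * |f x| * ‖fderiv ℝ f x‖) := by
        simp
        ring
    _ ≤ _ := by gcongr

theorem Real.div_rpow_mul_le_of_mul_le {a A B p : ℝ} (hp : 1 < p) (ha : 0 ≤ a) (hA : 0 ≤ A)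
    (hB : 0 ≤ B) (h : a * A ≤ p * (A ^ ((p - 1) / p) * B ^ (1 / p))) :
    (a / p) ^ p * A ≤ B := by
  have hp0 : 0 < p := by linarith
  rcases hA.eq_or_lt with rfl | hA'
  · simpa using hB
  have hsplit : A = A ^ ((p - 1) / p) * A ^ (1 / p) := by
    rw [← Real.rpow_add hA', show (p - 1) / p + 1 / p = 1 by field_simp; ring, Real.rpow_one]
  have hpos : 0 < A ^ ((p - 1) / p) := Real.rpow_pos_of_pos hA' _
  have h1 : a / p * A ^ (1 / p) ≤ B ^ (1 / p) := by
    rw [div_mul_eq_mul_div, div_le_iff₀ hp0]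
    refine le_of_mul_le_mul_left ?_ hpos
    calc A ^ ((p - 1) / p) * (a * A ^ (1 / p)) = a * (A ^ ((p - 1) / p) * A ^ (1 / p)) := by ring
      _ = a * A := by rw [← hsplit]
      _ ≤ _ := h
      _ = _ := by ring
  have h2 := Real.rpow_le_rpow (by positivity) h1 hp0.le
  rwa [Real.mul_rpow (by positivity) (by positivity), ← Real.rpow_mul hA, ← Real.rpow_mul hB,
    one_div_mul_cancel hp0.ne', Real.rpow_one, Real.rpow_one] at h2

theorem stmt_9 (n : ℕ) (p s : ℝ) (hp1 : 1 < p) (hs : (n : ℝ) < s)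
    (Ω : Set (EuclideanSpace ℝ (Fin n)))
    (hΩopen : IsOpen Ω) (hΩconn : IsConnected Ω) (hΩne : Ω.Nonempty)
    (hΩproper : Ω ≠ Set.univ)
    (hL1 : ∀ φ : EuclideanSpace ℝ (Fin n) → ℝ, ContDiff ℝ (⊤ : ℕ∞) φ →
      HasCompactSupport φ → tsupport φ ⊆ Ω →
      ∫ x in Ω, ‖fderiv ℝ φ x‖ * (infDist x (frontier Ω)) ^ (-(s - 1)) ≥
        (s - n) * ∫ x in Ω, |φ x| * (infDist x (frontier Ω)) ^ (-s))
    (ψ : EuclideanSpace ℝ (Fin n) → ℝ) (hψ : ContDiff ℝ (⊤ : ℕ∞) ψ)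
    (hψc : HasCompactSupport ψ) (hψsupp : tsupport ψ ⊆ Ω) :
    ((s - n) / p) ^ p * ∫ x in Ω, |ψ x| ^ p * (infDist x (frontier Ω)) ^ (-s) ≤
      ∫ x in Ω, ‖fderiv ℝ ψ x‖ ^ p * (infDist x (frontier Ω)) ^ (-(s - p)) := by
  have hp0 : 0 < p := by linarith
  have hfr : (frontier Ω).Nonempty := nonempty_frontier_iff.2 ⟨hΩne, hΩproper⟩
  set d : EuclideanSpace ℝ (Fin n) → ℝ := fun x ↦ infDist x (frontier Ω) with hd
  set K := tsupport ψ with hKdef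
  have hK : IsCompact K := hψc
  have hdpos : ∀ x ∈ K, 0 < d x := fun x hx ↦
    (isClosed_frontier.notMem_iff_infDist_pos hfr).1 fun h ↦
      disjoint_left.1 (disjoint_frontier_iff_isOpen.2 hΩopen) h (hψsupp hx)
  have hdc : ContinuousOn d K := (continuous_infDist_pt _).continuousOn
  have hdpow (a : ℝ) : ContinuousOn (fun x ↦ d x ^ a) K :=
    hdc.rpow_const fun x hx ↦ .inl (hdpos x hx).ne'
  have hψ0 {x} (hx : x ∉ K) : ψ x = 0 := image_eq_zero_of_notMem_tsupport hx
  have hψ'0 {x} (hx : x ∉ K) : fderiv ℝ ψ x = 0 :=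
    Function.notMem_support.1 fun h ↦ hx (support_fderiv_subset ℝ h)
  have hψ'c : Continuous fun x ↦ ‖fderiv ℝ ψ x‖ := (hψ.continuous_fderiv (by simp)).norm
  have hrestrict {F : EuclideanSpace ℝ (Fin n) → ℝ} (hF : ∀ x ∉ K, F x = 0) :
      ∫ x in Ω, F x = ∫ x in K, F x :=
    setIntegral_eq_of_subset_of_forall_sdiff_eq_zero hΩopen.measurableSet hψsupp
      fun x hx ↦ hF x hx.2
  rw [hrestrict (F := fun x ↦ |ψ x| ^ p * d x ^ (-s))
      fun x hx ↦ by simp [hψ0 hx, Real.zero_rpow hp0.ne'],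
    hrestrict (F := fun x ↦ ‖fderiv ℝ ψ x‖ ^ p * d x ^ (-(s - p)))
      fun x hx ↦ by simp [hψ'0 hx, Real.zero_rpow hp0.ne']]
  have hd0 (x) (a : ℝ) : 0 ≤ d x ^ a := Real.rpow_nonneg infDist_nonneg _
  refine Real.div_rpow_mul_le_of_mul_le hp1 (by linarith)
    (integral_nonneg fun x ↦ mul_nonneg (by positivity) (hd0 x _))
    (integral_nonneg fun x ↦ mul_nonneg (by positivity) (hd0 x _)) ?_
  set B := ∫ x in K, ‖fderiv ℝ ψ x‖ ^ p * d x ^ (-(s - p))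
  have hsq (x) : (ψ x ^ 2) ^ (p / 2) = |ψ x| ^ p := by
    rw [← sq_abs, ← Real.rpow_natCast, ← Real.rpow_mul (abs_nonneg _)]
    congr 1
    push_cast
    ring
  have hlim := tendsto_setIntegral_sq_add_rpow (μ := volume) hK (half_pos hp0)
    hψ.continuous.continuousOn (hdpow (-s))
  simp only [hsq] at hlim
  have hδlim : Tendsto (fun δ : ℝ ↦ δ ^ (p / 2) * ∫ x in K, d x ^ (-s)) (𝓝[>] 0) (𝓝 0) := by
    have := (Real.continuousAt_rpow_const 0 (p / 2) (.inr (half_pos hp0).le)).tendsto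
    rw [Real.zero_rpow (half_pos hp0).ne'] at this
    simpa using (this.mono_left nhdsWithin_le_nhds).mul_const (∫ x in K, d x ^ (-s))
  have hleft := (hlim.sub hδlim).const_mul (s - n)
  rw [sub_zero] at hleft
  have hright := ((hlim.rpow_const (p := (p - 1) / p)
    (.inr (by apply div_nonneg <;> linarith))).mul_const (B ^ (1 / p))).const_mul p
  refine le_of_tendsto_of_tendsto hleft hright ?_
  filter_upwards [self_mem_nhdsWithin] with δ (hδ : 0 < δ)
  have hVpos (x) : 0 < ψ x ^ 2 + δ := by positivity
  have hVc (a : ℝ) : Continuous fun x ↦ (ψ x ^ 2 + δ) ^ a :=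
    ((hψ.continuous.pow 2).add continuous_const).rpow_const fun x ↦ .inl (hVpos x).ne'
  set φ : EuclideanSpace ℝ (Fin n) → ℝ := fun x ↦ (ψ x ^ 2 + δ) ^ (p / 2) - δ ^ (p / 2) with hφdef
  have hφ : ContDiff ℝ (⊤ : ℕ∞) φ :=
    (((hψ.pow 2).add contDiff_const).rpow_const_of_ne fun x ↦ (hVpos x).ne').sub contDiff_const
  have hφ0 {x} (hx : x ∉ K) : φ x = 0 := by simp [hφdef, hψ0 hx]
  have hφnonneg (x) : 0 ≤ φ x := by
    refine sub_nonneg.2 (Real.rpow_le_rpow hδ.le ?_ (half_pos hp0).le)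
    nlinarith [sq_nonneg (ψ x)]
  have hφsub : tsupport φ ⊆ K := closure_minimal
    (fun x hx ↦ by_contra fun h ↦ hx (hφ0 h)) (isClosed_tsupport ψ)
  have hφ'0 {x} (hx : x ∉ K) : fderiv ℝ φ x = 0 :=
    Function.notMem_support.1 fun h ↦ hx (hφsub (support_fderiv_subset ℝ h))
  have hHardy := hL1 φ hφ (hK.of_isClosed_subset (isClosed_tsupport φ) hφsub)
    (hφsub.trans hψsupp)
  rw [hrestrict (F := fun x ↦ ‖fderiv ℝ φ x‖ * d x ^ (-(s - 1)))
      fun x hx ↦ by simp [hφ'0 hx],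
    hrestrict (F := fun x ↦ |φ x| * d x ^ (-s)) fun x hx ↦ by simp [hφ0 hx]] at hHardy
  have hsub : ∫ x in K, |φ x| * d x ^ (-s) =
      (∫ x in K, (ψ x ^ 2 + δ) ^ (p / 2) * d x ^ (-s)) - δ ^ (p / 2) * ∫ x in K, d x ^ (-s) := by
    rw [← integral_const_mul, ← integral_sub]
    · refine integral_congr_ae (.of_forall fun x ↦ ?_)
      simp only [abs_of_nonneg (hφnonneg x)]
      simp only [hφdef, sub_mul]
    · exact ((hVc _).continuousOn.mul (hdpow _)).integrableOn_compact hK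
    · exact (continuousOn_const.mul (hdpow _)).integrableOn_compact hK
  rw [← hsub]
  refine hHardy.le.trans ?_
  calc ∫ x in K, ‖fderiv ℝ φ x‖ * d x ^ (-(s - 1))
      ≤ ∫ x in K, p * ((ψ x ^ 2 + δ) ^ ((p - 1) / 2) * ‖fderiv ℝ ψ x‖ * d x ^ (-(s - 1))) := by
        refine integral_mono ?_ ?_ fun x ↦ ?_
        · exact ((hφ.continuous_fderiv (by simp)).norm.continuousOn.mul
            (hdpow _)).integrableOn_compact hK
        · exact (continuousOn_const.mul (((hVc _).mul hψ'c).continuousOn.mul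
            (hdpow _))).integrableOn_compact hK
        · simp only
          rw [← mul_assoc]
          exact mul_le_mul_of_nonneg_right (norm_fderiv_sq_add_rpow_sub_le
            (hψ.differentiable (by simp) x) hp0.le hδ) (hd0 x _)
    _ = p * ∫ x in K, (ψ x ^ 2 + δ) ^ ((p - 1) / 2) * ‖fderiv ℝ ψ x‖ * d x ^ (-(s - 1)) :=
        integral_const_mul _ _
    _ ≤ _ := by
        gcongr
        exact setIntegral_weighted_holder hK hp1
          ((hψ.continuous.pow 2).add continuous_const).continuousOn hψ'c.continuousOn hdc
          (fun x _ ↦ hVpos x) (fun x _ ↦ norm_nonneg _) hdpos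
end

section
/- Let Ω ⊊ ℝⁿ be a domain, 1 < p < ∞, α ∈ ℝ, and 0 < γ < (α+p−n)/(p−1). Then d_Ω^γ is a weak positive supersolution of −div(d_Ω^{−α} |∇u|^{p−2} ∇u) − C_{α,p,n,γ} d_Ω^{−(p+α)} |u|^{p−2} u = 0 in Ω; i.e., for all nonnegative φ ∈ C_c^∞(Ω), ∫_Ω d_Ω^{−α} |∇(d_Ω^γ)|^{p−2} ∇(d_Ω^γ) · ∇φ dx ≥ C_{α,p,n,γ} ∫_Ω d_Ω^{γ(p−1)−α−p} φ dx, where C_{α,p,n,γ} = γ^{p−1}(α − n + 1 − (γ−1)(p−1)). -/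
open MeasureTheory Metric Set
open scoped RealInnerProductSpace

open Filter Topology in
/-- A weak form of `∂ᵥᵥ f ≤ c` for a locally Lipschitz function `f` whose second differences in
the direction `v` are at most `c * t ^ 2`. -/
theorem integral_lineDeriv_mul_lineDeriv_ge {E : Type*} [NormedAddCommGroup E] [NormedSpace ℝ E]
    [FiniteDimensional ℝ E] [MeasurableSpace E] [BorelSpace E] {μ : Measure E}
    [μ.IsAddHaarMeasure] {f ψ : E → ℝ} {v : E} {c : ℝ}
    (hf : LocallyLipschitz f) (hψ : LocallyLipschitz ψ) (hc : HasCompactSupport ψ)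
    (hψ0 : ∀ x, 0 ≤ ψ x)
    (hf' : ∀ᵐ x ∂μ, LineDifferentiableAt ℝ f x v)
    (hψ' : ∀ᵐ x ∂μ, LineDifferentiableAt ℝ ψ x v)
    (hfc : ∀ x (t : ℝ), f (x + t • v) + f (x - t • v) - 2 * f x ≤ c * t ^ 2) :
    Integrable (fun x => lineDeriv ℝ f x v * lineDeriv ℝ ψ x v) μ ∧
      -c * ∫ x, ψ x ∂μ ≤ ∫ x, lineDeriv ℝ f x v * lineDeriv ℝ ψ x v ∂μ := by
  have hfC := hf.continuous
  have hψC := hψ.continuous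
  obtain ⟨r, hr⟩ := hc.isCompact.isBounded.subset_closedBall (0 : E)
  have hK : IsCompact (closedBall (0 : E) (r + 2 * ‖v‖)) := isCompact_closedBall _ _
  obtain ⟨C, hC⟩ := hf.locallyLipschitzOn.exists_lipschitzOnWith_of_compact hK
  obtain ⟨D, hD⟩ := hψ.locallyLipschitzOn.exists_lipschitzOnWith_of_compact hK
  let F : ℝ → E → ℝ := fun t x =>
    (t⁻¹ • (f (x + t • v) - f x)) * (t⁻¹ • (ψ (x + t • v) - ψ x))
  let bound : E → ℝ := (closedBall (0 : E) (r + ‖v‖)).indicator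
    fun _ => (C * ‖v‖) * (D * ‖v‖)
  have hbi : Integrable bound μ := by
    refine (integrable_indicator_iff measurableSet_closedBall).2 ?_
    exact integrableOn_const (isCompact_closedBall _ _).measure_lt_top.ne
  have ht1 : ∀ᶠ t : ℝ in 𝓝[>] 0, t ∈ Ioc (0 : ℝ) 1 := Ioc_mem_nhdsGT one_pos
  have hquot {h : E → ℝ} {L : NNReal}
      (hL : LipschitzOnWith L h (closedBall (0 : E) (r + 2 * ‖v‖))) {t : ℝ}
      (ht : t ∈ Ioc (0 : ℝ) 1) {x : E} (hx : x ∈ closedBall (0 : E) (r + ‖v‖)) :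
      ‖t⁻¹ • (h (x + t • v) - h x)‖ ≤ L * ‖v‖ := by
    have hx1 : ‖x‖ ≤ r + ‖v‖ := by simpa using hx
    have htv : ‖t • v‖ ≤ ‖v‖ := by
      rw [norm_smul, Real.norm_of_nonneg ht.1.le]
      exact mul_le_of_le_one_left (norm_nonneg _) ht.2
    have h1 : x ∈ closedBall (0 : E) (r + 2 * ‖v‖) := by
      simp only [mem_closedBall, dist_zero_right]; linarith [norm_nonneg v]
    have h2 : x + t • v ∈ closedBall (0 : E) (r + 2 * ‖v‖) := by
      simp only [mem_closedBall, dist_zero_right]; linarith [norm_add_le x (t • v)]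
    have h3 := hL.norm_sub_le h2 h1
    rw [add_sub_cancel_left, norm_smul, Real.norm_of_nonneg ht.1.le] at h3
    rw [norm_smul, norm_inv, Real.norm_of_nonneg ht.1.le, inv_mul_le_iff₀ ht.1]
    linarith
  have hbound : ∀ t ∈ Ioc (0 : ℝ) 1, ∀ x, ‖F t x‖ ≤ bound x := by
    intro t ht x
    by_cases hx : x ∈ closedBall (0 : E) (r + ‖v‖)
    · simp only [bound, indicator_of_mem hx, F, norm_mul]
      gcongr
      · exact hquot hC ht hx
      · exact hquot hD ht hx
    · have hx1 : r + ‖v‖ < ‖x‖ := by simpa using hx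
      have htv : ‖t • v‖ ≤ ‖v‖ := by
        rw [norm_smul, Real.norm_of_nonneg ht.1.le]
        exact mul_le_of_le_one_left (norm_nonneg _) ht.2
      have hz : ∀ y : E, r < ‖y‖ → ψ y = 0 := fun y hy =>
        image_eq_zero_of_notMem_tsupport fun h => by
          have := hr h
          simp only [mem_closedBall, dist_zero_right] at this
          linarith
      have h1 : ψ x = 0 := hz x (by linarith [norm_nonneg v])
      have h2 : ψ (x + t • v) = 0 := hz _ (by
        have := norm_sub_le (x + t • v) (t • v)
        rw [add_sub_cancel_right] at this
        linarith)
      simp [bound, indicator_of_notMem hx, F, h1, h2]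
  have hFcont : ∀ t, Continuous (F t) := fun t => by fun_prop
  have hlim : ∀ᵐ x ∂μ, Tendsto (fun t => F t x) (𝓝[>] 0)
      (𝓝 (lineDeriv ℝ f x v * lineDeriv ℝ ψ x v)) := by
    filter_upwards [hf', hψ'] with x h1 h2
    exact h1.hasLineDerivAt.tendsto_slope_zero_right.mul
      h2.hasLineDerivAt.tendsto_slope_zero_right
  have hint : Integrable (fun x => lineDeriv ℝ f x v * lineDeriv ℝ ψ x v) μ := by
    refine hbi.mono' (((measurable_lineDeriv hfC).mul
      (measurable_lineDeriv hψC)).aestronglyMeasurable) ?_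
    filter_upwards [hlim] with x hx
    exact le_of_tendsto hx.norm (ht1.mono fun t ht => hbound t ht x)
  refine ⟨hint, ?_⟩
  refine ge_of_tendsto (tendsto_integral_filter_of_dominated_convergence bound
    (Eventually.of_forall fun t => (hFcont t).aestronglyMeasurable)
    (ht1.mono fun t ht => Eventually.of_forall (hbound t ht)) hbi hlim) (ht1.mono ?_)
  intro t ht
  have hi {h : E → ℝ} (hh : Continuous h) : Integrable (fun x => h x * ψ x) μ :=
    (hh.mul hψC).integrable_of_hasCompactSupport hc.mul_left
  let G : E → ℝ := fun y => (f y - f (y - t • v)) * ψ y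
  have hG : Integrable G μ := hi (h := fun y => f y - f (y - t • v)) (by fun_prop)
  have hH : Integrable (fun x => (f (x + t • v) - f x) * ψ x) μ :=
    hi (h := fun x => f (x + t • v) - f x) (by fun_prop)
  have hψi : Integrable ψ μ := hψC.integrable_of_hasCompactSupport hc
  have hFt : ∀ x, F t x = (t⁻¹ * t⁻¹) * (G (x + t • v) - (f (x + t • v) - f x) * ψ x) := by
    intro x
    simp only [F, G, smul_eq_mul, add_sub_cancel_right]
    ring
  simp_rw [hFt]
  rw [integral_const_mul, integral_sub (hG.comp_add_right _) hH,
    integral_add_right_eq_self G (t • v), ← integral_sub hG hH]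
  have hle : ∫ x, (-(c * t ^ 2)) * ψ x ∂μ ≤
      ∫ x, (G x - (f (x + t • v) - f x) * ψ x) ∂μ := by
    refine integral_mono (hψi.const_mul _) (hG.sub hH) fun x => ?_
    have := mul_le_mul_of_nonneg_right (hfc x t) (hψ0 x)
    simp only [G]
    linarith
  rw [integral_const_mul] at hle
  have ht0 := ht.1
  calc -c * ∫ x, ψ x ∂μ = (t⁻¹ * t⁻¹) * (-(c * t ^ 2) * ∫ x, ψ x ∂μ) := by field_simp
    _ ≤ _ := by gcongr

/-- A weak form of `Δ f ≤ c * dim E` for a locally Lipschitz function `f` for which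
`f - c / 2 * ‖·‖ ^ 2` is midpoint concave. -/
theorem integral_inner_gradient_ge {E : Type*} [NormedAddCommGroup E] [InnerProductSpace ℝ E]
    [FiniteDimensional ℝ E] [MeasurableSpace E] [BorelSpace E] {μ : Measure E}
    [μ.IsAddHaarMeasure] {f ψ : E → ℝ} {c : ℝ}
    (hf : LocallyLipschitz f) (hψ : LocallyLipschitz ψ) (hc : HasCompactSupport ψ)
    (hψ0 : ∀ x, 0 ≤ ψ x)
    (hf' : ∀ᵐ x ∂μ, DifferentiableAt ℝ f x) (hψ' : ∀ᵐ x ∂μ, DifferentiableAt ℝ ψ x)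
    (hfc : ∀ x v, f (x + v) + f (x - v) - 2 * f x ≤ c * ‖v‖ ^ 2) :
    Integrable (fun x => ⟪gradient f x, gradient ψ x⟫) μ ∧
      -(c * Module.finrank ℝ E) * ∫ x, ψ x ∂μ ≤
        ∫ x, ⟪gradient f x, gradient ψ x⟫ ∂μ := by
  let b := stdOrthonormalBasis ℝ E
  have key i := integral_lineDeriv_mul_lineDeriv_ge (μ := μ) (v := b i) (c := c) hf hψ hc hψ0
    (hf'.mono fun x hx => hx.lineDifferentiableAt) (hψ'.mono fun x hx => hx.lineDifferentiableAt)
    (fun x t => (hfc x (t • b i)).trans_eq (by simp [norm_smul]))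
  have hsum : (fun x => ⟪gradient f x, gradient ψ x⟫) =ᵐ[μ]
      fun x => ∑ i, lineDeriv ℝ f x (b i) * lineDeriv ℝ ψ x (b i) := by
    filter_upwards [hf', hψ'] with x h1 h2
    rw [← b.sum_inner_mul_inner]
    refine Finset.sum_congr rfl fun i _ => ?_
    rw [h1.lineDeriv_eq_fderiv, h2.lineDeriv_eq_fderiv, real_inner_comm (gradient ψ x),
      ← InnerProductSpace.toDual_apply_apply, ← InnerProductSpace.toDual_apply_apply,
      toDual_gradient, toDual_gradient]
  refine ⟨(integrable_finsetSum _ fun i _ => (key i).1).congr hsum.symm, ?_⟩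
  rw [integral_congr_ae hsum, integral_finsetSum _ fun i _ => (key i).1]
  calc -(c * Module.finrank ℝ E) * ∫ x, ψ x ∂μ
      = ∑ _i : Fin (Module.finrank ℝ E), -c * ∫ x, ψ x ∂μ := by
        simp; ring
    _ ≤ _ := Finset.sum_le_sum fun i _ => (key i).2

theorem HasDerivAt.comp_hasGradientAt {E : Type*} [NormedAddCommGroup E] [InnerProductSpace ℝ E]
    [CompleteSpace E] {h : ℝ → ℝ} {h' : ℝ} {u : E → ℝ} {u' x : E}
    (hh : HasDerivAt h h' (u x)) (hu : HasGradientAt u u' x) :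
    HasGradientAt (fun y => h (u y)) (h' • u') x := by
  rw [hasGradientAt_iff_hasFDerivAt] at hu ⊢
  rw [map_smulₛₗ]
  exact hh.comp_hasFDerivAt x hu

theorem HasGradientAt.fun_mul {E : Type*} [NormedAddCommGroup E] [InnerProductSpace ℝ E]
    [CompleteSpace E] {u w : E → ℝ} {u' w' x : E}
    (hu : HasGradientAt u u' x) (hw : HasGradientAt w w' x) :
    HasGradientAt (fun y => u y * w y) (u x • w' + w x • u') x := by
  rw [hasGradientAt_iff_hasFDerivAt] at hu hw ⊢
  rw [map_add, map_smulₛₗ, map_smulₛₗ]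
  exact hu.mul hw

theorem norm_gradient_infDist {E : Type*} [NormedAddCommGroup E] [InnerProductSpace ℝ E]
    [FiniteDimensional ℝ E] {F : Set E} (hF : IsClosed F) (hne : F.Nonempty) {x : E}
    (hx : x ∉ F) (hd : DifferentiableAt ℝ (fun y => infDist y F) x) :
    ‖gradient (fun y => infDist y F) x‖ = 1 := by
  have hpos : 0 < infDist x F := (hF.notMem_iff_infDist_pos hne).1 hx
  obtain ⟨y, hy, hxy⟩ := hF.exists_infDist_eq_dist hne x
  rw [← LinearIsometryEquiv.norm_map (InnerProductSpace.toDual ℝ E), toDual_gradient]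
  refine le_antisymm (by
    simpa using norm_fderiv_le_of_lipschitz ℝ (lipschitz_infDist_pt F) (x₀ := x)) ?_
  have h1 : HasDerivAt (fun t : ℝ => infDist (x + t • (y - x)) F)
      (fderiv ℝ (fun y => infDist y F) x (y - x)) 0 := hd.hasFDerivAt.hasLineDerivAt (y - x)
  have h2 : HasDerivAt (fun t : ℝ => (1 - t) * infDist x F) (-1 * infDist x F) 0 :=
    ((hasDerivAt_id (0 : ℝ)).const_sub 1).mul_const _
  have hmin : IsLocalMin
      (fun t : ℝ => (1 - t) * infDist x F - infDist (x + t • (y - x)) F) 0 := by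
    filter_upwards [Iio_mem_nhds one_pos] with t ht
    have : infDist (x + t • (y - x)) F ≤ (1 - t) * infDist x F := by
      refine (infDist_le_dist_of_mem hy).trans_eq ?_
      rw [hxy, dist_eq_norm, dist_eq_norm,
        show x + t • (y - x) - y = (1 - t) • (x - y) by module, norm_smul,
        Real.norm_of_nonneg (sub_nonneg.2 (le_of_lt ht))]
    simpa using this
  have h3 := hmin.hasDerivAt_eq_zero (h2.sub h1)
  have h4 := (fderiv ℝ (fun y => infDist y F) x).le_opNorm (y - x)
  rw [show fderiv ℝ (fun y => infDist y F) x (y - x) = -infDist x F by linarith, norm_neg,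
    Real.norm_of_nonneg hpos.le, ← dist_eq_norm, dist_comm, ← hxy] at h4
  exact (le_mul_iff_one_le_left hpos).1 h4

theorem sq_infDist_add_sub_le {E : Type*} [NormedAddCommGroup E] [InnerProductSpace ℝ E]
    [FiniteDimensional ℝ E] {F : Set E} (hF : IsClosed F) (hne : F.Nonempty) (x v : E) :
    infDist (x + v) F ^ 2 / 2 + infDist (x - v) F ^ 2 / 2 - 2 * (infDist x F ^ 2 / 2)
      ≤ 1 * ‖v‖ ^ 2 := by
  obtain ⟨y, hy, hxy⟩ := hF.exists_infDist_eq_dist hne x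
  have h1 : infDist (x + v) F ^ 2 ≤ dist (x + v) y ^ 2 :=
    pow_le_pow_left₀ infDist_nonneg (infDist_le_dist_of_mem hy) 2
  have h2 : infDist (x - v) F ^ 2 ≤ dist (x - v) y ^ 2 :=
    pow_le_pow_left₀ infDist_nonneg (infDist_le_dist_of_mem hy) 2
  have h3 := parallelogram_law_with_norm ℝ (x - y) v
  rw [dist_eq_norm, show x + v - y = x - y + v by abel] at h1
  rw [dist_eq_norm, show x - v - y = x - y - v by abel] at h2
  rw [hxy, dist_eq_norm]
  linarith

theorem locallyLipschitz_max_rpow {ε : ℝ} (hε : 0 < ε) (q : ℝ) :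
    LocallyLipschitz fun s : ℝ => max s ε ^ q := by
  intro s
  have hs : max s ε ≠ 0 := (hε.trans_le (le_max_right _ _)).ne'
  obtain ⟨K, t, ht, hK⟩ :=
    (Real.contDiffAt_rpow_const_of_ne (n := 1) (p := q) hs).exists_lipschitzOnWith
  have hmax : LipschitzWith 1 fun s : ℝ => max s ε := LipschitzWith.id.max_const ε
  exact ⟨K * 1, _, hmax.continuous.continuousAt ht,
    hK.comp hmax.lipschitzOnWith fun _ h => h⟩

open Topology in
/-- The distributional inequality `-div (d ^ β ∇ d) ≥ -(β + dim E - 1) d ^ (β - 1)` off the closed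
set `F`, where `d` is the distance to `F`. -/
theorem integral_rpow_infDist_mul_inner_gradient_ge {E : Type*} [NormedAddCommGroup E]
    [InnerProductSpace ℝ E] [FiniteDimensional ℝ E] [MeasurableSpace E] [BorelSpace E]
    {μ : Measure E} [μ.IsAddHaarMeasure] {F : Set E} (hF : IsClosed F) (hne : F.Nonempty)
    {φ : E → ℝ} (hφ : ContDiff ℝ 1 φ) (hc : HasCompactSupport φ) (hφF : Disjoint (tsupport φ) F)
    (hφ0 : ∀ x, 0 ≤ φ x) (β : ℝ) :
    -(β + Module.finrank ℝ E - 1) * ∫ x, infDist x F ^ (β - 1) * φ x ∂μ ≤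
      ∫ x, infDist x F ^ β * ⟪gradient (fun y => infDist y F) x, gradient φ x⟫ ∂μ := by
  set d : E → ℝ := fun y => infDist y F with hd
  have hdL : LipschitzWith 1 d := lipschitz_infDist_pt F
  have hdd : ∀ᵐ x ∂μ, DifferentiableAt ℝ d x := hdL.ae_differentiableAt
  have hpos : ∀ x ∉ F, 0 < d x := fun x hx => (hF.notMem_iff_infDist_pos hne).1 hx
  let f : E → ℝ := fun x => d x ^ 2 / 2
  let ψ : E → ℝ := fun x => d x ^ (β - 1) * φ x
  obtain ⟨ε, hε, hεd⟩ := hc.isCompact.exists_forall_le' hdL.continuous.continuousOn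
    fun x hx => hpos x (hφF.notMem_of_mem_left hx)
  have hf : LocallyLipschitz f :=
    (ContDiff.locallyLipschitz (𝕂 := ℝ) (f := fun s : ℝ => s ^ 2 / 2) (by fun_prop)).comp
      hdL.locallyLipschitz
  have hψ : LocallyLipschitz ψ := by
    have h1 : LocallyLipschitz fun x => (max (d x) ε ^ (β - 1), φ x) :=
      ((locallyLipschitz_max_rpow hε (β - 1)).comp hdL.locallyLipschitz).prodMk
        hφ.locallyLipschitz
    have h2 := (ContDiff.locallyLipschitz (𝕂 := ℝ) (f := fun z : ℝ × ℝ => z.1 * z.2)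
      (by fun_prop)).comp h1
    convert h2 using 1
    ext x
    by_cases hx : x ∈ tsupport φ
    · simp [ψ, max_eq_left (hεd x hx)]
    · simp [ψ, image_eq_zero_of_notMem_tsupport hx]
  have hψc : HasCompactSupport ψ := hc.mul_left
  have hψ0 : ∀ x, 0 ≤ ψ x := fun x => mul_nonneg (Real.rpow_nonneg infDist_nonneg _) (hφ0 x)
  have hgf {x} (hx : DifferentiableAt ℝ d x) : HasGradientAt f (d x • gradient d x) x := by
    refine HasDerivAt.comp_hasGradientAt (h := fun s : ℝ => s ^ 2 / 2) ?_ hx.hasGradientAt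
    simpa using (hasDerivAt_pow 2 (d x)).div_const 2
  have hgψ {x} (hx : DifferentiableAt ℝ d x) (hxF : x ∉ F) : HasGradientAt ψ
      (d x ^ (β - 1) • gradient φ x + φ x • ((β - 1) * d x ^ (β - 1 - 1)) • gradient d x) x :=
    (HasDerivAt.comp_hasGradientAt (Real.hasDerivAt_rpow_const (Or.inl (hpos x hxF).ne'))
      hx.hasGradientAt).fun_mul ((hφ.differentiable one_ne_zero x).hasGradientAt)
  have hz {x} (hx : x ∉ tsupport φ) : φ =ᶠ[𝓝 x] fun _ => 0 :=
    notMem_tsupport_iff_eventuallyEq.1 hx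
  have hψz {x} (hx : x ∉ tsupport φ) : ψ =ᶠ[𝓝 x] fun _ => 0 :=
    (hz hx).mono fun y hy => by simp [ψ, hy]
  have hψd : ∀ᵐ x ∂μ, DifferentiableAt ℝ ψ x := by
    filter_upwards [hdd] with x hx
    by_cases hxφ : x ∈ tsupport φ
    · exact (hgψ hx (hφF.notMem_of_mem_left hxφ)).differentiableAt
    · exact (differentiableAt_const 0).congr_of_eventuallyEq (hψz hxφ)
  obtain ⟨hint, hle⟩ := integral_inner_gradient_ge (μ := μ) (c := 1) hf hψ hψc hψ0
    (hdd.mono fun x hx => (hgf hx).differentiableAt) hψd (sq_infDist_add_sub_le hF hne)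
  have hψi : Integrable ψ μ := hψ.continuous.integrable_of_hasCompactSupport hψc
  have hae : (fun x => d x ^ β * ⟪gradient d x, gradient φ x⟫) =ᵐ[μ]
      fun x => ⟪gradient f x, gradient ψ x⟫ - (β - 1) * ψ x := by
    filter_upwards [hdd] with x hx
    by_cases hxφ : x ∈ tsupport φ
    · have hxF := hφF.notMem_of_mem_left hxφ
      have h0 := hpos x hxF
      have h1 : ⟪gradient d x, gradient d x⟫ = 1 := by
        rw [real_inner_self_eq_norm_sq, norm_gradient_infDist hF hne hxF hx, one_pow]
      have e1 : d x ^ β = d x * d x ^ (β - 1) := by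
        rw [Real.rpow_sub_one h0.ne']; field_simp
      have e2 : d x ^ (β - 1) = d x * d x ^ (β - 1 - 1) := by
        rw [Real.rpow_sub_one h0.ne' (β - 1)]; field_simp
      rw [(hgf hx).gradient, (hgψ hx hxF).gradient]
      simp only [inner_smul_left, inner_add_right, inner_smul_right, h1, ψ]
      rw [e1]
      simp only [conj_trivial]
      linear_combination ((β - 1) * φ x) * e2
    · have hg : gradient φ x = 0 := by
        rw [gradient, (hz hxφ).fderiv_eq]; simp
      have hg' : gradient ψ x = 0 := by
        rw [gradient, (hψz hxφ).fderiv_eq]; simp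
      simp [hg, hg', (hψz hxφ).self_of_nhds]
  rw [integral_congr_ae hae, integral_sub hint (hψi.const_mul _), integral_const_mul]
  linarith

theorem stmt_12 (n : ℕ) (p α γ : ℝ) (hp1 : 1 < p)
    (hγ0 : 0 < γ) (hγ : γ < (α + p - n) / (p - 1))
    (Ω : Set (EuclideanSpace ℝ (Fin n)))
    (hΩopen : IsOpen Ω) (hΩconn : IsConnected Ω) (hΩne : Ω.Nonempty)
    (hΩproper : Ω ≠ Set.univ) :
    let d : EuclideanSpace ℝ (Fin n) → ℝ := fun x => infDist x (frontier Ω)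
    let g : EuclideanSpace ℝ (Fin n) → EuclideanSpace ℝ (Fin n) :=
      gradient (fun x => d x ^ γ)
    ∀ φ : EuclideanSpace ℝ (Fin n) → ℝ, ContDiff ℝ (⊤ : ℕ∞) φ →
      HasCompactSupport φ → tsupport φ ⊆ Ω → (∀ x, 0 ≤ φ x) →
      ∫ x in Ω, d x ^ (-α) * ‖g x‖ ^ (p - 2) * ⟪g x, gradient φ x⟫ ≥
        γ ^ (p - 1) * (α - n + 1 - (γ - 1) * (p - 1)) *
          ∫ x in Ω, d x ^ (γ * (p - 1) - α - p) * φ x := by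
  intro d g φ hφ hc hφΩ hφ0
  have hF : IsClosed (frontier Ω) := isClosed_frontier
  have hne : (frontier Ω).Nonempty := nonempty_frontier_iff.2 ⟨hΩne, hΩproper⟩
  have hΩF : Disjoint Ω (frontier Ω) :=
    disjoint_iff_inter_eq_empty.2 hΩopen.inter_frontier_eq
  set β : ℝ := (γ - 1) * (p - 1) - α with hβ
  have hφz : ∀ x ∉ Ω, φ x = 0 := fun x hx =>
    image_eq_zero_of_notMem_tsupport fun h => hx (hφΩ h)
  have hgz : ∀ x ∉ Ω, gradient φ x = 0 := fun x hx => by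
    have := notMem_tsupport_iff_eventuallyEq.1 fun h => hx (hφΩ h)
    rw [gradient, this.fderiv_eq]; simp
  have key := integral_rpow_infDist_mul_inner_gradient_ge (μ := volume) hF hne
    (hφ.of_le (mod_cast le_top)) hc (hΩF.mono_left hφΩ) hφ0 β
  rw [finrank_euclideanSpace_fin] at key
  have hlhs : ∫ x in Ω, d x ^ (-α) * ‖g x‖ ^ (p - 2) * ⟪g x, gradient φ x⟫ =
      γ ^ (p - 1) * ∫ x, d x ^ β * ⟪gradient d x, gradient φ x⟫ := by
    rw [setIntegral_eq_integral_of_forall_compl_eq_zero fun x hx => by simp [hgz x hx],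
      ← integral_const_mul]
    refine integral_congr_ae ?_
    filter_upwards [(lipschitz_infDist_pt (frontier Ω)).ae_differentiableAt (μ := volume)]
      with x hx
    by_cases hxΩ : x ∈ Ω
    · have hxF := hΩF.notMem_of_mem_left hxΩ
      have h0 : 0 < d x := (hF.notMem_iff_infDist_pos hne).1 hxF
      have hg : g x = (γ * d x ^ (γ - 1)) • gradient d x :=
        (HasDerivAt.comp_hasGradientAt (u := d) (Real.hasDerivAt_rpow_const (Or.inl h0.ne'))
          hx.hasGradientAt).gradient
      have hk : 0 < γ * d x ^ (γ - 1) := by positivity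
      have hn : ‖g x‖ = γ * d x ^ (γ - 1) := by
        rw [hg, norm_smul, norm_gradient_infDist hF hne hxF hx, mul_one,
          Real.norm_of_nonneg hk.le]
      have e1 : (γ * d x ^ (γ - 1)) ^ (p - 2) * (γ * d x ^ (γ - 1)) =
          γ ^ (p - 1) * d x ^ ((γ - 1) * (p - 1)) := by
        rw [← Real.rpow_add_one hk.ne', show p - 2 + 1 = p - 1 by ring,
          Real.mul_rpow hγ0.le (by positivity), ← Real.rpow_mul h0.le]
      have e2 : d x ^ β = d x ^ (-α) * d x ^ ((γ - 1) * (p - 1)) := by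
        rw [← Real.rpow_add h0]; congr 1; ring
      simp only [hn]
      rw [hg, inner_smul_left, e2, conj_trivial]
      linear_combination (d x ^ (-α) * ⟪gradient d x, gradient φ x⟫) * e1
    · simp [hgz x hxΩ]
  have hrhs : ∫ x in Ω, d x ^ (γ * (p - 1) - α - p) * φ x =
      ∫ x, d x ^ (β - 1) * φ x := by
    rw [setIntegral_eq_integral_of_forall_compl_eq_zero fun x hx => by simp [hφz x hx],
      show γ * (p - 1) - α - p = β - 1 by rw [hβ]; ring]
  rw [hlhs, hrhs, ge_iff_le, mul_assoc]
  refine mul_le_mul_of_nonneg_left ?_ (Real.rpow_nonneg hγ0.le _)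
  rwa [show α - n + 1 - (γ - 1) * (p - 1) = -(β + n - 1) by rw [hβ]; ring]
end

section
/- Let n ≥ 2 and p > n. Then for every domain Ω ⊊ ℝⁿ and every φ ∈ C_c^∞(Ω), ∫_Ω |∇φ|^p dx ≥ ((p−n)/p)^p ∫_Ω |φ|^p d_Ω^{−p} dx; in particular the L^p-Hardy constant of any domain satisfies H_p(Ω) ≥ ((p−n)/p)^p. -/
open MeasureTheory Metric Set

open scoped ENNReal

theorem infDist_frontier_pos {X : Type*} [PseudoMetricSpace X] {Ω : Set X} (hΩ : IsOpen Ω)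
    (hF : (frontier Ω).Nonempty) {x : X} (hx : x ∈ Ω) : 0 < infDist x (frontier Ω) :=
  (isClosed_frontier.notMem_iff_infDist_pos hF).1 fun h => (hΩ.frontier_eq ▸ h).2 hx

section Hardy

variable {E : Type*} [NormedAddCommGroup E] [NormedSpace ℝ E]

/-- A function vanishing at `a` is controlled by the mean of its derivative along segments from
`a`. -/
theorem enorm_div_edist_le_lintegral_fderiv {φ : E → ℝ} (hφ : ContDiff ℝ 1 φ) {a : E}
    (ha : φ a = 0) (x : E) :
    ‖φ x‖ₑ / edist x a ≤ ∫⁻ t in Ioc (0 : ℝ) 1, ‖fderiv ℝ φ (a + t • (x - a))‖ₑ := by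
  have hseg (t : ℝ) : HasDerivAt (fun t : ℝ => φ (a + t • (x - a)))
      (fderiv ℝ φ (a + t • (x - a)) (x - a)) t := by
    have h : HasDerivAt (fun t : ℝ => a + t • (x - a)) (x - a) t := by
      simpa using ((hasDerivAt_id t).smul_const (x - a)).const_add a
    exact ((hφ.differentiable one_ne_zero _).hasFDerivAt).comp_hasDerivAt t h
  have hcont : Continuous fun t : ℝ => fderiv ℝ φ (a + t • (x - a)) (x - a) :=
    ((hφ.continuous_fderiv one_ne_zero).comp (by fun_prop)).clm_apply continuous_const
  have hftc : φ x = ∫ t in Ioc (0 : ℝ) 1, fderiv ℝ φ (a + t • (x - a)) (x - a) := by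
    rw [← intervalIntegral.integral_of_le zero_le_one,
      intervalIntegral.integral_eq_sub_of_hasDerivAt (fun t _ => hseg t)
        (hcont.intervalIntegrable _ _)]
    simp [ha]
  refine ENNReal.div_le_of_le_mul ?_
  calc ‖φ x‖ₑ ≤ ∫⁻ t in Ioc (0 : ℝ) 1, ‖fderiv ℝ φ (a + t • (x - a)) (x - a)‖ₑ := by
        rw [hftc]
        exact enorm_integral_le_lintegral_enorm _
    _ ≤ ∫⁻ t in Ioc (0 : ℝ) 1, ‖fderiv ℝ φ (a + t • (x - a))‖ₑ * edist x a := by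
        rw [edist_eq_enorm_sub]
        gcongr with t
        exact ContinuousLinearMap.le_opENorm _ _
    _ = _ := lintegral_mul_const' _ _ (edist_ne_top _ _)

theorem lintegral_Ioc_rpow_neg {s : ℝ} (hs : s < 1) :
    ∫⁻ t in Ioc (0 : ℝ) 1, ENNReal.ofReal (t ^ (-s)) = ENNReal.ofReal (1 / (1 - s)) := by
  rw [← ofReal_integral_eq_lintegral_ofReal]
  · rw [← intervalIntegral.integral_of_le zero_le_one, integral_rpow (by left; linarith),
      Real.one_rpow, Real.zero_rpow (by linarith), sub_zero, neg_add_eq_sub]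
  · exact (intervalIntegrable_iff_integrableOn_Ioc_of_le zero_le_one).1
      (intervalIntegral.intervalIntegrable_rpow' (by linarith))
  · filter_upwards [ae_restrict_mem measurableSet_Ioc] with t ht using Real.rpow_nonneg ht.1.le _

/-- Hölder's inequality on `(0, 1]` with respect to the weight `t ^ (-s)`. -/
theorem lintegral_Ioc_rpow_le {s p : ℝ} (hs : s < 1) (hp : 1 < p) {g : ℝ → ℝ≥0∞}
    (hg : Measurable g) :
    (∫⁻ t in Ioc (0 : ℝ) 1, g t) ^ p ≤ ENNReal.ofReal (1 / (1 - s)) ^ (p - 1) *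
      ∫⁻ t in Ioc (0 : ℝ) 1, ENNReal.ofReal (t ^ (s * (p - 1))) * g t ^ p := by
  have hp0 : 0 < p := by linarith
  have hp1 : 0 < p - 1 := by linarith
  have hpq := (Real.HolderConjugate.conjExponent hp).symm
  have hq : Real.conjExponent p = p / (p - 1) := rfl
  set q := Real.conjExponent p
  have hq0 : 0 < q := by rw [hq]; positivity
  have hsplit : ∫⁻ t in Ioc (0 : ℝ) 1, g t = ∫⁻ t in Ioc (0 : ℝ) 1,
      ((fun t => ENNReal.ofReal (t ^ (-s / q))) *
        fun t => ENNReal.ofReal (t ^ (s / q)) * g t) t := by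
    refine setLIntegral_congr_fun measurableSet_Ioc fun t ht => ?_
    simp only [Pi.mul_apply]
    rw [← mul_assoc, ← ENNReal.ofReal_mul (Real.rpow_nonneg ht.1.le _), ← Real.rpow_add ht.1]
    simp [neg_div]
  have holder := ENNReal.lintegral_mul_le_Lp_mul_Lq (volume.restrict (Ioc (0 : ℝ) 1)) hpq
    (f := fun t => ENNReal.ofReal (t ^ (-s / q))) (g := fun t => ENNReal.ofReal (t ^ (s / q)) * g t)
    (by fun_prop) (by fun_prop)
  have h1 : ∫⁻ t in Ioc (0 : ℝ) 1, ENNReal.ofReal (t ^ (-s / q)) ^ q =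
      ENNReal.ofReal (1 / (1 - s)) := by
    rw [← lintegral_Ioc_rpow_neg hs]
    refine setLIntegral_congr_fun measurableSet_Ioc fun t ht => ?_
    rw [ENNReal.ofReal_rpow_of_nonneg (Real.rpow_nonneg ht.1.le _) hq0.le, ← Real.rpow_mul ht.1.le,
      div_mul_cancel₀ _ hq0.ne']
  have h2 : ∫⁻ t in Ioc (0 : ℝ) 1, (ENNReal.ofReal (t ^ (s / q)) * g t) ^ p =
      ∫⁻ t in Ioc (0 : ℝ) 1, ENNReal.ofReal (t ^ (s * (p - 1))) * g t ^ p := by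
    refine setLIntegral_congr_fun measurableSet_Ioc fun t ht => ?_
    rw [ENNReal.mul_rpow_of_nonneg _ _ hp0.le,
      ENNReal.ofReal_rpow_of_nonneg (Real.rpow_nonneg ht.1.le _) hp0.le, ← Real.rpow_mul ht.1.le]
    congr 3
    rw [hq]; field_simp
  rw [hsplit]
  refine (ENNReal.rpow_le_rpow holder hp0.le).trans_eq ?_
  rw [ENNReal.mul_rpow_of_nonneg _ _ hp0.le, h1, h2, ← ENNReal.rpow_mul, ← ENNReal.rpow_mul,
    one_div_mul_cancel hp0.ne', ENNReal.rpow_one]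
  congr 2
  rw [hq]; field_simp

variable [FiniteDimensional ℝ E] [MeasurableSpace E] [BorelSpace E] {μ : Measure E}
  [μ.IsAddHaarMeasure]

/-- Contracting a set which is star-shaped about `a` towards `a` increases integrals over the set at
most by the Jacobian factor. -/
theorem setLIntegral_comp_contraction_le {V : Set E} (hV : MeasurableSet V) {a : E} {t : ℝ}
    (ht : 0 < t) (hstar : ∀ x ∈ V, a + t • (x - a) ∈ V) {f : E → ℝ≥0∞} (hf : Measurable f) :
    ∫⁻ x in V, f (a + t • (x - a)) ∂μ ≤
      ENNReal.ofReal (t ^ (-(Module.finrank ℝ E : ℝ))) * ∫⁻ x in V, f x ∂μ := by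
  have hFm : Measurable (V.indicator f) := hf.indicator hV
  calc ∫⁻ x in V, f (a + t • (x - a)) ∂μ
      = ∫⁻ x in V, V.indicator f (a + t • (x - a)) ∂μ :=
        setLIntegral_congr_fun hV fun x hx => (indicator_of_mem (hstar x hx) f).symm
    _ ≤ ∫⁻ x, V.indicator f (a + t • (x - a)) ∂μ := setLIntegral_le_lintegral _ _
    _ = ∫⁻ x, V.indicator f (a + t • x) ∂μ :=
        lintegral_sub_right_eq_self (fun x => V.indicator f (a + t • x)) a
    _ = ∫⁻ y, V.indicator f (a + y) ∂(μ.map (t • ·)) :=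
        (lintegral_map (hFm.comp (measurable_const_add a)) (measurable_const_smul t)).symm
    _ = ENNReal.ofReal (t ^ (-(Module.finrank ℝ E : ℝ))) * ∫⁻ y, V.indicator f (a + y) ∂μ := by
        rw [Measure.map_addHaar_smul μ ht.ne', lintegral_smul_measure, Real.rpow_neg ht.le,
          Real.rpow_natCast, abs_of_pos (by positivity), smul_eq_mul]
    _ = _ := by
        rw [lintegral_add_left_eq_self (fun y => V.indicator f y) a, lintegral_indicator hV]

/-- Hardy's inequality for the distance to the centre of a star-shaped set. -/
theorem hardy_of_starShaped {p : ℝ} (hp1 : 1 < p) (hp : (Module.finrank ℝ E : ℝ) < p)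
    {φ : E → ℝ} (hφ : ContDiff ℝ 1 φ) {a : E} (ha : φ a = 0) {V : Set E} (hV : MeasurableSet V)
    (hstar : ∀ x ∈ V, ∀ t ∈ Ioc (0 : ℝ) 1, a + t • (x - a) ∈ V) :
    ∫⁻ x in V, (‖φ x‖ₑ / edist x a) ^ p ∂μ ≤
      ENNReal.ofReal (p / (p - Module.finrank ℝ E)) ^ p *
        ∫⁻ x in V, ‖fderiv ℝ φ x‖ₑ ^ p ∂μ := by
  have hp0 : 0 < p := by linarith
  set n : ℝ := (Module.finrank ℝ E : ℝ)
  have hs : n / p < 1 := (div_lt_one hp0).2 hp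
  have hC : 1 / (1 - n / p) = p / (p - n) := by
    have : p - n ≠ 0 := by linarith
    field_simp
  have hG : Continuous fun x => ‖fderiv ℝ φ x‖ₑ := (hφ.continuous_fderiv one_ne_zero).enorm
  have hGp : Measurable fun x => ‖fderiv ℝ φ x‖ₑ ^ p := hG.measurable.pow_const p
  have hjoint : Measurable fun z : E × ℝ =>
      ENNReal.ofReal (z.2 ^ (n / p * (p - 1))) * ‖fderiv ℝ φ (a + z.2 • (z.1 - a))‖ₑ ^ p := by
    refine Measurable.mul (by fun_prop) (hGp.comp ?_)
    exact Continuous.measurable (by fun_prop)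
  calc ∫⁻ x in V, (‖φ x‖ₑ / edist x a) ^ p ∂μ
      ≤ ∫⁻ x in V, ENNReal.ofReal (p / (p - n)) ^ (p - 1) * (∫⁻ t in Ioc (0 : ℝ) 1,
          ENNReal.ofReal (t ^ (n / p * (p - 1))) * ‖fderiv ℝ φ (a + t • (x - a))‖ₑ ^ p) ∂μ := by
        refine lintegral_mono fun x => ?_
        refine (ENNReal.rpow_le_rpow (enorm_div_edist_le_lintegral_fderiv hφ ha x) hp0.le).trans ?_
        rw [← hC]
        exact lintegral_Ioc_rpow_le hs hp1
          (hG.comp (by fun_prop : Continuous fun t : ℝ => a + t • (x - a))).measurable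
    _ = ENNReal.ofReal (p / (p - n)) ^ (p - 1) * ∫⁻ t in Ioc (0 : ℝ) 1, ∫⁻ x in V,
          ENNReal.ofReal (t ^ (n / p * (p - 1))) * ‖fderiv ℝ φ (a + t • (x - a))‖ₑ ^ p ∂μ := by
        rw [lintegral_const_mul _ hjoint.lintegral_prod_right', lintegral_lintegral_swap
          hjoint.aemeasurable]
    _ ≤ ENNReal.ofReal (p / (p - n)) ^ (p - 1) * ∫⁻ t in Ioc (0 : ℝ) 1,
          ENNReal.ofReal (t ^ (-(n / p))) * ∫⁻ x in V, ‖fderiv ℝ φ x‖ₑ ^ p ∂μ := by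
        refine mul_le_mul_right (setLIntegral_mono' measurableSet_Ioc fun t ht => ?_) _
        rw [lintegral_const_mul' _ _ ENNReal.ofReal_ne_top]
        refine (mul_le_mul_right (setLIntegral_comp_contraction_le hV ht.1
          (fun x hx => hstar x hx t ht) hGp) _).trans_eq ?_
        rw [← mul_assoc, ← ENNReal.ofReal_mul (Real.rpow_nonneg ht.1.le _), ← Real.rpow_add ht.1]
        congr 3
        field_simp
        ring
    _ = _ := by
        rw [lintegral_mul_const _ (by fun_prop), lintegral_Ioc_rpow_neg hs, hC, ← mul_assoc]
        congr 1
        nth_rw 2 [← ENNReal.rpow_one (ENNReal.ofReal _)]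
        have : ENNReal.ofReal (p / (p - n)) ≠ 0 := by
          simpa using div_pos hp0 (sub_pos.2 hp)
        rw [← ENNReal.rpow_add _ _ this ENNReal.ofReal_ne_top, sub_add_cancel]

end Hardy

section Voronoi

variable {X : Type*} [PseudoMetricSpace X]

/-- The Voronoi cell of `a i` among `a 0, …, a N`, ties being given to the least index. -/
def voronoiCell (a : ℕ → X) (N i : ℕ) : Set X :=
  {x | ∀ j ≤ N, dist x (a i) ≤ dist x (a j) ∧ (j < i → dist x (a i) < dist x (a j))}

theorem measurableSet_voronoiCell [MeasurableSpace X] [OpensMeasurableSpace X] (a : ℕ → X)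
    (N i : ℕ) : MeasurableSet (voronoiCell a N i) := by
  have : voronoiCell a N i = ⋂ j, ⋂ _ : j ≤ N, ({x | dist x (a i) ≤ dist x (a j)} ∩
      {x | j < i → dist x (a i) < dist x (a j)}) := by
    ext; simp [voronoiCell]
  rw [this]
  refine .iInter fun j => .iInter fun _ => (isClosed_le (by fun_prop)
    (by fun_prop)).measurableSet.inter ?_
  by_cases h : j < i
  · simpa [h] using (isOpen_lt (continuous_id.dist continuous_const)
      (continuous_id.dist continuous_const)).measurableSet
  · simp [h]

theorem pairwiseDisjoint_voronoiCell (a : ℕ → X) (N : ℕ) :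
    (↑(Finset.range (N + 1)) : Set ℕ).PairwiseDisjoint (voronoiCell a N) := by
  intro i hi j hj hij
  simp only [Finset.coe_range, mem_Iio, Nat.lt_succ_iff] at hi hj
  refine Set.disjoint_left.2 fun x hxi hxj => ?_
  rcases hij.lt_or_gt with h | h
  · exact ((hxj i hi).2 h).not_ge (hxi j hj).1
  · exact ((hxi j hj).2 h).not_ge (hxj i hi).1

theorem exists_mem_voronoiCell (a : ℕ → X) (N : ℕ) (x : X) : ∃ i ≤ N, x ∈ voronoiCell a N i := by
  classical
  have hex : ∃ i, i ≤ N ∧ ∀ j ≤ N, dist x (a i) ≤ dist x (a j) := by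
    obtain ⟨i, hi, hmin⟩ := (Finset.range (N + 1)).exists_min_image (fun i => dist x (a i)) (by simp)
    exact ⟨i, by simpa [Nat.lt_succ_iff] using hi, fun j hj => hmin j (by simpa [Nat.lt_succ_iff])⟩
  obtain ⟨hi, hmin⟩ := Nat.find_spec hex
  refine ⟨Nat.find hex, hi, fun j hj => ⟨hmin j hj, fun hji => ?_⟩⟩
  by_contra! hle
  exact Nat.find_min hex hji ⟨hj, fun k hk => hle.trans (hmin k hk)⟩

end Voronoi

section Hardy

variable {E : Type*} [NormedAddCommGroup E] [NormedSpace ℝ E]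

theorem starShaped_voronoiCell (a : ℕ → E) (N i : ℕ) {x : E} (hx : x ∈ voronoiCell a N i) {t : ℝ}
    (ht : t ∈ Ioc (0 : ℝ) 1) : a i + t • (x - a i) ∈ voronoiCell a N i := by
  set y := a i + t • (x - a i) with hy
  have h1 : dist y (a i) = t * dist x (a i) := by
    rw [dist_eq_norm, dist_eq_norm, hy, add_sub_cancel_left, norm_smul, Real.norm_of_nonneg ht.1.le]
  have h2 : dist x y = (1 - t) * dist x (a i) := by
    rw [dist_eq_norm, dist_eq_norm, show x - y = (1 - t) • (x - a i) by rw [hy]; module,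
      norm_smul, Real.norm_of_nonneg (by linarith [ht.2])]
  intro j hj
  have h3 := dist_triangle x y (a j)
  exact ⟨by linarith [(hx j hj).1], fun hji => by linarith [(hx j hj).2 hji]⟩

variable [MeasurableSpace E] [BorelSpace E] {μ : Measure E} [μ.IsAddHaarMeasure]

theorem integrable_norm_fderiv_rpow {p : ℝ} (hp0 : 0 < p) {φ : E → ℝ} (hφ : ContDiff ℝ 1 φ)
    (hcs : HasCompactSupport φ) : Integrable (fun x => ‖fderiv ℝ φ x‖ ^ p) μ := by
  refine Continuous.integrable_of_hasCompactSupport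
    ((hφ.continuous_fderiv one_ne_zero).norm.rpow_const fun _ => .inr hp0.le) ?_
  exact (hcs.fderiv ℝ).comp_left (g := fun L : E →L[ℝ] ℝ => ‖L‖ ^ p) (by simp [hp0.ne'])

variable [FiniteDimensional ℝ E]

/-- Hardy's inequality for the distance to a finite set. -/
theorem hardy_finite {p : ℝ} (hp1 : 1 < p) (hp : (Module.finrank ℝ E : ℝ) < p)
    {φ : E → ℝ} (hφ : ContDiff ℝ 1 φ) {a : ℕ → E} (ha : ∀ i, φ (a i) = 0) (N : ℕ) :
    ∫⁻ x, ⨆ i ≤ N, (‖φ x‖ₑ / edist x (a i)) ^ p ∂μ ≤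
      ENNReal.ofReal (p / (p - Module.finrank ℝ E)) ^ p * ∫⁻ x, ‖fderiv ℝ φ x‖ₑ ^ p ∂μ := by
  have hp0 : 0 ≤ p := by linarith
  have hcover : ⋃ i ∈ Finset.range (N + 1), voronoiCell a N i = univ := by
    refine eq_univ_of_forall fun x => ?_
    obtain ⟨i, hi, hx⟩ := exists_mem_voronoiCell a N x
    exact mem_biUnion (by simpa [Nat.lt_succ_iff] using hi) hx
  have hsum (f : E → ℝ≥0∞) : ∫⁻ x, f x ∂μ =
      ∑ i ∈ Finset.range (N + 1), ∫⁻ x in voronoiCell a N i, f x ∂μ := by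
    rw [← lintegral_biUnion_finset (pairwiseDisjoint_voronoiCell a N)
      (fun i _ => measurableSet_voronoiCell a N i), hcover, Measure.restrict_univ]
  rw [hsum, hsum, Finset.mul_sum]
  refine Finset.sum_le_sum fun i _ => ?_
  refine le_trans (setLIntegral_mono' (measurableSet_voronoiCell a N i) fun x hx => ?_)
    (hardy_of_starShaped hp1 hp hφ (ha i) (measurableSet_voronoiCell a N i)
      fun x hx t ht => starShaped_voronoiCell a N i hx ht)
  refine iSup₂_le fun j hj => ?_
  gcongr
  rw [edist_dist, edist_dist]
  exact ENNReal.ofReal_le_ofReal (hx j hj).1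

/-- Hardy's inequality for the distance to an arbitrary nonempty set. -/
theorem hardy_infEDist {p : ℝ} (hp1 : 1 < p) (hp : (Module.finrank ℝ E : ℝ) < p)
    {φ : E → ℝ} (hφ : ContDiff ℝ 1 φ) {F : Set E} (hF : F.Nonempty) (hφF : ∀ x ∈ F, φ x = 0) :
    ∫⁻ x, (‖φ x‖ₑ / infEDist x F) ^ p ∂μ ≤
      ENNReal.ofReal (p / (p - Module.finrank ℝ E)) ^ p * ∫⁻ x, ‖fderiv ℝ φ x‖ₑ ^ p ∂μ := by
  have hp0 : 0 < p := by linarith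
  have := hF.to_subtype
  let a : ℕ → E := fun i => (TopologicalSpace.denseSeq F i : E)
  have haF : range a ⊆ F := by rintro _ ⟨i, rfl⟩; exact Subtype.coe_prop _
  have hFa : F ⊆ closure (range a) := by
    intro x hx
    have h := (TopologicalSpace.denseRange_denseSeq F) ⟨x, hx⟩
    have := image_closure_subset_closure_image continuous_subtype_val (mem_image_of_mem _ h)
    rwa [← range_comp] at this
  have hdist (x : E) : infEDist x F = ⨅ i, edist x (a i) := by
    rw [← iInf_range (f := a) (g := fun y => edist x y)]
    exact le_antisymm (infEDist_anti haF) (infEDist_closure.symm.le.trans (infEDist_anti hFa))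
  have hsup (x : E) : (‖φ x‖ₑ / infEDist x F) ^ p =
      ⨆ N, ⨆ i ≤ N, (‖φ x‖ₑ / edist x (a i)) ^ p := by
    rw [hdist, ENNReal.div_eq_inv_mul, ENNReal.inv_iInf, ENNReal.iSup_mul]
    refine ((ENNReal.orderIsoRpow p hp0).map_iSup _).trans ?_
    simp only [ENNReal.orderIsoRpow_apply, ← ENNReal.div_eq_inv_mul]
    exact le_antisymm (iSup_le fun i => le_iSup_of_le i (le_iSup₂_of_le i le_rfl le_rfl))
      (iSup_le fun N => iSup₂_le fun i _ => le_iSup (fun i => (‖φ x‖ₑ / edist x (a i)) ^ p) i)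
  simp_rw [hsup]
  rw [lintegral_iSup]
  · exact iSup_le fun N => hardy_finite hp1 hp hφ (fun i => hφF _ (haF ⟨i, rfl⟩)) N
  · intro N
    refine .iSup fun i => .iSup fun _ => ?_
    exact ((hφ.continuous.enorm.measurable).div (by fun_prop)).pow_const p
  · intro N M hNM x
    exact biSup_mono fun i hi => hi.trans hNM

theorem setLIntegral_hardy_le {p : ℝ} (hp1 : 1 < p) (hp : (Module.finrank ℝ E : ℝ) < p)
    {Ω : Set E} (hΩ : IsOpen Ω) (hF : (frontier Ω).Nonempty) {φ : E → ℝ} (hφ : ContDiff ℝ 1 φ)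
    (hsupp : tsupport φ ⊆ Ω) :
    ∫⁻ x in Ω, ENNReal.ofReal (|φ x| ^ p * infDist x (frontier Ω) ^ (-p)) ∂μ ≤
      ENNReal.ofReal ((p / (p - Module.finrank ℝ E)) ^ p) *
        ∫⁻ x, ENNReal.ofReal (‖fderiv ℝ φ x‖ ^ p) ∂μ := by
  have hp0 : 0 < p := by linarith
  have hφF : ∀ x ∈ frontier Ω, φ x = 0 := fun x hx => by
    by_contra h
    exact (hΩ.frontier_eq ▸ hx).2 (hsupp (subset_tsupport φ h))
  have hpt : ∀ x ∈ Ω, ENNReal.ofReal (|φ x| ^ p * infDist x (frontier Ω) ^ (-p)) =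
      (‖φ x‖ₑ / infEDist x (frontier Ω)) ^ p := by
    intro x hx
    have hd := infDist_frontier_pos hΩ hF hx
    have hd' : infEDist x (frontier Ω) = ENNReal.ofReal (infDist x (frontier Ω)) :=
      (ENNReal.ofReal_toReal (infEDist_ne_top hF)).symm
    rw [hd', ← ofReal_norm, Real.norm_eq_abs, ← ENNReal.ofReal_div_of_pos hd,
      ENNReal.ofReal_rpow_of_nonneg (by positivity) hp0.le, Real.div_rpow (abs_nonneg _) hd.le,
      Real.rpow_neg hd.le, div_eq_mul_inv]
  rw [setLIntegral_congr_fun hΩ.measurableSet hpt]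
  refine (setLIntegral_le_lintegral _ _).trans ((hardy_infEDist hp1 hp hφ hF hφF).trans_eq ?_)
  rw [ENNReal.ofReal_rpow_of_nonneg (div_nonneg hp0.le (sub_nonneg.2 hp.le)) hp0.le]
  congr 1
  refine lintegral_congr fun x => ?_
  rw [← ofReal_norm, ENNReal.ofReal_rpow_of_nonneg (norm_nonneg _) hp0.le]

theorem integrableOn_hardy {p : ℝ} (hp1 : 1 < p) (hp : (Module.finrank ℝ E : ℝ) < p)
    {Ω : Set E} (hΩ : IsOpen Ω) (hF : (frontier Ω).Nonempty) {φ : E → ℝ} (hφ : ContDiff ℝ 1 φ)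
    (hcs : HasCompactSupport φ) (hsupp : tsupport φ ⊆ Ω) :
    IntegrableOn (fun x => |φ x| ^ p * infDist x (frontier Ω) ^ (-p)) Ω μ := by
  have hp0 : 0 < p := by linarith
  have hmeas : Measurable fun x => |φ x| ^ p * infDist x (frontier Ω) ^ (-p) :=
    (hφ.continuous.measurable.abs.pow_const p).mul (measurable_infDist.pow_const _)
  refine ⟨hmeas.aestronglyMeasurable, ?_⟩
  rw [hasFiniteIntegral_iff_ofReal (.of_forall fun x =>
    mul_nonneg (by positivity) (Real.rpow_nonneg infDist_nonneg _))]
  refine (setLIntegral_hardy_le hp1 hp hΩ hF hφ hsupp).trans_lt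
    (ENNReal.mul_lt_top ENNReal.ofReal_lt_top ?_)
  rw [← ofReal_integral_eq_lintegral_ofReal (integrable_norm_fderiv_rpow hp0 hφ hcs)
    (.of_forall fun x => by positivity)]
  exact ENNReal.ofReal_lt_top

/-- Hardy's inequality on an open set, for exponents larger than the dimension. -/
theorem hardy_of_isOpen {p : ℝ} (hp1 : 1 < p) (hp : (Module.finrank ℝ E : ℝ) < p)
    {Ω : Set E} (hΩ : IsOpen Ω) (hF : (frontier Ω).Nonempty) {φ : E → ℝ} (hφ : ContDiff ℝ 1 φ)
    (hcs : HasCompactSupport φ) (hsupp : tsupport φ ⊆ Ω) :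
    ((p - Module.finrank ℝ E) / p) ^ p *
        ∫ x in Ω, |φ x| ^ p * infDist x (frontier Ω) ^ (-p) ∂μ ≤
      ∫ x in Ω, ‖fderiv ℝ φ x‖ ^ p ∂μ := by
  have hp0 : 0 < p := by linarith
  have hpn : 0 < p - Module.finrank ℝ E := sub_pos.2 hp
  have hnn : 0 ≤ ∫ x, ‖fderiv ℝ φ x‖ ^ p ∂μ := integral_nonneg fun x => by positivity
  have hout : ∀ x, x ∉ Ω → ‖fderiv ℝ φ x‖ ^ p = 0 := fun x hx => by
    rw [image_eq_zero_of_notMem_tsupport fun h => hx (hsupp (tsupport_fderiv_subset ℝ h)),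
      norm_zero, Real.zero_rpow hp0.ne']
  have key := setLIntegral_hardy_le (μ := μ) hp1 hp hΩ hF hφ hsupp
  rw [← ofReal_integral_eq_lintegral_ofReal (integrableOn_hardy hp1 hp hΩ hF hφ hcs hsupp)
      (.of_forall fun x => mul_nonneg (by positivity) (Real.rpow_nonneg infDist_nonneg _)),
    ← ofReal_integral_eq_lintegral_ofReal (integrable_norm_fderiv_rpow hp0 hφ hcs)
      (.of_forall fun x => by positivity), ← ENNReal.ofReal_mul (by positivity),
    ENNReal.ofReal_le_ofReal_iff (by positivity)] at key
  rw [setIntegral_eq_integral_of_forall_compl_eq_zero hout, ← inv_div, Real.inv_rpow (by positivity),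
    inv_mul_le_iff₀ (by positivity)]
  exact key

/-- Some test function has a positive Hardy integral. -/
theorem exists_setIntegral_hardy_pos {p : ℝ} (hp1 : 1 < p) (hp : (Module.finrank ℝ E : ℝ) < p)
    {Ω : Set E} (hΩ : IsOpen Ω) (hΩne : Ω.Nonempty) (hF : (frontier Ω).Nonempty) :
    ∃ φ : E → ℝ, ContDiff ℝ (⊤ : ℕ∞) φ ∧ HasCompactSupport φ ∧ tsupport φ ⊆ Ω ∧
      0 < ∫ x in Ω, |φ x| ^ p * infDist x (frontier Ω) ^ (-p) ∂μ := by
  obtain ⟨x₀, hx₀⟩ := hΩne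
  obtain ⟨φ, hsupp, hcs, hφ, -, hφx⟩ :=
    exists_contDiff_tsupport_subset (n := ⊤) (hΩ.mem_nhds hx₀)
  refine ⟨φ, hφ, hcs, hsupp, ?_⟩
  rw [setIntegral_pos_iff_support_of_nonneg_ae
    (.of_forall fun x => mul_nonneg (by positivity) (Real.rpow_nonneg infDist_nonneg _))
    (integrableOn_hardy hp1 hp hΩ hF (hφ.of_le (by exact_mod_cast le_top)) hcs hsupp)]
  refine (hφ.continuous.isOpen_support.measure_pos μ ⟨x₀, by simp [hφx]⟩).trans_le
    (measure_mono fun x hx => ?_)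
  have hxΩ := hsupp (subset_tsupport φ hx)
  exact ⟨(mul_pos (Real.rpow_pos_of_pos (abs_pos.2 hx) _)
    (Real.rpow_pos_of_pos (infDist_frontier_pos hΩ hF hxΩ) _)).ne', hxΩ⟩

end Hardy

theorem stmt_14 (n : ℕ) (hn : 2 ≤ n) (p : ℝ) (hp : (n : ℝ) < p)
    (Ω : Set (EuclideanSpace ℝ (Fin n)))
    (hΩopen : IsOpen Ω) (hΩconn : IsConnected Ω) (hΩne : Ω.Nonempty)
    (hΩproper : Ω ≠ Set.univ) :
    (∀ φ : EuclideanSpace ℝ (Fin n) → ℝ, ContDiff ℝ (⊤ : ℕ∞) φ →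
      HasCompactSupport φ → tsupport φ ⊆ Ω →
      ∫ x in Ω, ‖fderiv ℝ φ x‖ ^ p ≥
        ((p - n) / p) ^ p * ∫ x in Ω, |φ x| ^ p * (infDist x (frontier Ω)) ^ (-p)) ∧
    ((p - n) / p) ^ p ≤
      sSup {c : ℝ | ∀ φ : EuclideanSpace ℝ (Fin n) → ℝ, ContDiff ℝ (⊤ : ℕ∞) φ →
        HasCompactSupport φ → tsupport φ ⊆ Ω →
        ∫ x in Ω, ‖fderiv ℝ φ x‖ ^ p ≥
          c * ∫ x in Ω, |φ x| ^ p * (infDist x (frontier Ω)) ^ (-p)} := by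
  have hF : (frontier Ω).Nonempty := nonempty_frontier_iff.2 ⟨hΩne, hΩproper⟩
  have hn' : (2 : ℝ) ≤ n := by exact_mod_cast hn
  have hp1 : 1 < p := by linarith
  have hpd : (Module.finrank ℝ (EuclideanSpace ℝ (Fin n)) : ℝ) < p := by simpa using hp
  have main : ∀ φ : EuclideanSpace ℝ (Fin n) → ℝ, ContDiff ℝ (⊤ : ℕ∞) φ →
      HasCompactSupport φ → tsupport φ ⊆ Ω →
      ∫ x in Ω, ‖fderiv ℝ φ x‖ ^ p ≥
        ((p - n) / p) ^ p * ∫ x in Ω, |φ x| ^ p * (infDist x (frontier Ω)) ^ (-p) := by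
    intro φ hφ hcs hsupp
    simpa using hardy_of_isOpen (μ := volume) hp1 hpd hΩopen hF
      (hφ.of_le (by exact_mod_cast le_top)) hcs hsupp
  refine ⟨main, le_csSup ?_ main⟩
  obtain ⟨φ, hφ, hcs, hsupp, hpos⟩ :=
    exists_setIntegral_hardy_pos (μ := volume) hp1 hpd hΩopen hΩne hF
  exact ⟨_, fun c hc => (le_div_iff₀ hpos).2 (hc φ hφ hcs hsupp)⟩
end

section
/- Let n ≥ 2, 1 < p < ∞, α + p > n, and let c_{α,p,n} = ((α+p−n)/p)^p. Then the constant c_{α,p,n} in the weighted Hardy inequality is sharp: for every μ > c_{α,p,n} there exists a domain Ω ⊊ ℝⁿ (namely Ω = ℝⁿ \ {y} for any y) and φ ∈ C_c^∞(Ω) such that ∫_Ω |∇φ|^p d_Ω^{−α} dx < μ ∫_Ω |φ|^p d_Ω^{−(p+α)} dx. -/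
open MeasureTheory Metric Set

/-- Integration of a radial function in logarithmic polar coordinates about `y`. -/
theorem integral_compl_singleton_radial_log (n : ℕ) (hn : 2 ≤ n) (y : EuclideanSpace ℝ (Fin n)) :
    ∃ C : ℝ, 0 < C ∧ ∀ K : ℝ → ℝ,
      ∫ x in ({y}ᶜ : Set (EuclideanSpace ℝ (Fin n))),
        ‖x - y‖ ^ (-(n : ℝ)) * K (Real.log ‖x - y‖) = C * ∫ t, K t := by
  have : Nonempty (Fin n) := ⟨⟨0, by omega⟩⟩
  refine ⟨n * volume.real (ball (0 : EuclideanSpace ℝ (Fin n)) 1), ?_, fun K => ?_⟩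
  · have h1 : 0 < volume.real (ball (0 : EuclideanSpace ℝ (Fin n)) 1) :=
      ENNReal.toReal_pos (measure_ball_pos _ _ one_pos).ne' measure_ball_lt_top.ne
    have h2 : (0 : ℝ) < n := by exact_mod_cast (by omega : 0 < n)
    positivity
  · rw [restrict_compl_singleton,
      integral_sub_right_eq_self
        (fun x : EuclideanSpace ℝ (Fin n) => ‖x‖ ^ (-(n : ℝ)) * K (Real.log ‖x‖)) y,
      integral_fun_norm_addHaar volume (fun r : ℝ => r ^ (-(n : ℝ)) * K (Real.log r)),
      finrank_euclideanSpace_fin]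
    have key := integral_image_eq_integral_abs_deriv_smul (s := univ) MeasurableSet.univ
      (fun x _ => (Real.hasDerivAt_exp x).hasDerivWithinAt) Real.exp_injective.injOn
      (fun r : ℝ => r ^ (n - 1) • (r ^ (-(n : ℝ)) * K (Real.log r)))
    rw [image_univ, Real.range_exp] at key
    rw [key, Measure.restrict_univ, nsmul_eq_mul, smul_eq_mul, mul_assoc]
    congr 3
    ext t
    have h : Real.exp t * Real.exp t ^ (n - 1) * Real.exp t ^ (-(n : ℝ)) = 1 := by
      rw [← pow_succ', Nat.sub_add_cancel (by omega), Real.rpow_neg (Real.exp_pos t).le,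
        Real.rpow_natCast, mul_inv_cancel₀ (by positivity)]
    rw [abs_of_pos (Real.exp_pos t), Real.log_exp, smul_eq_mul, smul_eq_mul, ← mul_assoc,
      ← mul_assoc, h, one_mul]

/-- A slowly varying profile almost saturates the one-dimensional inequality. -/
theorem exists_eps_integral_lt (G : ℝ → ℝ) (hG : ContDiff ℝ (⊤ : ℕ∞) G)
    (hsupp : HasCompactSupport G) (hne : G 0 ≠ 0) (β p μ : ℝ) (hβ : 0 < β) (hp : 1 < p)
    (hμ : β ^ p < μ) :
    ∃ ε : ℝ, 0 < ε ∧
      ∫ t, |β * G (ε * t) + ε * deriv G (ε * t)| ^ p < μ * ∫ t, |G (ε * t)| ^ p := by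
  have hp0 : 0 < p := by linarith
  have hG' : Continuous (deriv G) := hG.continuous_deriv (by simp)
  have hzero : ∀ ε t, t ∉ tsupport G → |β * G t + ε * deriv G t| ^ p = 0 := by
    intro ε t ht
    have h1 : G t = 0 := image_eq_zero_of_notMem_tsupport ht
    have h2 : deriv G t = 0 := by
      by_contra h
      exact ht (support_deriv_subset h)
    simp [h1, h2, hp0.ne']
  have hcont : Continuous fun ε : ℝ => ∫ t in tsupport G, |β * G t + ε * deriv G t| ^ p := by
    apply continuous_parametric_integral_of_continuous _ hsupp
    have := hG.continuous
    exact Continuous.rpow_const (by fun_prop) (fun _ => Or.inr hp0.le)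
  have hfull : ∀ ε : ℝ, ∫ t in tsupport G, |β * G t + ε * deriv G t| ^ p =
      ∫ t, |β * G t + ε * deriv G t| ^ p := fun ε =>
    setIntegral_eq_integral_of_forall_compl_eq_zero (hzero ε)
  simp only [hfull] at hcont
  have hpos : 0 < ∫ t, |G t| ^ p := by
    apply Continuous.integral_pos_of_hasCompactSupport_nonneg_nonzero (x := 0)
    · exact Continuous.rpow_const hG.continuous.abs (fun _ => Or.inr hp0.le)
    · exact hsupp.comp_left (g := fun s : ℝ => |s| ^ p) (by simp [hp0.ne'])
    · intro t
      positivity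
    · positivity
  have h0 : ∫ t, |β * G t + 0 * deriv G t| ^ p < μ * ∫ t, |G t| ^ p := by
    have : ∀ t, |β * G t + 0 * deriv G t| ^ p = β ^ p * |G t| ^ p := fun t => by
      rw [zero_mul, add_zero, abs_mul, abs_of_pos hβ, Real.mul_rpow hβ.le (abs_nonneg _)]
    simp only [this, integral_const_mul]
    exact mul_lt_mul_of_pos_right hμ hpos
  have hev := (hcont.tendsto 0).eventually_lt_const h0
  obtain ⟨ε, hε, hεpos⟩ :=
    ((hev.filter_mono nhdsWithin_le_nhds).and
      (self_mem_nhdsWithin : Ioi (0 : ℝ) ∈ nhdsWithin 0 (Ioi 0))).exists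
  have hεpos : 0 < ε := hεpos
  refine ⟨ε, hεpos, ?_⟩
  rw [Measure.integral_comp_mul_left (fun t => |β * G t + ε * deriv G t| ^ p) ε,
    Measure.integral_comp_mul_left (fun t => |G t| ^ p) ε, smul_eq_mul, smul_eq_mul,
    mul_left_comm]
  exact mul_lt_mul_of_pos_left hε (by positivity)

/-- The gradient of a radial function has the modulus of the radial derivative. -/
theorem norm_fderiv_radial {E : Type*} [NormedAddCommGroup E] [InnerProductSpace ℝ E]
    {h : ℝ → ℝ} {h' : ℝ} {x y : E} (hxy : x ≠ y) (hh : HasDerivAt h h' ‖x - y‖) :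
    ‖fderiv ℝ (fun z => h ‖z - y‖) x‖ = |h'| := by
  have hne : x - y ≠ 0 := sub_ne_zero.2 hxy
  have hd : DifferentiableAt ℝ (fun z : E => ‖z‖) (x - y) :=
    differentiableAt_id.norm ℝ hne
  have hd' : HasFDerivAt (fun z : E => ‖z - y‖) (fderiv ℝ (fun z : E => ‖z‖) (x - y)) x := by
    have := hd.hasFDerivAt.comp x ((hasFDerivAt_id x).sub_const y)
    rwa [ContinuousLinearMap.comp_id] at this
  have : Nontrivial E := ⟨x, y, hxy⟩
  have hcomp : HasFDerivAt (fun z => h ‖z - y‖) _ x := hh.comp_hasFDerivAt x hd'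
  rw [hcomp.fderiv, norm_smul, norm_fderiv_norm hd, mul_one, Real.norm_eq_abs]

theorem stmt_15 (n : ℕ) (hn : 2 ≤ n) (p α : ℝ) (hp1 : 1 < p)
    (hα : (n : ℝ) < α + p) (μ : ℝ) (hμ : ((α + p - n) / p) ^ p < μ) :
    ∀ y : EuclideanSpace ℝ (Fin n),
      ∃ φ : EuclideanSpace ℝ (Fin n) → ℝ, ContDiff ℝ (⊤ : ℕ∞) φ ∧
        HasCompactSupport φ ∧ tsupport φ ⊆ {y}ᶜ ∧
        ∫ x in ({y}ᶜ : Set (EuclideanSpace ℝ (Fin n))),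
            ‖fderiv ℝ φ x‖ ^ p * ‖x - y‖ ^ (-α) <
          μ * ∫ x in ({y}ᶜ : Set (EuclideanSpace ℝ (Fin n))),
            |φ x| ^ p * ‖x - y‖ ^ (-(p + α)) := by
  intro y
  have hp0 : 0 < p := by linarith
  set β := (α + p - n) / p with hβdef
  have hβ : 0 < β := div_pos (by linarith) hp0
  have hβp : β * p = α + p - n := div_mul_cancel₀ _ hp0.ne'
  let G : ContDiffBump (0 : ℝ) := ⟨1, 2, one_pos, one_lt_two⟩
  have hGs : ContDiff ℝ (⊤ : ℕ∞) G := G.contDiff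
  have hG0 : G 0 ≠ 0 := (G.pos_of_mem_ball (by simp [G])).ne'
  have hGsupp : ∀ t, G t ≠ 0 → |t| < 2 := fun t ht => by
    have : t ∈ Function.support G := ht
    rw [G.support_eq] at this
    simpa [G] using this
  obtain ⟨ε, hε, hlt⟩ := exists_eps_integral_lt G hGs G.hasCompactSupport hG0 β p μ hβ hp1 hμ
  obtain ⟨C, hC, hrad⟩ := integral_compl_singleton_radial_log n hn y
  set h : ℝ → ℝ := fun r => r ^ β * G (ε * Real.log r) with hh
  set φ : EuclideanSpace ℝ (Fin n) → ℝ := fun x => h ‖x - y‖ with hφ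
  set A : Set (EuclideanSpace ℝ (Fin n)) :=
    closedBall y (Real.exp (2 / ε)) \ ball y (Real.exp (-(2 / ε))) with hA
  have hAc : IsCompact A := (isCompact_closedBall y _).diff isOpen_ball
  have hsA : Function.support φ ⊆ A := by
    intro x hx
    have hx : ‖x - y‖ ^ β * G (ε * Real.log ‖x - y‖) ≠ 0 := hx
    have hr : 0 < ‖x - y‖ := by
      rcases (norm_nonneg (x - y)).eq_or_lt with h0 | h0
      · rw [← h0, Real.zero_rpow hβ.ne', zero_mul] at hx
        exact absurd rfl hx
      · exact h0
    have hl := abs_lt.1 (hGsupp _ (right_ne_zero_of_mul hx))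
    have h1 : Real.log ‖x - y‖ ≤ 2 / ε := by
      rw [le_div_iff₀ hε]; linarith
    have h2 : -(2 / ε) ≤ Real.log ‖x - y‖ := by
      rw [← neg_div, div_le_iff₀ hε]; linarith
    rw [hA, mem_sdiff, mem_closedBall, mem_ball, not_lt, dist_eq_norm]
    exact ⟨(Real.log_le_iff_le_exp hr).1 h1, (Real.le_log_iff_exp_le hr).1 h2⟩
  have htA : tsupport φ ⊆ A := closure_minimal hsA hAc.isClosed
  have hyA : A ⊆ {y}ᶜ := by
    rintro x ⟨-, hx⟩ rfl
    exact hx (mem_ball_self (Real.exp_pos _))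
  refine ⟨φ, ?_, hAc.of_isClosed_subset (isClosed_tsupport φ) htA, htA.trans hyA, ?_⟩
  · refine contDiff_iff_contDiffAt.2 fun x => ?_
    by_cases hx : x ∈ tsupport φ
    swap
    · exact contDiffAt_const.congr_of_eventuallyEq (notMem_tsupport_iff_eventuallyEq.1 hx)
    have hxy : x - y ≠ 0 := sub_ne_zero.2 (hyA (htA hx))
    have hn : ContDiffAt ℝ (⊤ : ℕ∞) (fun x => ‖x - y‖) x :=
      (contDiffAt_id.sub contDiffAt_const).norm ℝ hxy
    have hr : ‖x - y‖ ≠ 0 := norm_ne_zero_iff.2 hxy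
    exact (hn.rpow_const_of_ne hr).mul
      (hGs.contDiffAt.comp x (contDiffAt_const.mul (hn.log hr)))
  · have hL : ∫ x in ({y}ᶜ : Set (EuclideanSpace ℝ (Fin n))),
        ‖fderiv ℝ φ x‖ ^ p * ‖x - y‖ ^ (-α) =
        C * ∫ t, |β * G (ε * t) + ε * deriv G (ε * t)| ^ p := by
      rw [← hrad (fun t => |β * G (ε * t) + ε * deriv G (ε * t)| ^ p)]
      refine setIntegral_congr_fun (measurableSet_singleton y).compl fun x hx => ?_
      have hr : 0 < ‖x - y‖ := norm_pos_iff.2 (sub_ne_zero.2 hx)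
      have hd : HasDerivAt h (‖x - y‖ ^ (β - 1) * (β * G (ε * Real.log ‖x - y‖) +
          ε * deriv G (ε * Real.log ‖x - y‖))) ‖x - y‖ := by
        have hGd := (hGs.differentiable (by simp) (ε * Real.log ‖x - y‖)).hasDerivAt
        have := (Real.hasDerivAt_rpow_const (p := β) (Or.inl hr.ne')).mul
          (hGd.comp ‖x - y‖ ((Real.hasDerivAt_log hr.ne').const_mul ε))
        refine this.congr_deriv ?_
        rw [Real.rpow_sub_one hr.ne']
        simp only [Function.comp_apply]
        field_simp
      have hn := norm_fderiv_radial hx hd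
      simp only [hφ]
      rw [hn, abs_mul, abs_of_pos (Real.rpow_pos_of_pos hr _),
        Real.mul_rpow (Real.rpow_nonneg hr.le _) (abs_nonneg _), ← Real.rpow_mul hr.le,
        mul_right_comm, ← Real.rpow_add hr]
      congr 2
      linarith
    have hR : ∫ x in ({y}ᶜ : Set (EuclideanSpace ℝ (Fin n))),
        |φ x| ^ p * ‖x - y‖ ^ (-(p + α)) = C * ∫ t, |G (ε * t)| ^ p := by
      rw [← hrad (fun t => |G (ε * t)| ^ p)]
      refine setIntegral_congr_fun (measurableSet_singleton y).compl fun x hx => ?_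
      have hr : 0 < ‖x - y‖ := norm_pos_iff.2 (sub_ne_zero.2 hx)
      simp only [hφ, hh]
      rw [abs_mul, abs_of_pos (Real.rpow_pos_of_pos hr _),
        Real.mul_rpow (Real.rpow_nonneg hr.le _) (abs_nonneg _), ← Real.rpow_mul hr.le,
        mul_right_comm, ← Real.rpow_add hr]
      congr 2
      linarith
    rw [hL, hR, mul_left_comm]
    exact mul_lt_mul_of_pos_left hlt hC
end
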